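/- Convergence of the finite-control approximation: under Assumption (A), fix ε ∈ (0,1) and a family (A_δ)_{δ∈(0,1]} of finite nonempty subsets of A with sup_{α∈A} min_{α'∈A_δ} |α−α'| < δ for every δ ∈ (0,1]. Let u^ε be a viscosity solution of the A-HJBVI (the A'-HJBVI with A' = A) and, for each δ ∈ (0,1], let u^{ε,δ} be a viscosity solution of the A_δ-HJBVI, and assume sup_{δ∈(0,1]} sup_{[0,T]×ℝ^d} |u^{ε,δ}| < ∞. Then u^{ε,δ} converges to u^ε uniformly on every compact subset of [0,T]×ℝ^d as δ → 0. -/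

import Mathlib

open MeasureTheory Set Filter Topology Metric
open scoped RealInnerProductSpace Matrix

attribute [local instance] Matrix.normedAddCommGroup Matrix.normedSpace

noncomputable section

abbrev Vec (d : ℕ) := EuclideanSpace ℝ (Fin d)

structure C12 (d : ℕ) where
  toFun : ℝ → Vec d → ℝ
  dt : ℝ → Vec d → ℝ
  grad : ℝ → Vec d → Vec d
  hess : ℝ → Vec d → Matrix (Fin d) (Fin d) ℝ
  hasDt : ∀ t x, HasDerivAt (fun s => toFun s x) (dt t x) t
  hasGrad : ∀ t x, HasGradientAt (toFun t) (grad t x) x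
  hasHess : ∀ t x, HasFDerivAt (grad t)
      ((Matrix.toEuclideanLin (hess t x)).toContinuousLinearMap) x
  cont : Continuous fun p : ℝ × Vec d => toFun p.1 p.2
  cont_dt : Continuous fun p : ℝ × Vec d => dt p.1 p.2
  cont_grad : Continuous fun p : ℝ × Vec d => grad p.1 p.2
  cont_hess : Continuous fun p : ℝ × Vec d => hess p.1 p.2

def mvE {d : ℕ} (M : Matrix (Fin d) (Fin d) ℝ) (v : Vec d) : Vec d :=
  (EuclideanSpace.equiv (Fin d) ℝ).symm (M.mulVec ((EuclideanSpace.equiv (Fin d) ℝ) v))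

variable {n d m : ℕ}

/-- Assumption (A) of the paper. -/
structure AssumptionA (ν : Measure (Vec n)) (A : Set (Vec m)) (T : ℝ)
    (b : Vec m → Vec d → Vec d) (σ : Vec m → Vec d → Matrix (Fin d) (Fin d) ℝ)
    (η : Vec m → Vec d → Vec n → Vec d) (γ : Vec d → Vec n → ℝ)
    (f : Vec m → ℝ → Vec d → ℝ → Vec d → ℝ → ℝ)
    (ζ : ℝ → Vec d → ℝ) (g : Vec d → ℝ) (C : ℝ) : Prop where
  hC : 0 < C
  hT : 0 < T
  hAcpt : IsCompact A
  hAne : A.Nonempty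
  hν_sf : SigmaFinite ν
  hν_zero : ν {0} = 0
  hν_int : Integrable (fun e => min 1 (‖e‖ ^ 2)) ν
  hη_meas : ∀ α x, Measurable (η α x)
  hγ_meas : ∀ x, Measurable (γ x)
  hb : ∀ α ∈ A, ∀ α' ∈ A, ∀ x x' : Vec d,
      ‖b α x - b α' x'‖ + ‖σ α x - σ α' x'‖ ≤ C * (‖x - x'‖ + ‖α - α'‖)
  hη_lip : ∀ α ∈ A, ∀ α' ∈ A, ∀ (x x' : Vec d) (e : Vec n),
      ‖η α x e - η α' x' e‖ ≤ C * (‖x - x'‖ + ‖α - α'‖) * min 1 ‖e‖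
  hη_bdd : ∀ α ∈ A, ∀ (x : Vec d) (e : Vec n), ‖η α x e‖ ≤ C * min 1 ‖e‖
  hγ_lip : ∀ (x x' : Vec d) (e : Vec n),
      |γ x e - γ x' e| ≤ C * ‖x - x'‖ * min 1 (‖e‖ ^ 2)
  hγ_nonneg : ∀ x e, 0 ≤ γ x e
  hγ_bdd : ∀ (x : Vec d) (e : Vec n), γ x e ≤ C * min 1 ‖e‖
  hf_t_cont : ∀ α x u p k, Continuous fun t => f α t x u p k
  hf_bdd : ∀ α ∈ A, ∀ t ∈ Icc (0:ℝ) T, ∀ x : Vec d, |f α t x 0 0 0| ≤ C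
  hf_mono : ∀ α ∈ A, ∀ t ∈ Icc (0:ℝ) T, ∀ (x : Vec d) (p : Vec d) (k u v : ℝ),
      v ≤ u → C * (u - v) ≤ f α t x v p k - f α t x u p k
  hf_k_mono : ∀ α ∈ A, ∀ t ∈ Icc (0:ℝ) T, ∀ (x : Vec d) (u : ℝ) (p : Vec d),
      Monotone fun k => f α t x u p k
  hf_lip : ∀ α ∈ A, ∀ α' ∈ A, ∀ t ∈ Icc (0:ℝ) T, ∀ (x : Vec d) (u v : ℝ) (p q : Vec d) (k k' : ℝ),
      |f α t x u p k - f α' t x v q k'| ≤ C * (‖α - α'‖ + |u - v| + ‖p - q‖ + |k - k'|)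
  hf_x : ∀ R > (0:ℝ), ∃ mR : ℝ → ℝ, Continuous mR ∧ mR 0 = 0 ∧ (∀ r, 0 ≤ mR r) ∧
      ∀ α ∈ A, ∀ t ∈ Icc (0:ℝ) T, ∀ (x x' : Vec d) (u : ℝ) (p : Vec d) (k : ℝ),
        ‖x‖ ≤ R → ‖x'‖ ≤ R → |u| ≤ R →
        |f α t x u p k - f α t x' u p k| ≤ mR (‖x - x'‖ * (1 + ‖p‖))
  hζ_t_cont : ∀ x, Continuous fun t => ζ t x
  hζg_lip : ∀ (t : ℝ) (x x' : Vec d), |g x - g x'| + |ζ t x - ζ t x'| ≤ C * ‖x - x'‖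
  hζg_bdd : ∀ (t : ℝ) (x : Vec d), |g x| + |ζ t x| ≤ C
  hgζ : ∀ x, ζ 0 x ≤ g x

/-- The nonlocal operator `K^α`. -/
def Kop (ν : Measure (Vec n)) (η : Vec m → Vec d → Vec n → Vec d)
    (φ : C12 d) (α : Vec m) (t : ℝ) (x : Vec d) : ℝ :=
  ∫ e, (φ.toFun t (x + η α x e) - φ.toFun t x - ⟪η α x e, φ.grad t x⟫) ∂ν

/-- The nonlocal operator `B^α`. -/
def Bop (ν : Measure (Vec n)) (η : Vec m → Vec d → Vec n → Vec d) (γ : Vec d → Vec n → ℝ)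
    (φ : C12 d) (α : Vec m) (t : ℝ) (x : Vec d) : ℝ :=
  ∫ e, (φ.toFun t (x + η α x e) - φ.toFun t x) * γ x e ∂ν

/-- The local operator `A^α`. -/
def Aop (b : Vec m → Vec d → Vec d) (σ : Vec m → Vec d → Matrix (Fin d) (Fin d) ℝ)
    (φ : C12 d) (α : Vec m) (t : ℝ) (x : Vec d) : ℝ :=
  (1/2) * Matrix.trace (σ α x * (σ α x)ᵀ * φ.hess t x) + ⟪b α x, φ.grad t x⟫

/-- `L^α = A^α + K^α`. -/
def Lop (ν : Measure (Vec n)) (b : Vec m → Vec d → Vec d)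
    (σ : Vec m → Vec d → Matrix (Fin d) (Fin d) ℝ) (η : Vec m → Vec d → Vec n → Vec d)
    (φ : C12 d) (α : Vec m) (t : ℝ) (x : Vec d) : ℝ :=
  Aop b σ φ α t x + Kop ν η φ α t x

/-- Modified diffusion matrix `σ̃`. -/
def sigmaTilde (ν : Measure (Vec n)) (σ : Vec m → Vec d → Matrix (Fin d) (Fin d) ℝ)
    (η : Vec m → Vec d → Vec n → Vec d) (ε : ℝ) (α : Vec m) (x : Vec d) :
    Matrix (Fin d) (Fin d) ℝ :=
  Matrix.of fun i j =>
    if i = j then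
      Real.sqrt ((σ α x i i) ^ 2 + ∫ e in {e : Vec n | ‖e‖ < ε}, (η α x e i) ^ 2 ∂ν)
    else σ α x i j

/-- Truncated `K_ε^α`. -/
def Ktr (ν : Measure (Vec n)) (η : Vec m → Vec d → Vec n → Vec d) (ε : ℝ)
    (φ : C12 d) (α : Vec m) (t : ℝ) (x : Vec d) : ℝ :=
  Kop (ν.restrict {e : Vec n | ε < ‖e‖}) η φ α t x

/-- Truncated `B_ε^α`. -/
def Btr (ν : Measure (Vec n)) (η : Vec m → Vec d → Vec n → Vec d) (γ : Vec d → Vec n → ℝ)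
    (ε : ℝ) (φ : C12 d) (α : Vec m) (t : ℝ) (x : Vec d) : ℝ :=
  Bop (ν.restrict {e : Vec n | ε < ‖e‖}) η γ φ α t x

/-- Truncated `L_ε^α`. -/
def Ltr (ν : Measure (Vec n)) (b : Vec m → Vec d → Vec d)
    (σ : Vec m → Vec d → Matrix (Fin d) (Fin d) ℝ) (η : Vec m → Vec d → Vec n → Vec d)
    (ε : ℝ) (φ : C12 d) (α : Vec m) (t : ℝ) (x : Vec d) : ℝ :=
  (1/2) * Matrix.trace (sigmaTilde ν σ η ε α x * (sigmaTilde ν σ η ε α x)ᵀ * φ.hess t x)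
    + ⟪b α x, φ.grad t x⟫ + Ktr ν η ε φ α t x

/-- Viscosity subsolution of the HJBVI
`min{ u − ζ, ∂ₜu + inf_{α∈A}( −L^α u − f(α,t,x,u,σᵀDu,B^α u) ) } = 0`. -/
def SubsolnHJBVI (ν : Measure (Vec n)) (A : Set (Vec m)) (T : ℝ)
    (b : Vec m → Vec d → Vec d) (σ : Vec m → Vec d → Matrix (Fin d) (Fin d) ℝ)
    (η : Vec m → Vec d → Vec n → Vec d) (γ : Vec d → Vec n → ℝ)
    (f : Vec m → ℝ → Vec d → ℝ → Vec d → ℝ → ℝ) (ζ : ℝ → Vec d → ℝ)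
    (u : ℝ → Vec d → ℝ) : Prop :=
  ∀ (φ : C12 d) (t₀ : ℝ) (x₀ : Vec d), t₀ ∈ Ioc (0:ℝ) T →
    (∀ t ∈ Icc (0:ℝ) T, ∀ x, u t x - φ.toFun t x ≤ u t₀ x₀ - φ.toFun t₀ x₀) →
    min (u t₀ x₀ - ζ t₀ x₀)
      (φ.dt t₀ x₀ + ⨅ α : A, (-(Lop ν b σ η φ (↑α) t₀ x₀)
        - f (↑α) t₀ x₀ (u t₀ x₀) (mvE ((σ (↑α) x₀)ᵀ) (φ.grad t₀ x₀))
            (Bop ν η γ φ (↑α) t₀ x₀))) ≤ 0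

/-- Viscosity supersolution of the HJBVI. -/
def SupersolnHJBVI (ν : Measure (Vec n)) (A : Set (Vec m)) (T : ℝ)
    (b : Vec m → Vec d → Vec d) (σ : Vec m → Vec d → Matrix (Fin d) (Fin d) ℝ)
    (η : Vec m → Vec d → Vec n → Vec d) (γ : Vec d → Vec n → ℝ)
    (f : Vec m → ℝ → Vec d → ℝ → Vec d → ℝ → ℝ) (ζ : ℝ → Vec d → ℝ)
    (u : ℝ → Vec d → ℝ) : Prop :=
  ∀ (φ : C12 d) (t₀ : ℝ) (x₀ : Vec d), t₀ ∈ Ioc (0:ℝ) T →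
    (∀ t ∈ Icc (0:ℝ) T, ∀ x, u t₀ x₀ - φ.toFun t₀ x₀ ≤ u t x - φ.toFun t x) →
    0 ≤ min (u t₀ x₀ - ζ t₀ x₀)
      (φ.dt t₀ x₀ + ⨅ α : A, (-(Lop ν b σ η φ (↑α) t₀ x₀)
        - f (↑α) t₀ x₀ (u t₀ x₀) (mvE ((σ (↑α) x₀)ᵀ) (φ.grad t₀ x₀))
            (Bop ν η γ φ (↑α) t₀ x₀)))

/-- Viscosity subsolution of the `A'`-HJBVI with `ε`-truncated operators. -/
def SubsolnHJBVIe (ν : Measure (Vec n)) (A' : Set (Vec m)) (T : ℝ)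
    (b : Vec m → Vec d → Vec d) (σ : Vec m → Vec d → Matrix (Fin d) (Fin d) ℝ)
    (η : Vec m → Vec d → Vec n → Vec d) (γ : Vec d → Vec n → ℝ)
    (f : Vec m → ℝ → Vec d → ℝ → Vec d → ℝ → ℝ) (ζ : ℝ → Vec d → ℝ) (ε : ℝ)
    (u : ℝ → Vec d → ℝ) : Prop :=
  ∀ (φ : C12 d) (t₀ : ℝ) (x₀ : Vec d), t₀ ∈ Ioc (0:ℝ) T →
    (∀ t ∈ Icc (0:ℝ) T, ∀ x, u t x - φ.toFun t x ≤ u t₀ x₀ - φ.toFun t₀ x₀) →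
    min (u t₀ x₀ - ζ t₀ x₀)
      (φ.dt t₀ x₀ + ⨅ α : A', (-(Ltr ν b σ η ε φ (↑α) t₀ x₀)
        - f (↑α) t₀ x₀ (u t₀ x₀) (mvE ((sigmaTilde ν σ η ε (↑α) x₀)ᵀ) (φ.grad t₀ x₀))
            (Btr ν η γ ε φ (↑α) t₀ x₀))) ≤ 0

/-- Viscosity supersolution of the `A'`-HJBVI with `ε`-truncated operators. -/
def SupersolnHJBVIe (ν : Measure (Vec n)) (A' : Set (Vec m)) (T : ℝ)
    (b : Vec m → Vec d → Vec d) (σ : Vec m → Vec d → Matrix (Fin d) (Fin d) ℝ)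
    (η : Vec m → Vec d → Vec n → Vec d) (γ : Vec d → Vec n → ℝ)
    (f : Vec m → ℝ → Vec d → ℝ → Vec d → ℝ → ℝ) (ζ : ℝ → Vec d → ℝ) (ε : ℝ)
    (u : ℝ → Vec d → ℝ) : Prop :=
  ∀ (φ : C12 d) (t₀ : ℝ) (x₀ : Vec d), t₀ ∈ Ioc (0:ℝ) T →
    (∀ t ∈ Icc (0:ℝ) T, ∀ x, u t₀ x₀ - φ.toFun t₀ x₀ ≤ u t x - φ.toFun t x) →
    0 ≤ min (u t₀ x₀ - ζ t₀ x₀)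
      (φ.dt t₀ x₀ + ⨅ α : A', (-(Ltr ν b σ η ε φ (↑α) t₀ x₀)
        - f (↑α) t₀ x₀ (u t₀ x₀) (mvE ((sigmaTilde ν σ η ε (↑α) x₀)ᵀ) (φ.grad t₀ x₀))
            (Btr ν η γ ε φ (↑α) t₀ x₀)))

/-- The switching obstacle `M_j U = max_{k ≠ j} (U_k − c)`. -/
def MaxSw {J : ℕ} (U : Fin J → ℝ → Vec d → ℝ) (c : ℝ) (j : Fin J) (t : ℝ) (x : Vec d) : ℝ :=
  ⨆ k : {k : Fin J // k ≠ j}, (U (↑k) t x - c)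

/-- Viscosity subsolution of the switching system. -/
def SubsolnSwitch (ν : Measure (Vec n)) (T : ℝ)
    (b : Vec m → Vec d → Vec d) (σ : Vec m → Vec d → Matrix (Fin d) (Fin d) ℝ)
    (η : Vec m → Vec d → Vec n → Vec d) (γ : Vec d → Vec n → ℝ)
    (f : Vec m → ℝ → Vec d → ℝ → Vec d → ℝ → ℝ) (ζ : ℝ → Vec d → ℝ) (ε : ℝ)
    {J : ℕ} (αs : Fin J → Vec m) (c : ℝ) (U : Fin J → ℝ → Vec d → ℝ) : Prop :=
  ∀ (j : Fin J) (φ : C12 d) (t₀ : ℝ) (x₀ : Vec d), t₀ ∈ Ioc (0:ℝ) T →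
    (∀ t ∈ Icc (0:ℝ) T, ∀ x, U j t x - φ.toFun t x ≤ U j t₀ x₀ - φ.toFun t₀ x₀) →
    min (U j t₀ x₀ - ζ t₀ x₀)
      (min (φ.dt t₀ x₀ - Ltr ν b σ η ε φ (αs j) t₀ x₀
          - f (αs j) t₀ x₀ (U j t₀ x₀)
              (mvE ((sigmaTilde ν σ η ε (αs j) x₀)ᵀ) (φ.grad t₀ x₀))
              (Btr ν η γ ε φ (αs j) t₀ x₀))
        (U j t₀ x₀ - MaxSw U c j t₀ x₀)) ≤ 0

/-- Viscosity supersolution of the switching system. -/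
def SupersolnSwitch (ν : Measure (Vec n)) (T : ℝ)
    (b : Vec m → Vec d → Vec d) (σ : Vec m → Vec d → Matrix (Fin d) (Fin d) ℝ)
    (η : Vec m → Vec d → Vec n → Vec d) (γ : Vec d → Vec n → ℝ)
    (f : Vec m → ℝ → Vec d → ℝ → Vec d → ℝ → ℝ) (ζ : ℝ → Vec d → ℝ) (ε : ℝ)
    {J : ℕ} (αs : Fin J → Vec m) (c : ℝ) (U : Fin J → ℝ → Vec d → ℝ) : Prop :=
  ∀ (j : Fin J) (φ : C12 d) (t₀ : ℝ) (x₀ : Vec d), t₀ ∈ Ioc (0:ℝ) T →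
    (∀ t ∈ Icc (0:ℝ) T, ∀ x, U j t₀ x₀ - φ.toFun t₀ x₀ ≤ U j t x - φ.toFun t x) →
    0 ≤ min (U j t₀ x₀ - ζ t₀ x₀)
      (min (φ.dt t₀ x₀ - Ltr ν b σ η ε φ (αs j) t₀ x₀
          - f (αs j) t₀ x₀ (U j t₀ x₀)
              (mvE ((sigmaTilde ν σ η ε (αs j) x₀)ᵀ) (φ.grad t₀ x₀))
              (Btr ν η γ ε φ (αs j) t₀ x₀))
        (U j t₀ x₀ - MaxSw U c j t₀ x₀))

section SecondOrder

variable {V : Type*} [NormedAddCommGroup V] [InnerProductSpace ℝ V]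

/-- `W` lies above a downward paraboloid of opening `Λ` touching it at any given point. -/
def Semiconvex (Λ : ℝ) (W : V → ℝ) : Prop :=
  ∀ z, ∃ p : V, ∀ y, W z + ⟪p, y - z⟫ - Λ / 2 * ‖y - z‖ ^ 2 ≤ W y

/-- Second-order Taylor expansion of `W` at `z` with gradient `q` and Hessian `H`. -/
def HasTaylor2 (W : V → ℝ) (z q : V) (H : V →L[ℝ] V) : Prop :=
  ∀ κ > 0, ∀ᶠ y in 𝓝 z,
    |W y - W z - ⟪q, y - z⟫ - 1 / 2 * ⟪H (y - z), y - z⟫| ≤ κ * ‖y - z‖ ^ 2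

lemma norm_sq_eq_add_sub (z y : V) :
    ‖y‖ ^ 2 = ‖z‖ ^ 2 + 2 * ⟪z, y - z⟫ + ‖y - z‖ ^ 2 := by
  have h := norm_add_sq_real z (y - z)
  rwa [add_sub_cancel] at h

lemma convexOn_of_subgradient {h : V → ℝ} {P : V → V}
    (hP : ∀ z y, h z + ⟪P z, y - z⟫ ≤ h y) : ConvexOn ℝ univ h := by
  refine ⟨convex_univ, fun x _ y _ a b ha hb hab => ?_⟩
  set w := a • x + b • y
  have h1 := mul_le_mul_of_nonneg_left (hP w x) ha
  have h2 := mul_le_mul_of_nonneg_left (hP w y) hb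
  have h3 : a * ⟪P w, x - w⟫ + b * ⟪P w, y - w⟫ = 0 := by
    rw [← inner_smul_right, ← inner_smul_right, ← inner_add_right]
    have : a • (x - w) + b • (y - w) = (0 : V) := by
      have : a • (x - w) + b • (y - w) = (a • x + b • y) - (a + b) • w := by module
      rw [this, hab, one_smul, sub_self]
    rw [this, inner_zero_right]
  have h4 : h w = (a + b) * h w := by rw [hab, one_mul]
  simp only [smul_eq_mul]
  nlinarith

lemma Semiconvex.exists_strong_subgradient {Λ : ℝ} {W : V → ℝ} (hW : Semiconvex Λ W) :
    ∃ P : V → V, ∀ z y, (W z + Λ * ‖z‖ ^ 2) + ⟪P z, y - z⟫ + Λ / 2 * ‖y - z‖ ^ 2 ≤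
      W y + Λ * ‖y‖ ^ 2 := by
  choose p hp using hW
  refine ⟨fun z => p z + (2 * Λ) • z, fun z y => ?_⟩
  have h1 := hp z y
  rw [inner_add_left, inner_smul_left, norm_sq_eq_add_sub z y]
  simp only [conj_trivial]
  nlinarith

lemma Semiconvex.continuous [FiniteDimensional ℝ V] {Λ : ℝ} (hΛ : 0 ≤ Λ) {W : V → ℝ}
    (hW : Semiconvex Λ W) : Continuous W := by
  obtain ⟨P, hP⟩ := hW.exists_strong_subgradient
  have h1 : Continuous fun y => W y + Λ * ‖y‖ ^ 2 := by
    rw [← continuousOn_univ]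
    refine (convexOn_of_subgradient (P := P) fun z y => ?_).continuousOn isOpen_univ
    have := hP z y
    have : 0 ≤ Λ / 2 * ‖y - z‖ ^ 2 := by positivity
    linarith
  have h2 : W = fun y => (W y + Λ * ‖y‖ ^ 2) - Λ * ‖y‖ ^ 2 := by ext; ring
  rw [h2]
  exact h1.sub (by fun_prop)

/-- A one-dimensional mean value inequality for functions with an affinely bounded slope. -/
lemma sub_le_of_slope_le_affine {φ : ℝ → ℝ} (hφ : ContinuousOn φ (Icc 0 1)) {α β : ℝ}
    (h : ∀ s ∈ Icc (0 : ℝ) 1, ∀ t ∈ Icc (0 : ℝ) 1, s < t →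
      φ t - φ s ≤ (t - s) * (α + max (β * s) (β * t))) :
    φ 1 - φ 0 ≤ α + β / 2 := by
  have key := image_le_of_liminf_slope_right_le_deriv_boundary (a := 0) (b := 1) hφ
    (B := fun t => φ 0 + (α * t + β / 2 * t ^ 2)) (B' := fun t => α + β * t) (by simp)
    (by fun_prop) (fun x _ => ?_) (fun x hx r hr => ?_)
  · have := key (right_mem_Icc.2 zero_le_one)
    linarith
  · have h1 : HasDerivAt (fun t : ℝ => φ 0 + (α * t + β / 2 * t ^ 2)) (α + β * x) x := by
      have := (((hasDerivAt_id x).const_mul α).add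
        (((hasDerivAt_id x).pow 2).const_mul (β / 2))).const_add (φ 0)
      exact this.congr_deriv (by simp; ring)
    exact h1.hasDerivWithinAt
  · have hc : ContinuousAt (fun t => α + max (β * x) (β * t)) x := by fun_prop
    have h1 : ∀ᶠ t in 𝓝[>] x, α + max (β * x) (β * t) < r :=
      (hc.eventually_lt_const (by simpa using hr)).filter_mono nhdsWithin_le_nhds
    have h2 : ∀ᶠ t in 𝓝[>] x, t ∈ Ioo x 1 := Ioo_mem_nhdsGT hx.2
    refine (h1.and h2).frequently.mono fun t ht => ?_
    have h3 := h x ⟨hx.1, hx.2.le⟩ t ⟨hx.1.trans ht.2.1.le, ht.2.2.le⟩ ht.2.1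
    rw [slope_def_field, div_lt_iff₀ (by linarith [ht.2.1])]
    nlinarith [ht.1, ht.2.1]

lemma hasTaylor2_of_subgradient [FiniteDimensional ℝ V] {h : V → ℝ} {P : V → V}
    (hP : ∀ z y, h z + ⟪P z, y - z⟫ ≤ h y) {z : V} {H : V →L[ℝ] V}
    (hH : ∀ κ > 0, ∀ᶠ y in 𝓝 z, ‖P y - P z - H (y - z)‖ ≤ κ * ‖y - z‖) :
    HasTaylor2 h z (P z) H := by
  have hcont : Continuous h := by
    rw [← continuousOn_univ]
    exact (convexOn_of_subgradient hP).continuousOn isOpen_univ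
  intro κ hκ
  obtain ⟨ρ, hρ, hb⟩ := Metric.eventually_nhds_iff.1 (hH κ hκ)
  refine Metric.eventually_nhds_iff.2 ⟨ρ, hρ, fun y hy => ?_⟩
  set v := y - z with hv
  have hyv : y = z + v := by simp [hv]
  have hline : Continuous fun t : ℝ => h (z + t • v) := by fun_prop
  have hPt : ∀ t ∈ Icc (0 : ℝ) 1,
      |⟪P (z + t • v), v⟫ - (⟪P z, v⟫ + t * ⟪H v, v⟫)| ≤ κ * ‖v‖ ^ 2 := by
    intro t ht
    have h1 : ‖t • v‖ ≤ ‖v‖ := by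
      rw [norm_smul, Real.norm_eq_abs, abs_of_nonneg ht.1]
      exact mul_le_of_le_one_left (norm_nonneg _) ht.2
    have h2 : ‖P (z + t • v) - P z - H (t • v)‖ ≤ κ * ‖t • v‖ := by
      have := @hb (z + t • v) (by
        rw [dist_eq_norm, add_sub_cancel_left]
        rw [dist_eq_norm] at hy
        exact h1.trans_lt hy)
      rwa [add_sub_cancel_left] at this
    have h3 : ⟪P (z + t • v), v⟫ - (⟪P z, v⟫ + t * ⟪H v, v⟫)
        = ⟪P (z + t • v) - P z - H (t • v), v⟫ := by
      rw [inner_sub_left, inner_sub_left, map_smul, inner_smul_left]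
      simp; ring
    rw [h3]
    calc _ ≤ ‖P (z + t • v) - P z - H (t • v)‖ * ‖v‖ := abs_real_inner_le_norm _ _
      _ ≤ (κ * ‖v‖) * ‖v‖ := by gcongr; exact h2.trans (by gcongr)
      _ = _ := by ring
  have hslope : ∀ s t : ℝ, h (z + s • v) + (t - s) * ⟪P (z + s • v), v⟫ ≤ h (z + t • v) := by
    intro s t
    have := hP (z + s • v) (z + t • v)
    have e : z + t • v - (z + s • v) = (t - s) • v := by module
    rwa [e, inner_smul_right] at this
  have up := sub_le_of_slope_le_affine (φ := fun t => h (z + t • v)) hline.continuousOn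
    (α := ⟪P z, v⟫ + κ * ‖v‖ ^ 2) (β := ⟪H v, v⟫) (by
      intro s _ t ht hst
      have h1 := hslope t s
      have h2 := (abs_le.1 (hPt t ht)).2
      have h3 := le_max_right (⟪H v, v⟫ * s) (⟪H v, v⟫ * t)
      have h4 : (t - s) * ⟪P (z + t • v), v⟫ ≤
          (t - s) * (⟪P z, v⟫ + κ * ‖v‖ ^ 2 + max (⟪H v, v⟫ * s) (⟪H v, v⟫ * t)) :=
        mul_le_mul_of_nonneg_left (by linarith) (by linarith)
      linarith)
  have lo := sub_le_of_slope_le_affine (φ := fun t => - h (z + t • v)) hline.neg.continuousOn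
    (α := - ⟪P z, v⟫ + κ * ‖v‖ ^ 2) (β := - ⟪H v, v⟫) (by
      intro s hs t _ hst
      have h1 := hslope s t
      have h2 := (abs_le.1 (hPt s hs)).1
      have h3 := le_max_left (-⟪H v, v⟫ * s) (-⟪H v, v⟫ * t)
      have h4 : (t - s) * -⟪P (z + s • v), v⟫ ≤
          (t - s) * (-⟪P z, v⟫ + κ * ‖v‖ ^ 2 + max (-⟪H v, v⟫ * s) (-⟪H v, v⟫ * t)) :=
        mul_le_mul_of_nonneg_left (by linarith) (by linarith)
      linarith)
  simp only [one_smul, zero_smul, add_zero, ← hyv] at up lo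
  rw [abs_le]
  constructor <;> linarith

lemma exists_equiv_of_taylor_inverse [FiniteDimensional ℝ V] {P : V → V} {z : V}
    {A : V →L[ℝ] V}
    (hA : ∀ κ > 0, ∀ᶠ y in 𝓝 z, ‖y - z - A (P y - P z)‖ ≤ κ * ‖y - z‖) :
    ∃ H : V →L[ℝ] V, ∀ κ > 0, ∀ᶠ y in 𝓝 z, ‖P y - P z - H (y - z)‖ ≤ κ * ‖y - z‖ := by
  have hsurj : Function.Surjective A := by
    intro v
    have hcl : IsClosed (A.range : Set V) := Submodule.closed_of_finiteDimensional _
    suffices v ∈ closure (A.range : Set V) by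
      rw [hcl.closure_eq] at this
      exact this
    rw [Metric.mem_closure_iff]
    intro e he
    rcases eq_or_ne v 0 with rfl | hv
    · exact ⟨0, ⟨0, by simp⟩, by simpa using he⟩
    have hv' : 0 < ‖v‖ := norm_pos_iff.2 hv
    obtain ⟨ρ, hρ, hb⟩ := Metric.eventually_nhds_iff.1 (hA (e / (2 * ‖v‖)) (by positivity))
    set s := ρ / (2 * ‖v‖) with hs
    have hs0 : 0 < s := by positivity
    have hsv : ‖s • v‖ = s * ‖v‖ := by
      rw [norm_smul, Real.norm_eq_abs, abs_of_pos hs0]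
    have h1 := @hb (z + s • v) (by
      rw [dist_eq_norm, add_sub_cancel_left, hsv, hs]
      have : ρ / (2 * ‖v‖) * ‖v‖ = ρ / 2 := by field_simp
      linarith)
    rw [add_sub_cancel_left, hsv] at h1
    refine ⟨A (s⁻¹ • (P (z + s • v) - P z)), ⟨_, rfl⟩, ?_⟩
    have h2 : v - A (s⁻¹ • (P (z + s • v) - P z)) =
        s⁻¹ • (s • v - A (P (z + s • v) - P z)) := by
      rw [map_smul, smul_sub, smul_smul, inv_mul_cancel₀ hs0.ne', one_smul]
    rw [dist_eq_norm, h2, norm_smul, Real.norm_eq_abs, abs_of_pos (inv_pos.2 hs0)]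
    calc _ ≤ s⁻¹ * (e / (2 * ‖v‖) * (s * ‖v‖)) := by gcongr
      _ = e / 2 := by field_simp
      _ < e := by linarith
  have hinj : Function.Injective A := by
    have : Function.Injective (A : V →ₗ[ℝ] V) :=
      LinearMap.injective_iff_surjective.2 hsurj
    exact this
  let B := (LinearEquiv.ofBijective (A : V →ₗ[ℝ] V) ⟨hinj, hsurj⟩).toContinuousLinearEquiv
  have hBA : ∀ v, B.symm (A v) = v := fun v => B.symm_apply_apply v
  refine ⟨B.symm, fun κ hκ => ?_⟩
  set N := ‖(B.symm : V →L[ℝ] V)‖ with hN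
  filter_upwards [hA (κ / (N + 1)) (by positivity)] with y hy
  have h1 : P y - P z - B.symm (y - z) = -(B.symm : V →L[ℝ] V) (y - z - A (P y - P z)) := by
    simp only [ContinuousLinearEquiv.coe_coe, map_sub, hBA]
    abel
  simp only [ContinuousLinearEquiv.coe_coe]
  rw [h1, norm_neg]
  calc _ ≤ N * ‖y - z - A (P y - P z)‖ := ContinuousLinearMap.le_opNorm _ _
    _ ≤ (N + 1) * (κ / (N + 1) * ‖y - z‖) := by gcongr; linarith
    _ = κ * ‖y - z‖ := by
      have : N + 1 ≠ 0 := by positivity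
      field_simp

end SecondOrder

section Jensen

variable {V : Type*} [NormedAddCommGroup V] [InnerProductSpace ℝ V]

lemma norm_le_norm_sub_of_strong_subgradient {Λ : ℝ} {h : V → ℝ} {P : V → V}
    (hP : ∀ z y, h z + ⟪P z, y - z⟫ + Λ / 2 * ‖y - z‖ ^ 2 ≤ h y) (z y : V) :
    Λ * ‖y - z‖ ≤ ‖P y - P z‖ := by
  have h1 := hP z y
  have h2 := hP y z
  have h3 : ⟪P y, z - y⟫ = - ⟪P y, y - z⟫ := by rw [← inner_neg_right, neg_sub]
  rw [norm_sub_rev z y, h3] at h2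
  have h4 : Λ * ‖y - z‖ ^ 2 ≤ ⟪P y - P z, y - z⟫ := by rw [inner_sub_left]; linarith
  have h5 := h4.trans (real_inner_le_norm _ _)
  rcases (norm_nonneg (y - z)).eq_or_lt with h0 | h0
  · rw [← h0]; simp
  · nlinarith

lemma gradient_of_contact {Λ r : ℝ} {W : V → ℝ} {P : V → V} {c z q : V}
    (hP : ∀ y, (W z + Λ * ‖z‖ ^ 2) + ⟪P z, y - z⟫ ≤ W y + Λ * ‖y‖ ^ 2)
    (hz : ‖z - c‖ < r) (hΛ : 0 < Λ)
    (hmax : ∀ y, ‖y - c‖ ≤ r → W y ≤ W z + ⟪q, y - z⟫) :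
    P z = q + (2 * Λ) • z := by
  set v := P z - q - (2 * Λ) • z with hv
  suffices v = 0 by rw [hv, sub_sub, sub_eq_zero] at this; exact this
  set t := min (1 / (2 * Λ)) ((r - ‖z - c‖) / (‖v‖ + 1)) with ht
  have ht0 : 0 < t := lt_min (by positivity) (div_pos (by linarith) (by positivity))
  have ht1 : t * (2 * Λ) ≤ 1 := by
    rw [← le_div_iff₀ (by positivity)]; exact min_le_left _ _
  have ht2 : t * (‖v‖ + 1) ≤ r - ‖z - c‖ := by
    rw [← le_div_iff₀ (by positivity)]; exact min_le_right _ _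
  have h1 := hP (z + t • v)
  have h2 := hmax (z + t • v) (by
    have e : z + t • v - c = (z - c) + t • v := by abel
    rw [e]
    refine (norm_add_le _ _).trans ?_
    rw [norm_smul, Real.norm_eq_abs, abs_of_pos ht0]
    nlinarith)
  rw [norm_sq_eq_add_sub z (z + t • v)] at h1
  simp only [add_sub_cancel_left, inner_smul_right, norm_smul, mul_pow, Real.norm_eq_abs,
    sq_abs] at h1 h2
  have h3 : ‖v‖ ^ 2 = ⟪P z, v⟫ - ⟪q, v⟫ - 2 * Λ * ⟪z, v⟫ := by
    rw [← real_inner_self_eq_norm_sq]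
    have : ∀ x : V, ⟪v, x⟫ = ⟪P z, x⟫ - ⟪q, x⟫ - 2 * Λ * ⟪z, x⟫ := fun x => by
      rw [hv, inner_sub_left, inner_sub_left, inner_smul_left]; simp
    exact this v
  have h4 : t * ‖v‖ ^ 2 ≤ Λ * t ^ 2 * ‖v‖ ^ 2 := by
    have h5 : t * ‖v‖ ^ 2 = t * (⟪P z, v⟫ - ⟪q, v⟫ - 2 * Λ * ⟪z, v⟫) := by rw [← h3]
    linarith
  have h5 : ‖v‖ ^ 2 ≤ 0 := by
    by_contra hh
    push Not at hh
    have : Λ * t ^ 2 * ‖v‖ ^ 2 ≤ t * ‖v‖ ^ 2 / 2 := by nlinarith [mul_pos ht0 hh]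
    nlinarith [mul_pos ht0 hh]
  have : ‖v‖ = 0 := by nlinarith [norm_nonneg v]
  exact norm_eq_zero.1 this

lemma subgradient_growth_of_contact {Λ r : ℝ} {W : V → ℝ} {P : V → V} {c z q : V} (hΛ : 0 < Λ)
    (hP : ∀ z y, (W z + Λ * ‖z‖ ^ 2) + ⟪P z, y - z⟫ ≤ W y + Λ * ‖y‖ ^ 2)
    (hz : ‖z - c‖ < r)
    (hmax : ∀ y, ‖y - c‖ ≤ r → W y ≤ W z + ⟪q, y - z⟫) :
    ∀ᶠ y in 𝓝 z, ‖P y - P z‖ ≤ 4 * Λ * ‖y - z‖ := by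
  have hPz := gradient_of_contact (hP z) hz hΛ hmax
  refine Metric.eventually_nhds_iff.2 ⟨(r - ‖z - c‖) / 2, by linarith, fun y hy => ?_⟩
  rw [dist_eq_norm] at hy
  set w := P y - P z with hw
  set s := ‖y - z‖ with hs
  rcases eq_or_ne w 0 with h0 | h0
  · rw [h0, norm_zero]; positivity
  have hw0 : 0 < ‖w‖ := norm_pos_iff.2 h0
  rcases (norm_nonneg (y - z)).eq_or_lt with hs0 | hs0
  · have : y = z := by rw [← sub_eq_zero, ← norm_eq_zero, ← hs0]
    exact absurd (by rw [hw, this, sub_self]) h0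
  set y' := y + (s / ‖w‖) • w with hy'
  have hn : ‖(s / ‖w‖) • w‖ = s := by
    rw [norm_smul, Real.norm_eq_abs, abs_of_pos (by positivity)]; field_simp
  have hy'z : ‖y' - z‖ ≤ 2 * s := by
    have e : y' - z = (y - z) + (s / ‖w‖) • w := by rw [hy']; abel
    rw [e]; refine (norm_add_le _ _).trans ?_
    rw [hn]; linarith
  have h1 := hP y y'
  have h2 := hmax y' (by
    have e : y' - c = (y' - z) + (z - c) := by abel
    rw [e]; refine (norm_add_le _ _).trans ?_
    linarith)
  have h3 := hP z y
  have h4 := norm_sq_eq_add_sub z y'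
  have e1 : ⟪P y, y' - y⟫ = ⟪P z, y' - y⟫ + s * ‖w‖ := by
    have : P y = P z + w := by rw [hw]; abel
    rw [this, inner_add_left, hy', add_sub_cancel_left, inner_smul_right,
      inner_smul_right, real_inner_self_eq_norm_sq]
    field_simp
  have e2 : ⟪P z, y' - y⟫ + ⟪P z, y - z⟫ = ⟪q, y' - z⟫ + 2 * Λ * ⟪z, y' - z⟫ := by
    rw [← inner_add_right, sub_add_sub_cancel, hPz, inner_add_left, inner_smul_left]; simp
  have h5 : s * ‖w‖ ≤ Λ * ‖y' - z‖ ^ 2 := by nlinarith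
  have h6 : ‖y' - z‖ ^ 2 ≤ (2 * s) ^ 2 := by gcongr
  have h7 : s * ‖w‖ ≤ s * (4 * Λ * s) := by nlinarith
  exact le_of_mul_le_mul_left h7 hs0

variable [FiniteDimensional ℝ V]

/-- The images under a Lipschitz map of the non-differentiability points of another Lipschitz map
cannot fill a ball. -/
lemma exists_differentiableWithinAt_preimage {s : Set V} {J F : V → V} {K L : NNReal}
    (hJ : LipschitzOnWith K J s) (hF : LipschitzOnWith L F s) {δ : ℝ} (hδ : 0 < δ) :
    ∃ q, ‖q‖ < δ ∧ ∀ p ∈ s, F p = q → DifferentiableWithinAt ℝ J s p := by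
  let _ : MeasurableSpace V := borel V
  have _ : BorelSpace V := ⟨rfl⟩
  set μ : Measure V := Measure.hausdorffMeasure (Module.finrank ℝ V) with hμ
  set D := {p | p ∈ s ∧ ¬ DifferentiableWithinAt ℝ J s p} with hD
  have hD0 : μ D = 0 := by
    have := hJ.ae_differentiableWithinAt_of_mem (μ := μ)
    rw [ae_iff] at this
    convert this using 3
    simp
  have hFD : μ (F '' D) = 0 := by
    have h := (hF.mono (fun p hp => hp.1 : D ⊆ s)).hausdorffMeasure_image_le
      (d := Module.finrank ℝ V) (by positivity)
    rw [← hμ, hD0, mul_zero] at h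
    exact le_antisymm h zero_le
  have hball : μ (ball 0 δ) ≠ 0 := (measure_ball_pos μ 0 hδ).ne'
  have : ¬ ball (0 : V) δ ⊆ F '' D := fun h => hball (measure_mono_null h hFD)
  obtain ⟨q, hq, hqD⟩ := not_subset.1 this
  refine ⟨q, by simpa using hq, fun p hp hpq => ?_⟩
  by_contra hnd
  exact hqD ⟨p, ⟨hp, hnd⟩, hpq⟩

/-- Jensen's lemma combined with Alexandrov's theorem: a semiconvex function with a strict interior
maximum has, arbitrarily close to the maximality condition, a second-order expansion with small
gradient and nonpositive Hessian. -/
theorem Semiconvex.exists_hasTaylor2 {Λ : ℝ} {W : V → ℝ} (hW : Semiconvex Λ W) (hΛ : 0 < Λ)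
    {c : V} {r μ : ℝ} (hr : 0 < r) (hμ : 0 < μ) (hs : ∀ y, ‖y - c‖ = r → W y ≤ W c - μ)
    {δ : ℝ} (hδ : 0 < δ) :
    ∃ (z q : V) (H : V →L[ℝ] V), ‖z - c‖ < r ∧ ‖q‖ < δ ∧ HasTaylor2 W z q H ∧
      ∀ v, ⟪H v, v⟫ ≤ 0 := by
  have hWc := hW.continuous hΛ.le
  obtain ⟨P, hP⟩ := hW.exists_strong_subgradient
  have hP' : ∀ z y, (W z + Λ * ‖z‖ ^ 2) + ⟪P z, y - z⟫ ≤ W y + Λ * ‖y‖ ^ 2 := fun z y => by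
    have := hP z y
    have : 0 ≤ Λ / 2 * ‖y - z‖ ^ 2 := by positivity
    linarith
  have hexp : ∀ z y, Λ * ‖y - z‖ ≤ ‖P y - P z‖ :=
    norm_le_norm_sub_of_strong_subgradient (h := fun y => W y + Λ * ‖y‖ ^ 2) hP
  have hinj : Function.Injective P := fun x y hxy => by
    have := hexp y x
    rw [hxy, sub_self, norm_zero] at this
    rw [← sub_eq_zero, ← norm_eq_zero]
    nlinarith [norm_nonneg (x - y)]
  set J := Function.invFun P with hJdef
  have hJP : ∀ z, J (P z) = z := Function.leftInverse_invFun hinj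
  have hJ : LipschitzOnWith (Real.toNNReal Λ⁻¹) J (range P) := by
    refine LipschitzOnWith.of_dist_le_mul ?_
    rintro _ ⟨x, rfl⟩ _ ⟨y, rfl⟩
    rw [hJP, hJP, dist_eq_norm, dist_eq_norm, Real.coe_toNNReal _ (by positivity),
      le_inv_mul_iff₀ hΛ]
    exact hexp y x
  set F : V → V := fun p => p - (2 * Λ) • J p with hFdef
  have hF : LipschitzOnWith 3 F (range P) := by
    refine LipschitzOnWith.of_dist_le_mul ?_
    rintro _ ⟨x, rfl⟩ _ ⟨y, rfl⟩
    simp only [hFdef, hJP, dist_eq_norm]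
    have e : P x - (2 * Λ) • x - (P y - (2 * Λ) • y) = (P x - P y) - (2 * Λ) • (x - y) := by
      module
    rw [e]
    refine (norm_sub_le _ _).trans ?_
    rw [norm_smul, Real.norm_eq_abs, abs_of_pos (by positivity)]
    have := hexp y x
    norm_num
    linarith
  obtain ⟨q, hq, hqd⟩ := exists_differentiableWithinAt_preimage hJ hF
    (lt_min hδ (show 0 < μ / (2 * r) by positivity))
  have hq1 : ‖q‖ < δ := hq.trans_le (min_le_left _ _)
  have hq2 : ‖q‖ * (2 * r) < μ := by
    rw [← lt_div_iff₀ (by positivity)]; exact hq.trans_le (min_le_right _ _)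
  obtain ⟨z, hzr, hzmax⟩ := (isCompact_closedBall c r).exists_isMaxOn
    (nonempty_closedBall.2 hr.le) (f := fun y => W y - ⟪q, y⟫) (by fun_prop)
  have hzr' : ‖z - c‖ ≤ r := by rwa [mem_closedBall, dist_eq_norm] at hzr
  have hzlt : ‖z - c‖ < r := by
    refine lt_of_le_of_ne hzr' fun heq => ?_
    have h1 : W c - ⟪q, c⟫ ≤ W z - ⟪q, z⟫ := hzmax (mem_closedBall_self hr.le)
    have h2 := hs z heq
    have h3 : |⟪q, z - c⟫| ≤ ‖q‖ * r := heq ▸ abs_real_inner_le_norm q (z - c)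
    rw [inner_sub_right] at h3
    have := (abs_le.1 h3).1
    nlinarith [norm_nonneg q]
  have hmax : ∀ y, ‖y - c‖ ≤ r → W y ≤ W z + ⟪q, y - z⟫ := fun y hy => by
    have : W y - ⟪q, y⟫ ≤ W z - ⟪q, z⟫ := hzmax (by rwa [mem_closedBall, dist_eq_norm])
    rw [inner_sub_right]; linarith
  have hPz := gradient_of_contact (hP' z) hzlt hΛ hmax
  have hgrow := subgradient_growth_of_contact hΛ hP' hzlt hmax
  have hdiff := hqd (P z) (mem_range_self z) (by
    simp only [hFdef, hJP]
    rw [hPz, add_sub_cancel_right])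
  set A := fderivWithin ℝ J (range P) (P z) with hA
  have hPc : Tendsto P (𝓝 z) (𝓝[range P] (P z)) := by
    refine tendsto_nhdsWithin_iff.2 ⟨?_, Eventually.of_forall fun y => mem_range_self y⟩
    rw [tendsto_iff_norm_sub_tendsto_zero]
    have h0 : Tendsto (fun y => 4 * Λ * ‖y - z‖) (𝓝 z) (𝓝 0) := by
      have : Continuous fun y => 4 * Λ * ‖y - z‖ := by fun_prop
      simpa using this.tendsto z
    exact squeeze_zero' (Eventually.of_forall fun _ => norm_nonneg _) hgrow h0
  obtain ⟨H, hH⟩ := exists_equiv_of_taylor_inverse (P := P) (z := z) (A := A) fun κ hκ => by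
    have h1 := hdiff.hasFDerivWithinAt.isLittleO.bound (c := κ / (4 * Λ)) (by positivity)
    filter_upwards [hPc.eventually h1, hgrow] with y hy1 hy2
    rw [hJP, hJP] at hy1
    refine hy1.trans ?_
    calc κ / (4 * Λ) * ‖P y - P z‖ ≤ κ / (4 * Λ) * (4 * Λ * ‖y - z‖) := by gcongr
      _ = κ * ‖y - z‖ := by field_simp
  have hT := hasTaylor2_of_subgradient hP' hH
  have hTW : HasTaylor2 W z q (H - (2 * Λ) • ContinuousLinearMap.id ℝ V) := by
    intro κ hκ
    filter_upwards [hT κ hκ] with y hy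
    convert hy using 2
    rw [hPz, norm_sq_eq_add_sub z y, inner_add_left, inner_smul_left]
    simp only [_root_.sub_apply, _root_.smul_apply,
      ContinuousLinearMap.id_apply, inner_sub_left, inner_smul_left, conj_trivial,
      ← real_inner_self_eq_norm_sq (y - z)]
    ring
  refine ⟨z, q, _, hzlt, hq1, hTW, fun v => ?_⟩
  set H' := H - (2 * Λ) • ContinuousLinearMap.id ℝ V
  refine le_of_forall_pos_le_add fun e he => ?_
  have hlim : Tendsto (fun t : ℝ => z + t • v) (𝓝[>] 0) (𝓝 z) := by
    have : Continuous fun t : ℝ => z + t • v := by fun_prop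
    simpa using (this.tendsto 0).mono_left nhdsWithin_le_nhds
  have hev : ∀ᶠ y in 𝓝 z, ‖y - c‖ ≤ r := by
    have : Continuous fun y => ‖y - c‖ := by fun_prop
    exact ((this.tendsto z).eventually_lt_const hzlt).mono fun _ => le_of_lt
  obtain ⟨t, ht1, ht2, ht0⟩ := ((hlim.eventually (hTW (e / (2 * (‖v‖ ^ 2 + 1)))
    (by positivity))).and ((hlim.eventually hev).and self_mem_nhdsWithin)).exists
  have h1 := hmax _ ht2
  have h2 := (abs_le.1 ht1).1
  simp only [add_sub_cancel_left, map_smul, inner_smul_left, inner_smul_right, norm_smul,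
    conj_trivial, mul_pow, Real.norm_eq_abs, sq_abs] at h1 h2
  have ht0' : (0 : ℝ) < t := ht0
  have h3 : e / (2 * (‖v‖ ^ 2 + 1)) * ‖v‖ ^ 2 ≤ e / 2 := by
    rw [div_mul_eq_mul_div, div_le_div_iff₀ (by positivity) (by positivity)]
    nlinarith [sq_nonneg ‖v‖]
  have h4 : t ^ 2 * ⟪H' v, v⟫ ≤ t ^ 2 * e := by nlinarith [sq_nonneg t]
  rw [zero_add]
  exact le_of_mul_le_mul_left h4 (by positivity)

end Jensen

section SumJensen

variable {E : Type*} [NormedAddCommGroup E] [InnerProductSpace ℝ E]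

lemma HasTaylor2.comp_affine {V : Type*} [NormedAddCommGroup V] [InnerProductSpace ℝ V]
    {W : V → ℝ} {z q : V} {H : V →L[ℝ] V} (hW : HasTaylor2 W z q H)
    (i : E →L[ℝ] V) (p : V →L[ℝ] E) (hi : ∀ a, ‖i a‖ ≤ ‖a‖)
    (hip : ∀ a v, ⟪v, i a⟫ = ⟪p v, a⟫) (x : E) :
    HasTaylor2 (fun y => W (z + i (y - x))) x (p q) (p ∘L H ∘L i) := by
  intro κ hκ
  have hc : Tendsto (fun y => z + i (y - x)) (𝓝 x) (𝓝 z) := by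
    have : Continuous fun y => z + i (y - x) := by fun_prop
    simpa using this.tendsto x
  filter_upwards [hc.eventually (hW κ hκ)] with y hy
  simp only [add_sub_cancel_left, hip] at hy
  simp only [sub_self, map_zero, add_zero, ContinuousLinearMap.comp_apply]
  refine hy.trans ?_
  gcongr
  exact hi _

lemma HasTaylor2.add_quadratic {W G : E → ℝ} {z q p : E} {H D : E →L[ℝ] E}
    (hW : HasTaylor2 W z q H) (c : ℝ)
    (hG : ∀ y, G y = W y + c + ⟪p, y - z⟫ + 1 / 2 * ⟪D (y - z), y - z⟫) :
    HasTaylor2 G z (q + p) (H + D) := by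
  intro κ hκ
  filter_upwards [hW κ hκ] with y hy
  convert hy using 2
  rw [hG y, hG z]
  simp only [sub_self, inner_zero_right, map_zero, _root_.add_apply, inner_add_left]
  ring

lemma HasTaylor2.le_of_second_difference {W : E → ℝ} {z q : E} {H : E →L[ℝ] E}
    (hW : HasTaylor2 W z q H) {a b : E} {m : ℝ}
    (hm : ∀ t : ℝ, W (z + t • (a + b)) - W (z + t • a) - W (z + t • b) + W z = t ^ 2 * m) :
    ⟪H a, a⟫ + ⟪H b, b⟫ + 2 * m = ⟪H (a + b), a + b⟫ := by
  have key : ∀ e > 0, |⟪H (a + b), a + b⟫ - ⟪H a, a⟫ - ⟪H b, b⟫ - 2 * m| ≤ e := by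
    intro e he
    set N := ‖a + b‖ ^ 2 + ‖a‖ ^ 2 + ‖b‖ ^ 2 + 1 with hN
    have hN0 : 0 < N := by positivity
    have hlim : ∀ v : E, Tendsto (fun t : ℝ => z + t • v) (𝓝[>] 0) (𝓝 z) := fun v => by
      have : Continuous fun t : ℝ => z + t • v := by fun_prop
      simpa using (this.tendsto 0).mono_left nhdsWithin_le_nhds
    have hκ : 0 < e / (2 * N) := by positivity
    obtain ⟨t, h1, h2, h3, ht⟩ := (((hlim (a + b)).eventually (hW _ hκ)).and
      (((hlim a).eventually (hW _ hκ)).and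
        (((hlim b).eventually (hW _ hκ)).and self_mem_nhdsWithin))).exists
    have ht0 : (0 : ℝ) < t := ht
    have hm' := hm t
    simp only [add_sub_cancel_left, map_smul, inner_smul_left, inner_smul_right, norm_smul,
      conj_trivial, mul_pow, Real.norm_eq_abs, sq_abs] at h1 h2 h3
    rw [abs_le] at h1 h2 h3
    have hq : ⟪q, a + b⟫ = ⟪q, a⟫ + ⟪q, b⟫ := inner_add_right _ _ _
    have hs : e / (2 * N) * (t ^ 2 * ‖a + b‖ ^ 2) + e / (2 * N) * (t ^ 2 * ‖a‖ ^ 2)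
        + e / (2 * N) * (t ^ 2 * ‖b‖ ^ 2) ≤ t ^ 2 * e / 2 := by
      have : e / (2 * N) * (t ^ 2 * N) = t ^ 2 * e / 2 := by field_simp
      rw [← this, hN, ← mul_add, ← mul_add, ← mul_add, ← mul_add]
      refine mul_le_mul_of_nonneg_left ?_ hκ.le
      nlinarith [sq_nonneg t]
    rw [hq] at h1
    have h4 : t ^ 2 * (⟪H (a + b), a + b⟫ - ⟪H a, a⟫ - ⟪H b, b⟫ - 2 * m) ≤ t ^ 2 * e := by
      linarith [h1.1, h2.2, h3.2]
    have h5 : t ^ 2 * (-e) ≤ t ^ 2 * (⟪H (a + b), a + b⟫ - ⟪H a, a⟫ - ⟪H b, b⟫ - 2 * m) := by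
      linarith [h1.2, h2.1, h3.1]
    rw [abs_le]
    exact ⟨le_of_mul_le_mul_left h5 (by positivity), le_of_mul_le_mul_left h4 (by positivity)⟩
  have := abs_nonpos_iff.1 (le_of_forall_pos_le_add fun e he =>
    (key e he).trans_eq (zero_add e).symm)
  linarith

lemma quadratic_add {D : E →L[ℝ] E} (hD : ∀ a b, ⟪D a, b⟫ = ⟪a, D b⟫) (a b : E) :
    ⟪D (a + b), a + b⟫ = ⟪D a, a⟫ + 2 * ⟪D a, b⟫ + ⟪D b, b⟫ := by
  rw [map_add, inner_add_left, inner_add_right, inner_add_right, hD b a, real_inner_comm (D a) b]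
  ring

/-- Jensen's lemma for a sum of two semiconvex functions penalised by a quadratic form of the
difference of the variables. -/
theorem exists_hasTaylor2_of_sum [FiniteDimensional ℝ E] {Λ : ℝ} (hΛ : 0 < Λ) {f g : E → ℝ}
    (hf : Semiconvex Λ f) (hg : Semiconvex Λ g) {D : E →L[ℝ] E}
    (hD : ∀ a b, ⟪D a, b⟫ = ⟪a, D b⟫) {c₁ c₂ : E} {r μ : ℝ} (hr : 0 < r) (hμ : 0 < μ)
    (hs : ∀ z₁ z₂, ‖z₁ - c₁‖ ^ 2 + ‖z₂ - c₂‖ ^ 2 = r ^ 2 →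
      f z₁ + g z₂ - 1 / 2 * ⟪D (z₁ - z₂), z₁ - z₂⟫ ≤
        f c₁ + g c₂ - 1 / 2 * ⟪D (c₁ - c₂), c₁ - c₂⟫ - μ)
    {δ : ℝ} (hδ : 0 < δ) :
    ∃ (z₁ z₂ p₁ p₂ : E) (H₁ H₂ : E →L[ℝ] E), ‖z₁ - c₁‖ < r ∧ ‖z₂ - c₂‖ < r ∧
      HasTaylor2 f z₁ p₁ H₁ ∧ HasTaylor2 g z₂ p₂ H₂ ∧
      ‖p₁ - D (z₁ - z₂)‖ < δ ∧ ‖p₂ + D (z₁ - z₂)‖ < δ ∧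
      ∀ a b, ⟪H₁ a, a⟫ + ⟪H₂ b, b⟫ ≤ ⟪D (a - b), a - b⟫ := by
  let V := WithLp 2 (E × E)
  let e := WithLp.prodContinuousLinearEquiv 2 ℝ E E
  let π₁ : V →L[ℝ] E := ContinuousLinearMap.fst ℝ E E ∘L (e : V →L[ℝ] E × E)
  let π₂ : V →L[ℝ] E := ContinuousLinearMap.snd ℝ E E ∘L (e : V →L[ℝ] E × E)
  let ι₁ : E →L[ℝ] V := (e.symm : E × E →L[ℝ] V) ∘L ContinuousLinearMap.inl ℝ E E
  let ι₂ : E →L[ℝ] V := (e.symm : E × E →L[ℝ] V) ∘L ContinuousLinearMap.inr ℝ E E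
  have h11 : ∀ a, π₁ (ι₁ a) = a := fun a => rfl
  have h12 : ∀ a, π₁ (ι₂ a) = 0 := fun a => rfl
  have h21 : ∀ a, π₂ (ι₁ a) = 0 := fun a => rfl
  have h22 : ∀ a, π₂ (ι₂ a) = a := fun a => rfl
  have hsq : ∀ v : V, ‖v‖ ^ 2 = ‖π₁ v‖ ^ 2 + ‖π₂ v‖ ^ 2 := fun v =>
    WithLp.prod_norm_sq_eq_of_L2 v
  have hin : ∀ v w : V, ⟪v, w⟫ = ⟪π₁ v, π₁ w⟫ + ⟪π₂ v, π₂ w⟫ := fun v w =>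
    WithLp.prod_inner_apply v w
  have hπ₁ : ∀ v, ‖π₁ v‖ ≤ ‖v‖ := fun v =>
    abs_le_of_sq_le_sq' (by nlinarith [hsq v, sq_nonneg ‖π₂ v‖]) (norm_nonneg v) |>.2
  have hπ₂ : ∀ v, ‖π₂ v‖ ≤ ‖v‖ := fun v =>
    abs_le_of_sq_le_sq' (by nlinarith [hsq v, sq_nonneg ‖π₁ v‖]) (norm_nonneg v) |>.2
  have hι₁ : ∀ a, ‖ι₁ a‖ ≤ ‖a‖ := fun a =>
    abs_le_of_sq_le_sq' (by rw [hsq, h11, h21]; simp) (norm_nonneg a) |>.2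
  have hι₂ : ∀ a, ‖ι₂ a‖ ≤ ‖a‖ := fun a =>
    abs_le_of_sq_le_sq' (by rw [hsq, h12, h22]; simp) (norm_nonneg a) |>.2
  let W : V → ℝ := fun v =>
    f (π₁ v) + g (π₂ v) - 1 / 2 * ⟪D (π₁ v - π₂ v), π₁ v - π₂ v⟫
  have hWsc : Semiconvex (Λ + 2 * ‖D‖) W := by
    intro z
    obtain ⟨p, hp⟩ := hf (π₁ z)
    obtain ⟨q, hq⟩ := hg (π₂ z)
    set w := π₁ z - π₂ z with hw
    refine ⟨ι₁ (p - D w) + ι₂ (q + D w), fun y => ?_⟩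
    have h1 := hp (π₁ y)
    have h2 := hq (π₂ y)
    set k := (π₁ y - π₁ z) - (π₂ y - π₂ z) with hk
    have e1 : π₁ y - π₂ y = w + k := by rw [hw, hk]; abel
    have h3 : ⟪D k, k⟫ ≤ 2 * ‖D‖ * ‖y - z‖ ^ 2 := by
      have a1 : ⟪D k, k⟫ ≤ ‖D‖ * ‖k‖ * ‖k‖ :=
        (real_inner_le_norm _ _).trans (by gcongr; exact D.le_opNorm k)
      have a2 : ‖k‖ ≤ ‖π₁ (y - z)‖ + ‖π₂ (y - z)‖ := by
        rw [map_sub, map_sub]; exact norm_sub_le _ _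
      have a3 : ‖k‖ * ‖k‖ ≤ 2 * ‖y - z‖ ^ 2 := by
        rw [hsq]; nlinarith [sq_nonneg (‖π₁ (y - z)‖ - ‖π₂ (y - z)‖), norm_nonneg k]
      nlinarith [norm_nonneg D]
    have h4 : ⟪ι₁ (p - D w) + ι₂ (q + D w), y - z⟫ =
        ⟪p, π₁ y - π₁ z⟫ + ⟪q, π₂ y - π₂ z⟫ - ⟪D w, k⟫ := by
      rw [hin, map_add π₁, map_add π₂, h11, h12, h21, h22, map_sub π₁, map_sub π₂, hk,
        inner_sub_right (D w), add_zero, zero_add, inner_sub_left, inner_add_left]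
      ring
    have h5 := hsq (y - z)
    simp only [map_sub] at h5
    simp only [W]
    rw [e1, quadratic_add hD, ← hw, h4, h5]
    rw [h5] at h3
    nlinarith
  have hsph : ∀ v : V, ‖v - (ι₁ c₁ + ι₂ c₂)‖ = r → W v ≤ W (ι₁ c₁ + ι₂ c₂) - μ := by
    intro v hv
    have h1 := hsq (v - (ι₁ c₁ + ι₂ c₂))
    rw [hv] at h1
    simp only [map_sub, map_add, h11, h12, h21, h22, add_zero, zero_add] at h1
    simpa only [W, map_add, h11, h12, h21, h22, add_zero, zero_add] using hs _ _ h1.symm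
  obtain ⟨z, q, H, hz, hq, hT, hH⟩ := hWsc.exists_hasTaylor2 (by positivity) hr hμ hsph hδ
  set w := π₁ z - π₂ z with hw
  have hf' : HasTaylor2 f (π₁ z) (π₁ q + D w) (π₁ ∘L H ∘L ι₁ + D) := by
    refine (hT.comp_affine ι₁ π₁ hι₁ (fun a v => by rw [hin, h11, h21]; simp) (π₁ z)).add_quadratic
      (- g (π₂ z) + 1 / 2 * ⟪D w, w⟫) fun y => ?_
    have e1 : π₁ z + (y - π₁ z) - π₂ z = w + (y - π₁ z) := by rw [hw]; abel
    simp only [W, map_add, h11, h21, add_zero]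
    rw [e1, quadratic_add hD, add_sub_cancel]
    ring
  have hg' : HasTaylor2 g (π₂ z) (π₂ q + -D w) (π₂ ∘L H ∘L ι₂ + D) := by
    refine (hT.comp_affine ι₂ π₂ hι₂ (fun a v => by rw [hin, h12, h22]; simp) (π₂ z)).add_quadratic
      (- f (π₁ z) + 1 / 2 * ⟪D w, w⟫) fun y => ?_
    have e1 : π₁ z - (π₂ z + (y - π₂ z)) = w + -(y - π₂ z) := by rw [hw]; abel
    simp only [W, map_add, h12, h22, add_zero]
    rw [e1, quadratic_add hD, add_sub_cancel]
    simp only [map_neg, inner_neg_left, inner_neg_right]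
    ring
  refine ⟨π₁ z, π₂ z, _, _, _, _, ?_, ?_, hf', hg', ?_, ?_, fun a b => ?_⟩
  · have := hπ₁ (z - (ι₁ c₁ + ι₂ c₂))
    simp only [map_sub, map_add, h11, h12, add_zero] at this
    exact this.trans_lt hz
  · have := hπ₂ (z - (ι₁ c₁ + ι₂ c₂))
    simp only [map_sub, map_add, h21, h22, zero_add] at this
    exact this.trans_lt hz
  · rw [add_sub_cancel_right]; exact (hπ₁ q).trans_lt hq
  · rw [neg_add_cancel_right]; exact (hπ₂ q).trans_lt hq
  · have h1 := hT.le_of_second_difference (a := ι₁ a) (b := ι₂ b) (m := ⟪D a, b⟫) fun t => by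
      simp only [W, map_add, map_smul, h11, h12, h21, h22, add_zero, zero_add, smul_zero]
      have e1 : π₁ z + t • a - (π₂ z + t • b) = w + (t • a + -(t • b)) := by rw [hw]; abel
      have e2 : π₁ z + t • a - π₂ z = w + t • a := by rw [hw]; abel
      have e3 : π₁ z - (π₂ z + t • b) = w + -(t • b) := by rw [hw]; abel
      rw [e1, e2, e3]
      simp only [quadratic_add hD, inner_add_right, inner_neg_right, map_smul, inner_smul_left,
        inner_smul_right, conj_trivial]
      ring
    have h2 := hH (ι₁ a + ι₂ b)
    have h3 : ⟪D (a - b), a - b⟫ = ⟪D a, a⟫ - 2 * ⟪D a, b⟫ + ⟪D b, b⟫ := by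
      rw [sub_eq_add_neg, quadratic_add hD]; simp; ring
    have h4 : ⟪H (ι₁ a), ι₁ a⟫ = ⟪π₁ (H (ι₁ a)), a⟫ := by rw [hin, h11, h21]; simp
    have h5 : ⟪H (ι₂ b), ι₂ b⟫ = ⟪π₂ (H (ι₂ b)), b⟫ := by rw [hin, h12, h22]; simp
    rw [h3]
    simp only [_root_.add_apply, ContinuousLinearMap.comp_apply, inner_add_left]
    rw [← h4, ← h5]
    linarith

end SumJensen

section Sums

variable {E : Type*} [NormedAddCommGroup E] [InnerProductSpace ℝ E]

/-- `(q, H)` is a limiting element of the second-order superjet of `U` at `z`. -/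
def HasUpperJet (U : E → ℝ) (z q : E) (H : E →L[ℝ] E) : Prop :=
  ∀ κ > 0, ∀ᶠ y in 𝓝 z,
    U y ≤ U z + ⟪q, y - z⟫ + 1 / 2 * ⟪H (y - z), y - z⟫ + κ * ‖y - z‖ ^ 2

/-- `S` is the sup-convolution of `U` with parameter `k`, the supremum at `z` being attained at
`ξ z`. -/
structure IsSupConv (k : ℝ) (U S : E → ℝ) (ξ : E → E) : Prop where
  le : ∀ z y, U y - k / 2 * ‖y - z‖ ^ 2 ≤ S z
  eq : ∀ z, S z = U (ξ z) - k / 2 * ‖ξ z - z‖ ^ 2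

lemma exists_isSupConv [FiniteDimensional ℝ E] {U : E → ℝ} (hU : Continuous U) {M : ℝ}
    (hM : ∀ z, U z ≤ M) {k : ℝ} (hk : 0 < k) : ∃ S ξ, IsSupConv k U S ξ := by
  have h : ∀ z, ∃ x, ∀ y, U y - k / 2 * ‖y - z‖ ^ 2 ≤ U x - k / 2 * ‖x - z‖ ^ 2 := by
    intro z
    have hc : Continuous fun y => U y - k / 2 * ‖y - z‖ ^ 2 := by fun_prop
    refine hc.exists_forall_ge ?_
    have h1 : Tendsto (fun y => ‖y - z‖) (cocompact E) atTop :=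
      tendsto_norm_cocompact_atTop.comp (Homeomorph.subRight z).isClosedEmbedding.tendsto_cocompact
    have h2 : Tendsto (fun y => k / 2 * ‖y - z‖ ^ 2) (cocompact E) atTop :=
      ((tendsto_pow_atTop two_ne_zero).comp h1).const_mul_atTop (by positivity)
    have h3 := tendsto_atBot_add_const_left (cocompact E) M (tendsto_neg_atTop_atBot.comp h2)
    refine tendsto_atBot_mono (fun y => ?_) h3
    simp only [Function.comp]
    linarith [hM y]
  choose ξ hξ using h
  exact ⟨fun z => U (ξ z) - k / 2 * ‖ξ z - z‖ ^ 2, ξ, hξ, fun z => rfl⟩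

namespace IsSupConv

variable {k : ℝ} {U S : E → ℝ} {ξ : E → E}

lemma self_le (h : IsSupConv k U S ξ) (z : E) : U z ≤ S z := by
  simpa using h.le z z

lemma semiconvex (h : IsSupConv k U S ξ) : Semiconvex k S := by
  refine fun z => ⟨k • (ξ z - z), fun y => ?_⟩
  have h1 := h.le y (ξ z)
  have h2 := norm_sub_sq_real (ξ z - z) (y - z)
  rw [sub_sub_sub_cancel_right] at h2
  rw [h.eq z, inner_smul_left]
  simp only [conj_trivial]
  rw [h2] at h1
  linarith

lemma sq_le {M : ℝ} (h : IsSupConv k U S ξ) (hM : ∀ z, U z ≤ M) (z : E) :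
    k / 2 * ‖ξ z - z‖ ^ 2 ≤ M - U z := by
  have := h.self_le z
  rw [h.eq z] at this
  linarith [hM (ξ z)]

lemma hasUpperJet (h : IsSupConv k U S ξ) {z q : E} {H : E →L[ℝ] E}
    (hT : HasTaylor2 S z q H) : HasUpperJet U (ξ z) q H := by
  intro κ hκ
  have hc : Tendsto (fun y => z + (y - ξ z)) (𝓝 (ξ z)) (𝓝 z) := by
    have : Continuous fun y => z + (y - ξ z) := by fun_prop
    simpa using this.tendsto (ξ z)
  filter_upwards [hc.eventually (hT κ hκ)] with y hy
  rw [add_sub_cancel_left] at hy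
  have h1 := h.le (z + (y - ξ z)) y
  have e : y - (z + (y - ξ z)) = ξ z - z := by abel
  rw [e] at h1
  linarith [h.eq z, (abs_le.1 hy).2]

end IsSupConv

lemma HasUpperJet.add_sq {U : E → ℝ} {z q : E} {H : E →L[ℝ] E} {κ : ℝ} {c : E}
    (h : HasUpperJet (fun y => U y - κ * ‖y - c‖ ^ 2) z q H) :
    HasUpperJet U z (q + (2 * κ) • (z - c)) (H + (2 * κ) • ContinuousLinearMap.id ℝ E) := by
  intro e he
  filter_upwards [h e he] with y hy
  have e1 := norm_sq_eq_add_sub (z - c) (y - c)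
  rw [sub_sub_sub_cancel_right] at e1
  rw [e1] at hy
  simp only [_root_.add_apply, _root_.smul_apply, ContinuousLinearMap.id_apply, inner_add_left,
    inner_smul_left, conj_trivial, real_inner_self_eq_norm_sq]
  linarith

lemma tendsto_zero_of_mul_sq_le {α : Type*} {l : Filter α} {k f : α → ℝ} {B : ℝ}
    (hk : Tendsto k l atTop) (h : ∀ a, k a * f a ^ 2 ≤ B) : Tendsto f l (𝓝 0) := by
  have h1 : Tendsto (fun a => f a ^ 2) l (𝓝 0) := by
    refine squeeze_zero' (Eventually.of_forall fun a => sq_nonneg _) ?_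
      ((tendsto_const_nhds (x := B)).div_atTop hk)
    filter_upwards [hk.eventually_gt_atTop 0] with a ha
    rw [le_div_iff₀ ha, mul_comm]
    exact h a
  have h2 := h1.sqrt
  simp only [Real.sqrt_sq_eq_abs, Real.sqrt_zero] at h2
  exact (tendsto_zero_iff_abs_tendsto_zero f).2 h2

/-- The doubled functional built from sup-convolutions keeps a strict interior maximum once the
parameter is large. -/
lemma exists_supConv_gap [FiniteDimensional ℝ E] {U V : E → ℝ} (hU : Continuous U)
    (hV : Continuous V) {M : ℝ} (hUM : ∀ z, U z ≤ M) (hVM : ∀ z, V z ≤ M) {D T : E →L[ℝ] E}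
    (hD0 : ∀ a, 0 ≤ ⟪D a, a⟫) (hT : ∀ a, ⟪T a, a⟫ = ‖T a‖ ^ 2) {c₁ c₂ : E} (hc : T c₁ = T c₂)
    {r : ℝ}
    (hmax : ∀ z₁ z₂, T z₁ = T z₂ → ‖z₁ - c₁‖ ^ 2 + ‖z₂ - c₂‖ ^ 2 = r ^ 2 →
      U z₁ + V z₂ - 1 / 2 * ⟪D (z₁ - z₂), z₁ - z₂⟫ <
        U c₁ + V c₂ - 1 / 2 * ⟪D (c₁ - c₂), c₁ - c₂⟫) (k₀ : ℝ) :
    ∃ k > k₀, 0 < k ∧ ∃ μ > 0, ∀ S₁ ξ₁ S₂ ξ₂, IsSupConv k U S₁ ξ₁ → IsSupConv k V S₂ ξ₂ →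
      ∀ z₁ z₂, ‖z₁ - c₁‖ ^ 2 + ‖z₂ - c₂‖ ^ 2 = r ^ 2 →
      S₁ z₁ + S₂ z₂ - 1 / 2 * ⟪(D + k • T) (z₁ - z₂), z₁ - z₂⟫ ≤
        S₁ c₁ + S₂ c₂ - 1 / 2 * ⟪(D + k • T) (c₁ - c₂), c₁ - c₂⟫ - μ := by
  by_contra hcon
  push Not at hcon
  set m := U c₁ + V c₂ - 1 / 2 * ⟪D (c₁ - c₂), c₁ - c₂⟫ with hm
  set κ : ℕ → ℝ := fun j => max k₀ 0 + 1 + j with hκ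
  have hκ0 : ∀ j, 0 < κ j := fun j => by
    have : (0 : ℝ) ≤ j := by positivity
    have := le_max_right k₀ 0
    simp only [hκ]; linarith
  have hκt : Tendsto κ atTop atTop :=
    tendsto_atTop_add_const_left _ _ tendsto_natCast_atTop_atTop
  have hκk : ∀ j, k₀ < κ j := fun j => by
    have : (0 : ℝ) ≤ j := by positivity
    have := le_max_left k₀ 0
    simp only [hκ]; linarith
  choose S₁ ξ₁ S₂ ξ₂ h₁ h₂ z₁ z₂ hz hlt using fun j : ℕ =>
    hcon (κ j) (hκk j) (hκ0 j) (1 / ((j : ℝ) + 1)) (by positivity)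
  have hTc : T (c₁ - c₂) = 0 := by rw [map_sub, hc, sub_self]
  have hlow : ∀ j : ℕ, m - 1 / ((j : ℝ) + 1) < S₁ j (z₁ j) + S₂ j (z₂ j)
      - 1 / 2 * ⟪D (z₁ j - z₂ j), z₁ j - z₂ j⟫ - κ j / 2 * ‖T (z₁ j - z₂ j)‖ ^ 2 := by
    intro j
    have h3 := hlt j
    simp only [_root_.add_apply, _root_.smul_apply, inner_add_left, inner_smul_left,
      conj_trivial, hT, hTc, inner_zero_left, mul_zero] at h3
    linarith [(h₁ j).self_le c₁, (h₂ j).self_le c₂]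
  have hlow1 : ∀ j : ℕ, 1 / ((j : ℝ) + 1) ≤ 1 := fun j => by
    rw [div_le_one (by positivity)]
    have : (0 : ℝ) ≤ j := by positivity
    linarith
  have hB : ∀ j, κ j / 2 * ‖ξ₁ j (z₁ j) - z₁ j‖ ^ 2 + κ j / 2 * ‖ξ₂ j (z₂ j) - z₂ j‖ ^ 2
      + κ j / 2 * ‖T (z₁ j - z₂ j)‖ ^ 2 ≤ 2 * M - m + 1 := by
    intro j
    linarith [hlow j, hlow1 j, (h₁ j).eq (z₁ j), (h₂ j).eq (z₂ j), hUM (ξ₁ j (z₁ j)),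
      hVM (ξ₂ j (z₂ j)), hD0 (z₁ j - z₂ j)]
  have hκ2 : Tendsto (fun j => κ j / 2) atTop atTop := hκt.atTop_div_const two_pos
  have p1 : ∀ j, 0 ≤ κ j / 2 * ‖ξ₁ j (z₁ j) - z₁ j‖ ^ 2 := fun j =>
    mul_nonneg (by linarith [hκ0 j]) (sq_nonneg _)
  have p2 : ∀ j, 0 ≤ κ j / 2 * ‖ξ₂ j (z₂ j) - z₂ j‖ ^ 2 := fun j =>
    mul_nonneg (by linarith [hκ0 j]) (sq_nonneg _)
  have p3 : ∀ j, 0 ≤ κ j / 2 * ‖T (z₁ j - z₂ j)‖ ^ 2 := fun j =>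
    mul_nonneg (by linarith [hκ0 j]) (sq_nonneg _)
  have t1 : Tendsto (fun j => ξ₁ j (z₁ j) - z₁ j) atTop (𝓝 0) :=
    tendsto_zero_iff_norm_tendsto_zero.2 (tendsto_zero_of_mul_sq_le (B := 2 * M - m + 1) hκ2
      fun j => by linarith [hB j, p1 j, p2 j, p3 j])
  have t2 : Tendsto (fun j => ξ₂ j (z₂ j) - z₂ j) atTop (𝓝 0) :=
    tendsto_zero_iff_norm_tendsto_zero.2 (tendsto_zero_of_mul_sq_le (B := 2 * M - m + 1) hκ2
      fun j => by linarith [hB j, p1 j, p2 j, p3 j])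
  have t3 : Tendsto (fun j => T (z₁ j - z₂ j)) atTop (𝓝 0) :=
    tendsto_zero_iff_norm_tendsto_zero.2 (tendsto_zero_of_mul_sq_le (B := 2 * M - m + 1) hκ2
      fun j => by linarith [hB j, p1 j, p2 j, p3 j])
  have hcpt : IsCompact (closedBall c₁ |r| ×ˢ closedBall c₂ |r|) :=
    (isCompact_closedBall _ _).prod (isCompact_closedBall _ _)
  have hmem : ∀ j, (z₁ j, z₂ j) ∈ closedBall c₁ |r| ×ˢ closedBall c₂ |r| := fun j => by
    refine ⟨?_, ?_⟩ <;> simp only [mem_closedBall, dist_eq_norm] <;> refine abs_le_of_sq_le_sq' ?_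
      (abs_nonneg r) |>.2 <;> rw [sq_abs]
    · nlinarith [hz j, sq_nonneg ‖z₂ j - c₂‖]
    · nlinarith [hz j, sq_nonneg ‖z₁ j - c₁‖]
  obtain ⟨⟨w₁, w₂⟩, -, φ, hφ, hlim⟩ := hcpt.tendsto_subseq hmem
  have l1 : Tendsto (fun j => z₁ (φ j)) atTop (𝓝 w₁) := (continuous_fst.tendsto _).comp hlim
  have l2 : Tendsto (fun j => z₂ (φ j)) atTop (𝓝 w₂) := (continuous_snd.tendsto _).comp hlim
  have x1 : Tendsto (fun j => ξ₁ (φ j) (z₁ (φ j))) atTop (𝓝 w₁) := by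
    simpa using (t1.comp hφ.tendsto_atTop).add l1
  have x2 : Tendsto (fun j => ξ₂ (φ j) (z₂ (φ j))) atTop (𝓝 w₂) := by
    simpa using (t2.comp hφ.tendsto_atTop).add l2
  have hTw : T (w₁ - w₂) = 0 :=
    tendsto_nhds_unique ((T.continuous.tendsto _).comp (l1.sub l2)) (t3.comp hφ.tendsto_atTop)
  have hzw : ‖w₁ - c₁‖ ^ 2 + ‖w₂ - c₂‖ ^ 2 = r ^ 2 := by
    refine tendsto_nhds_unique ((((l1.sub_const c₁).norm).pow 2).add
      (((l2.sub_const c₂).norm).pow 2)) ?_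
    simp only [hz]
    exact tendsto_const_nhds
  have hlt' := hmax w₁ w₂ (by rw [← sub_eq_zero, ← map_sub, hTw]) hzw
  refine absurd hlt' (not_lt.2 ?_)
  have hL : Tendsto (fun j => m - 1 / ((φ j : ℝ) + 1)) atTop (𝓝 m) := by
    simpa using (tendsto_one_div_add_atTop_nhds_zero_nat.comp hφ.tendsto_atTop).const_sub m
  have hc' : Continuous fun p : E × E => 1 / 2 * ⟪D (p.1 - p.2), p.1 - p.2⟫ := by fun_prop
  have hR := (((hU.tendsto _).comp x1).add ((hV.tendsto _).comp x2)).sub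
    ((hc'.tendsto (w₁, w₂)).comp (l1.prodMk_nhds l2))
  refine le_of_tendsto_of_tendsto' hL hR fun j => ?_
  simp only [Function.comp]
  linarith [hlow (φ j), (h₁ (φ j)).eq (z₁ (φ j)), (h₂ (φ j)).eq (z₂ (φ j)), p1 (φ j), p2 (φ j),
    p3 (φ j)]

/-- A theorem on sums in which the variables are only constrained to share their `T`-component. -/
theorem exists_hasUpperJet_of_max [FiniteDimensional ℝ E] {U V : E → ℝ} (hU : Continuous U)
    (hV : Continuous V) {M : ℝ} (hUM : ∀ z, U z ≤ M) (hVM : ∀ z, V z ≤ M) {D T : E →L[ℝ] E}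
    (hDs : ∀ a b, ⟪D a, b⟫ = ⟪a, D b⟫) (hTs : ∀ a b, ⟪T a, b⟫ = ⟪a, T b⟫)
    (hD0 : ∀ a, 0 ≤ ⟪D a, a⟫) (hT : ∀ a, ⟪T a, a⟫ = ‖T a‖ ^ 2) {c₁ c₂ : E} (hc : T c₁ = T c₂)
    (hmax : ∀ z₁ z₂, T z₁ = T z₂ →
      U z₁ + V z₂ - 1 / 2 * ⟪D (z₁ - z₂), z₁ - z₂⟫ ≤
        U c₁ + V c₂ - 1 / 2 * ⟪D (c₁ - c₂), c₁ - c₂⟫) {κ : ℝ} (hκ : 0 < κ) :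
    ∃ (k : ℝ) (z₁ z₂ q₁ q₂ w : E) (H₁ H₂ : E →L[ℝ] E), ‖z₁ - c₁‖ < κ ∧ ‖z₂ - c₂‖ < κ ∧
      HasUpperJet U z₁ q₁ H₁ ∧ HasUpperJet V z₂ q₂ H₂ ∧
      ‖q₁ - D (c₁ - c₂) - T w‖ < κ ∧ ‖q₂ + D (c₁ - c₂) + T w‖ < κ ∧
      ∀ a b, ⟪H₁ a, a⟫ + ⟪H₂ b, b⟫ ≤
        ⟪D (a - b), a - b⟫ + k * ‖T (a - b)‖ ^ 2 + κ * (‖a‖ ^ 2 + ‖b‖ ^ 2) := by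
  set e := min κ 1 / 8 with he
  have he0 : 0 < e := by positivity
  have heκ : 8 * e ≤ κ := by rw [he]; linarith [min_le_left κ 1]
  have he1 : 8 * e ≤ 1 := by rw [he]; linarith [min_le_right κ 1]
  set r := κ / (4 * (‖D‖ + 1)) with hr
  have hr0 : 0 < r := by positivity
  have hrD : r * (‖D‖ + 1) = κ / 4 := by rw [hr]; field_simp
  have hrκ : r ≤ κ / 4 := by nlinarith [norm_nonneg D]
  set U' : E → ℝ := fun z => U z - e * ‖z - c₁‖ ^ 2 with hU'
  set V' : E → ℝ := fun z => V z - e * ‖z - c₂‖ ^ 2 with hV'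
  have hUc : Continuous U' := by fun_prop
  have hVc : Continuous V' := by fun_prop
  have hUM' : ∀ z, U' z ≤ M := fun z => by
    have : 0 ≤ e * ‖z - c₁‖ ^ 2 := by positivity
    simp only [hU']; linarith [hUM z]
  have hVM' : ∀ z, V' z ≤ M := fun z => by
    have : 0 ≤ e * ‖z - c₂‖ ^ 2 := by positivity
    simp only [hV']; linarith [hVM z]
  obtain ⟨B₁, hB₁⟩ := (isCompact_closedBall c₁ r).bddBelow_image hUc.continuousOn
  obtain ⟨B₂, hB₂⟩ := (isCompact_closedBall c₂ r).bddBelow_image hVc.continuousOn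
  set k₀ := max ((M - B₁) * (8 / κ ^ 2)) ((M - B₂) * (8 / κ ^ 2)) with hk₀
  obtain ⟨k, hk, hk0, μ, hμ, hgap⟩ := exists_supConv_gap hUc hVc hUM' hVM' hD0 hT hc (r := r)
    (fun z₁ z₂ hz hzr => by
      have h1 := hmax z₁ z₂ hz
      have h2 : 0 < e * (‖z₁ - c₁‖ ^ 2 + ‖z₂ - c₂‖ ^ 2) := by rw [hzr]; positivity
      simp only [hU', hV', sub_self, norm_zero]
      linarith) k₀
  obtain ⟨S₁, ξ₁, h₁⟩ := exists_isSupConv hUc hUM' hk0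
  obtain ⟨S₂, ξ₂, h₂⟩ := exists_isSupConv hVc hVM' hk0
  obtain ⟨z₁, z₂, p₁, p₂, H₁, H₂, hz₁, hz₂, hT₁, hT₂, hp₁, hp₂, hH⟩ :=
    exists_hasTaylor2_of_sum hk0 h₁.semiconvex h₂.semiconvex (D := D + k • T)
      (fun a b => by simp [inner_add_left, inner_add_right, inner_smul_left, inner_smul_right,
        hDs, hTs]) hr0 hμ (hgap S₁ ξ₁ S₂ ξ₂ h₁ h₂) he0
  have close : ∀ (U : E → ℝ) (S : E → ℝ) (ξ : E → E) (z c : E) (B : ℝ),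
      IsSupConv k U S ξ → (∀ z, U z ≤ M) → ‖z - c‖ < r → B ∈ lowerBounds (U '' closedBall c r) →
      (M - B) * (8 / κ ^ 2) < k → ‖ξ z - c‖ < κ := by
    intro U S ξ z c B h hM hz hB hkB
    have hUz : B ≤ U z := hB ⟨z, by rw [mem_closedBall, dist_eq_norm]; exact hz.le, rfl⟩
    have h1 := h.sq_le hM z
    have h2 : ‖ξ z - z‖ ≤ κ / 2 := by
      by_contra hlt
      push Not at hlt
      have h3 : (κ / 2) ^ 2 < ‖ξ z - z‖ ^ 2 := by gcongr
      have h4 : (M - B) * 8 < k * κ ^ 2 := by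
        rw [mul_div_assoc', div_lt_iff₀ (by positivity)] at hkB; exact hkB
      nlinarith
    have e1 : ξ z - c = (ξ z - z) + (z - c) := by abel
    rw [e1]
    refine (norm_add_le _ _).trans_lt ?_
    linarith
  have hξ₁ := close U' S₁ ξ₁ z₁ c₁ B₁ h₁ hUM' hz₁ hB₁ ((le_max_left _ _).trans_lt hk)
  have hξ₂ := close V' S₂ ξ₂ z₂ c₂ B₂ h₂ hVM' hz₂ hB₂ ((le_max_right _ _).trans_lt hk)
  have hDc : ‖D (z₁ - z₂) - D (c₁ - c₂)‖ ≤ κ / 2 := by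
    rw [← map_sub]
    have e1 : z₁ - z₂ - (c₁ - c₂) = (z₁ - c₁) - (z₂ - c₂) := by abel
    rw [e1]
    calc _ ≤ ‖D‖ * ‖(z₁ - c₁) - (z₂ - c₂)‖ := D.le_opNorm _
      _ ≤ (‖D‖ + 1) * (r + r) := by
        gcongr
        · linarith
        · exact (norm_sub_le _ _).trans (by linarith)
      _ = κ / 2 := by linarith
  have hsm : ∀ x : E, ‖x‖ < κ → ‖(2 * e) • x‖ ≤ κ / 4 := fun x hx => by
    rw [norm_smul, Real.norm_eq_abs, abs_of_pos (by positivity)]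
    nlinarith
  refine ⟨k, ξ₁ z₁, ξ₂ z₂, _, _, k • (z₁ - z₂), _, _, hξ₁, hξ₂,
    (h₁.hasUpperJet hT₁).add_sq, (h₂.hasUpperJet hT₂).add_sq, ?_, ?_, fun a b => ?_⟩
  · have e1 : p₁ + (2 * e) • (ξ₁ z₁ - c₁) - D (c₁ - c₂) - T (k • (z₁ - z₂)) =
        (p₁ - (D + k • T) (z₁ - z₂)) + (D (z₁ - z₂) - D (c₁ - c₂)) +
          (2 * e) • (ξ₁ z₁ - c₁) := by
      simp only [_root_.add_apply, _root_.smul_apply, map_smul]; abel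
    rw [e1]
    refine (norm_add₃_le).trans_lt ?_
    linarith [hsm _ hξ₁]
  · have e1 : p₂ + (2 * e) • (ξ₂ z₂ - c₂) + D (c₁ - c₂) + T (k • (z₁ - z₂)) =
        (p₂ + (D + k • T) (z₁ - z₂)) + -(D (z₁ - z₂) - D (c₁ - c₂)) +
          (2 * e) • (ξ₂ z₂ - c₂) := by
      simp only [_root_.add_apply, _root_.smul_apply, map_smul]; abel
    rw [e1]
    refine (norm_add₃_le).trans_lt ?_
    rw [norm_neg]
    linarith [hsm _ hξ₂]
  · have h3 := hH a b
    simp only [_root_.add_apply, _root_.smul_apply, ContinuousLinearMap.id_apply, inner_add_left,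
      inner_smul_left, conj_trivial, real_inner_self_eq_norm_sq, hT] at h3 ⊢
    nlinarith [sq_nonneg ‖a‖, sq_nonneg ‖b‖]

end Sums

section ParabolicSums

variable {F : Type*} [NormedAddCommGroup F] [InnerProductSpace ℝ F]

/-- `(a, p, X)` is an element of the closed parabolic superjet of `U` at `(t₀, x₀)`, up to
quadratic errors in time. -/
def ParabolicJet (U : ℝ → F → ℝ) (t₀ : ℝ) (x₀ : F) (a : ℝ) (p : F) (X : F →L[ℝ] F) : Prop :=
  ∀ κ > 0, ∃ K, ∀ᶠ z in 𝓝 (t₀, x₀),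
    U z.1 z.2 ≤ U t₀ x₀ + a * (z.1 - t₀) + ⟪p, z.2 - x₀⟫ + 1 / 2 * ⟪X (z.2 - x₀), z.2 - x₀⟫
      + κ * ‖z.2 - x₀‖ ^ 2 + K * (z.1 - t₀) ^ 2

/-- Adding a function with one-sided quadratic bounds shifts the parabolic jet. -/
lemma ParabolicJet.add {U G : ℝ → F → ℝ} {t₀ a a' c K' : ℝ} {x₀ p p' : F} {X : F →L[ℝ] F}
    (h : ParabolicJet U t₀ x₀ a p X)
    (hG : ∀ t x, G t x ≤ G t₀ x₀ + a' * (t - t₀) + ⟪p', x - x₀⟫ + 1 / 2 * (c * ‖x - x₀‖ ^ 2)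
      + K' * (t - t₀) ^ 2) :
    ParabolicJet (fun t x => U t x + G t x) t₀ x₀ (a + a') (p + p')
      (X + c • ContinuousLinearMap.id ℝ F) := by
  intro κ hκ
  obtain ⟨K, hK⟩ := h κ hκ
  refine ⟨K + K', hK.mono fun z hz => ?_⟩
  have h2 := hG z.1 z.2
  have h3 : ⟪(X + c • ContinuousLinearMap.id ℝ F) (z.2 - x₀), z.2 - x₀⟫
      = ⟪X (z.2 - x₀), z.2 - x₀⟫ + c * ‖z.2 - x₀‖ ^ 2 := by
    simp [inner_add_left, inner_smul_left]
  rw [h3, inner_add_left]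
  linarith

/-- The second component of a product as a continuous linear embedding. -/
def prodSnd : F →L[ℝ] WithLp 2 (ℝ × F) :=
  ((WithLp.prodContinuousLinearEquiv 2 ℝ ℝ F).symm : (ℝ × F) →L[ℝ] WithLp 2 (ℝ × F)) ∘L
    ContinuousLinearMap.inr ℝ ℝ F

/-- The first component of a product as a continuous linear embedding. -/
def prodFst : ℝ →L[ℝ] WithLp 2 (ℝ × F) :=
  ((WithLp.prodContinuousLinearEquiv 2 ℝ ℝ F).symm : (ℝ × F) →L[ℝ] WithLp 2 (ℝ × F)) ∘L
    ContinuousLinearMap.inl ℝ ℝ F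

lemma prodSnd_apply (x : F) : prodSnd x = WithLp.toLp 2 ((0 : ℝ), x) := rfl

lemma prodFst_apply (s : ℝ) : (prodFst s : WithLp 2 (ℝ × F)) = WithLp.toLp 2 (s, (0 : F)) := rfl

lemma HasUpperJet.parabolicJet {U : ℝ → F → ℝ} {z q : WithLp 2 (ℝ × F)}
    {H : WithLp 2 (ℝ × F) →L[ℝ] WithLp 2 (ℝ × F)}
    (h : HasUpperJet (fun z : WithLp 2 (ℝ × F) => U z.fst z.snd) z q H) :
    ParabolicJet U z.fst z.snd q.fst q.snd (WithLp.sndL 2 ℝ ℝ F ∘L H ∘L prodSnd) := by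
  intro κ hκ
  have hev := h (κ / 2) (by positivity)
  have hcont : Tendsto (fun y : ℝ × F => WithLp.toLp 2 y) (𝓝 (z.fst, z.snd)) (𝓝 z) :=
    ((WithLp.prodContinuousLinearEquiv 2 ℝ ℝ F).symm.continuous.tendsto (z.fst, z.snd))
  refine ⟨‖H‖ ^ 2 / (2 * κ) + ‖H‖ / 2 + κ / 2, (hcont.eventually hev).mono fun y hy => ?_⟩
  set s := y.1 - z.fst with hs
  set x := y.2 - z.snd with hx
  have e1 : WithLp.toLp 2 y - z = prodFst s + prodSnd x := by
    refine (WithLp.ofLp_injective 2) (Prod.ext ?_ ?_) <;>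
      simp [prodFst_apply, prodSnd_apply, hs, hx]
  have e2 : ‖WithLp.toLp 2 y - z‖ ^ 2 = s ^ 2 + ‖x‖ ^ 2 := by
    rw [WithLp.prod_norm_sq_eq_of_L2]
    simp [hs, hx]
  have e3 : ⟪q, WithLp.toLp 2 y - z⟫ = q.fst * s + ⟪q.snd, x⟫ := by
    rw [WithLp.prod_inner_apply]
    simp [hs, hx, mul_comm]
  have nF : ‖(prodFst s : WithLp 2 (ℝ × F))‖ = |s| := by
    rw [← sq_eq_sq₀ (norm_nonneg _) (abs_nonneg _), WithLp.prod_norm_sq_eq_of_L2, prodFst_apply]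
    simp
  have nS : ‖(prodSnd x : WithLp 2 (ℝ × F))‖ = ‖x‖ := by
    rw [← sq_eq_sq₀ (norm_nonneg _) (norm_nonneg _), WithLp.prod_norm_sq_eq_of_L2, prodSnd_apply]
    simp
  have e4 : ⟪H (prodSnd x), prodSnd x⟫ = ⟪(WithLp.sndL 2 ℝ ℝ F ∘L H ∘L prodSnd) x, x⟫ := by
    rw [WithLp.prod_inner_apply]
    simp [prodSnd_apply]
  have b1 : ⟪H (prodFst s), prodFst s⟫ ≤ ‖H‖ * s ^ 2 := by
    refine (real_inner_le_norm _ _).trans ?_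
    have := H.le_opNorm (prodFst s)
    rw [nF] at *
    calc _ ≤ ‖H‖ * |s| * |s| := by gcongr
      _ = ‖H‖ * s ^ 2 := by rw [mul_assoc, ← sq, sq_abs]
  have b2 : ⟪H (prodFst s), prodSnd x⟫ ≤ ‖H‖ * |s| * ‖x‖ := by
    refine (real_inner_le_norm _ _).trans ?_
    have := H.le_opNorm (prodFst s)
    rw [nF] at *
    rw [nS]
    gcongr
  have b3 : ⟪H (prodSnd x), prodFst s⟫ ≤ ‖H‖ * |s| * ‖x‖ := by
    refine (real_inner_le_norm _ _).trans ?_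
    have := H.le_opNorm (prodSnd x)
    rw [nS] at *
    rw [nF]
    nlinarith [abs_nonneg s]
  have b4 : ‖H‖ * |s| * ‖x‖ ≤ ‖H‖ ^ 2 / (2 * κ) * s ^ 2 + κ / 2 * ‖x‖ ^ 2 := by
    have : 0 ≤ (‖H‖ * |s| - κ * ‖x‖) ^ 2 / (2 * κ) := by positivity
    have h5 : (‖H‖ * |s| - κ * ‖x‖) ^ 2 / (2 * κ)
        = ‖H‖ ^ 2 / (2 * κ) * s ^ 2 + κ / 2 * ‖x‖ ^ 2 - ‖H‖ * |s| * ‖x‖ := by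
      rw [← sq_abs s]
      field_simp
      ring
    linarith
  have h6 : ⟪H (WithLp.toLp 2 y - z), WithLp.toLp 2 y - z⟫
      = ⟪H (prodFst s), prodFst s⟫ + ⟪H (prodFst s), prodSnd x⟫ + ⟪H (prodSnd x), prodFst s⟫
        + ⟪(WithLp.sndL 2 ℝ ℝ F ∘L H ∘L prodSnd) x, x⟫ := by
    rw [e1, map_add, inner_add_left, inner_add_right, inner_add_right, e4]
    ring
  rw [h6, e2, e3] at hy
  simp only [WithLp.toLp_fst, WithLp.toLp_snd] at hy
  nlinarith

/-- The parabolic theorem on sums. -/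
theorem exists_parabolicJet_of_max [FiniteDimensional ℝ F] {U V : ℝ → F → ℝ}
    (hU : Continuous fun z : ℝ × F => U z.1 z.2) (hV : Continuous fun z : ℝ × F => V z.1 z.2)
    {M : ℝ} (hUM : ∀ t x, U t x ≤ M) (hVM : ∀ t x, V t x ≤ M) {c : ℝ} (hc : 0 ≤ c) {t₀ : ℝ}
    {x₀ y₀ : F} (hmax : ∀ t x y, U t x + V t y - c / 2 * ‖x - y‖ ^ 2 ≤
      U t₀ x₀ + V t₀ y₀ - c / 2 * ‖x₀ - y₀‖ ^ 2) {κ : ℝ} (hκ : 0 < κ) :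
    ∃ (t₁ t₂ : ℝ) (x₁ y₂ : F) (a₁ a₂ : ℝ) (p₁ p₂ : F) (X Y : F →L[ℝ] F),
      |t₁ - t₀| < κ ∧ ‖x₁ - x₀‖ < κ ∧ |t₂ - t₀| < κ ∧ ‖y₂ - y₀‖ < κ ∧
      ParabolicJet U t₁ x₁ a₁ p₁ X ∧ ParabolicJet V t₂ y₂ a₂ p₂ Y ∧
      |a₁ + a₂| < κ ∧ ‖p₁ - c • (x₀ - y₀)‖ < κ ∧ ‖p₂ + c • (x₀ - y₀)‖ < κ ∧
      ∀ a b, ⟪X a, a⟫ + ⟪Y b, b⟫ ≤ c * ‖a - b‖ ^ 2 + κ * (‖a‖ ^ 2 + ‖b‖ ^ 2) := by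
  have hofLp : Continuous fun z : WithLp 2 (ℝ × F) => (z.fst, z.snd) :=
    (WithLp.prodContinuousLinearEquiv 2 ℝ ℝ F).continuous
  set D : WithLp 2 (ℝ × F) →L[ℝ] WithLp 2 (ℝ × F) := c • (prodSnd ∘L WithLp.sndL 2 ℝ ℝ F) with hD
  set T : WithLp 2 (ℝ × F) →L[ℝ] WithLp 2 (ℝ × F) := prodFst ∘L WithLp.fstL 2 ℝ ℝ F with hT
  have hDi : ∀ a b, ⟪D a, b⟫ = c * ⟪a.snd, b.snd⟫ := fun a b => by
    rw [hD, WithLp.prod_inner_apply]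
    simp [prodSnd_apply, inner_smul_left]
  have hTi : ∀ a b, ⟪T a, b⟫ = a.fst * b.fst := fun a b => by
    rw [hT, WithLp.prod_inner_apply]
    simp [prodFst_apply, mul_comm]
  have hTfst : ∀ a, (T a).fst = a.fst := fun a => rfl
  have hTsnd : ∀ a, (T a).snd = 0 := fun a => rfl
  have hDfst : ∀ a, (D a).fst = 0 := fun a => by simp [hD, prodSnd_apply]
  have hDsnd : ∀ a, (D a).snd = c • a.snd := fun a => by simp [hD, prodSnd_apply]
  have nfst : ∀ a : WithLp 2 (ℝ × F), |a.fst| ≤ ‖a‖ := fun a => by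
    refine abs_le_of_sq_le_sq' ?_ (norm_nonneg _) |> abs_le.2
    have := WithLp.prod_norm_sq_eq_of_L2 a
    rw [Real.norm_eq_abs, sq_abs] at this
    nlinarith [sq_nonneg ‖a.snd‖]
  have nsnd : ∀ a : WithLp 2 (ℝ × F), ‖a.snd‖ ≤ ‖a‖ := fun a => by
    refine abs_le_of_sq_le_sq' ?_ (norm_nonneg _) |>.2
    have := WithLp.prod_norm_sq_eq_of_L2 a
    nlinarith [sq_nonneg ‖a.fst‖]
  have key := exists_hasUpperJet_of_max (E := WithLp 2 (ℝ × F))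
    (U := fun z => U z.fst z.snd) (V := fun z => V z.fst z.snd) (hU.comp hofLp) (hV.comp hofLp)
    (M := M) (fun z => hUM _ _) (fun z => hVM _ _) (D := D) (T := T)
    (fun a b => by rw [hDi, real_inner_comm (D b), hDi, real_inner_comm])
    (fun a b => by rw [hTi, real_inner_comm (T b), hTi, mul_comm])
    (fun a => by rw [hDi, real_inner_self_eq_norm_sq]; positivity)
    (fun a => by
      rw [hTi, WithLp.prod_norm_sq_eq_of_L2, hTfst, hTsnd]
      simp [sq])
    (c₁ := WithLp.toLp 2 (t₀, x₀)) (c₂ := WithLp.toLp 2 (t₀, y₀)) rfl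
    (fun z₁ z₂ hz => by
      have hz' : z₁.fst = z₂.fst := by
        rw [← hTfst z₁, hz, hTfst]
      have := hmax z₁.fst z₁.snd z₂.snd
      simp only [hDi, WithLp.sub_snd, real_inner_self_eq_norm_sq, WithLp.toLp_fst, WithLp.toLp_snd]
      rw [← hz']
      linarith) (κ := κ / 2) (by positivity)
  obtain ⟨k, z₁, z₂, q₁, q₂, w, H₁, H₂, hz₁, hz₂, j₁, j₂, hq₁, hq₂, hH⟩ := key
  have s1 := (nfst _).trans_lt hz₁
  have s2 := (nsnd _).trans_lt hz₁
  have s3 := (nfst _).trans_lt hz₂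
  have s4 := (nsnd _).trans_lt hz₂
  have s5 := (nfst _).trans_lt hq₁
  have s6 := (nsnd _).trans_lt hq₁
  have s7 := (nfst _).trans_lt hq₂
  have s8 := (nsnd _).trans_lt hq₂
  simp only [WithLp.sub_fst, WithLp.sub_snd, WithLp.add_fst, WithLp.add_snd, hDfst, hDsnd, hTfst,
    hTsnd, WithLp.toLp_fst, WithLp.toLp_snd, sub_zero, add_zero] at s1 s2 s3 s4 s5 s6 s7 s8
  refine ⟨z₁.fst, z₂.fst, z₁.snd, z₂.snd, q₁.fst, q₂.fst, q₁.snd, q₂.snd, _, _, by linarith,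
    by linarith, by linarith, by linarith, j₁.parabolicJet, j₂.parabolicJet, ?_, by linarith,
    by linarith, fun a b => ?_⟩
  · rw [abs_lt] at *
    constructor <;> linarith [s5.1, s5.2, s7.1, s7.2]
  · have h := hH (prodSnd a) (prodSnd b)
    have n2 : ∀ a : F, ‖(prodSnd a : WithLp 2 (ℝ × F))‖ ^ 2 = ‖a‖ ^ 2 := fun a => by
      rw [WithLp.prod_norm_sq_eq_of_L2, prodSnd_apply]; simp
    have i2 : ∀ (H : WithLp 2 (ℝ × F) →L[ℝ] WithLp 2 (ℝ × F)) (a : F),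
        ⟪H (prodSnd a), prodSnd a⟫ = ⟪(WithLp.sndL 2 ℝ ℝ F ∘L H ∘L prodSnd) a, a⟫ := fun H a => by
      rw [WithLp.prod_inner_apply]
      simp [prodSnd_apply]
    have hT0 : T (prodSnd a - prodSnd b) = 0 := by
      rw [hT]; simp [prodSnd_apply]
    rw [i2, i2, n2, n2, hDi, hT0, ← map_sub, real_inner_self_eq_norm_sq] at h
    simp only [prodSnd_apply, WithLp.toLp_snd, norm_zero] at h
    nlinarith [sq_nonneg ‖a‖, sq_nonneg ‖b‖]

end ParabolicSums

section TestFunctions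

/-- A function of class `C²` in all variables is an admissible test function. -/
lemma C12.exists_of_contDiff {F : ℝ × Vec d → ℝ} (hF : ContDiff ℝ 2 F) :
    ∃ φ : C12 d, ∀ t x, φ.toFun t x = F (t, x) := by
  have hF1 : Differentiable ℝ F := hF.differentiable two_ne_zero
  have hdF : ContDiff ℝ 1 (fderiv ℝ F) := hF.fderiv_right (by norm_num)
  set G : ℝ × Vec d → Vec d := fun z =>
    (InnerProductSpace.toDual ℝ (Vec d)).symm
      (fderiv ℝ F z ∘L ContinuousLinearMap.inr ℝ ℝ (Vec d)) with hG
  have hG1 : ContDiff ℝ 1 G := by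
    refine (InnerProductSpace.toDual ℝ (Vec d)).symm.contDiff.comp ?_
    exact hdF.clm_comp contDiff_const
  set Hs : ℝ × Vec d → Vec d →L[ℝ] Vec d := fun z =>
    fderiv ℝ G z ∘L ContinuousLinearMap.inr ℝ ℝ (Vec d) with hHs
  have hHc : Continuous Hs :=
    (hG1.continuous_fderiv one_ne_zero).clm_comp continuous_const
  have hinr : ∀ t (x : Vec d), HasFDerivAt (fun y : Vec d => (t, y))
      (ContinuousLinearMap.inr ℝ ℝ (Vec d)) x := fun t x => hasFDerivAt_prodMk_right t x
  refine ⟨{ toFun := fun t x => F (t, x)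
            dt := fun t x => fderiv ℝ F (t, x) (1, 0)
            grad := fun t x => G (t, x)
            hess := fun t x => Matrix.toEuclideanLin.symm (Hs (t, x)).toLinearMap
            hasDt := fun t x => ?_
            hasGrad := fun t x => ?_
            hasHess := fun t x => ?_
            cont := hF.continuous
            cont_dt := ?_
            cont_grad := hG1.continuous
            cont_hess := ?_ }, fun t x => rfl⟩
  · have h1 : HasDerivAt (fun s : ℝ => (s, x)) (1, 0) t :=
      (hasDerivAt_id t).prodMk (hasDerivAt_const t x)
    exact (hF1 (t, x)).hasFDerivAt.comp_hasDerivAt t h1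
  · rw [hasGradientAt_iff_hasFDerivAt]
    simp only [hG, LinearIsometryEquiv.apply_symm_apply]
    exact (hF1 (t, x)).hasFDerivAt.comp x (hinr t x)
  · have h1 := ((hG1.differentiable one_ne_zero) (t, x)).hasFDerivAt.comp x (hinr t x)
    have h2 : (Matrix.toEuclideanLin (Matrix.toEuclideanLin.symm
        (Hs (t, x)).toLinearMap)).toContinuousLinearMap = Hs (t, x) := by
      rw [LinearEquiv.apply_symm_apply]
      rfl
    rw [h2]
    exact h1
  · exact (hdF.continuous.clm_apply continuous_const)
  · refine continuous_matrix fun i j => ?_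
    have h3 : ∀ z : ℝ × Vec d, (Matrix.toEuclideanLin.symm (Hs z).toLinearMap) i j
        = Hs z (EuclideanSpace.single j 1) i := by
      intro z
      have h4 : Matrix.toEuclideanLin (Matrix.toEuclideanLin.symm (Hs z).toLinearMap)
          (EuclideanSpace.single j 1) = Hs z (EuclideanSpace.single j 1) := by
        rw [LinearEquiv.apply_symm_apply]
        rfl
      rw [← h4, Matrix.toLpLin_apply]
      simp only [PiLp.ofLp_single, Matrix.mulVec_single_one, Matrix.col_apply]
    simp only [h3]
    exact (EuclideanSpace.proj i : Vec d →L[ℝ] ℝ).continuous.comp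
      (hHc.clm_apply continuous_const)

/-- A function touching `U` from above near a point can be modified away from it into a global
majorant close to `U`. -/
lemma exists_contDiff_touching {E : Type*} [NormedAddCommGroup E] [NormedSpace ℝ E]
    [FiniteDimensional ℝ E] {U P : E → ℝ} (hU : Continuous U) (hP : ContDiff ℝ 2 P) {z₀ : E}
    (hle : ∀ᶠ z in 𝓝 z₀, U z ≤ P z) (heq : P z₀ = U z₀) {κ : ℝ} (hκ : 0 < κ) :
    ∃ F : E → ℝ, ContDiff ℝ 2 F ∧ F =ᶠ[𝓝 z₀] P ∧ ∀ z, U z ≤ F z ∧ F z ≤ U z + κ := by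
  have hlt : ∀ᶠ z in 𝓝 z₀, P z < U z + κ := by
    refine (hP.continuous.tendsto z₀).eventually_lt ((hU.tendsto z₀).add_const κ) ?_
    linarith
  obtain ⟨r, hr, hball⟩ := Metric.eventually_nhds_iff_ball.1 (hle.and hlt)
  let χ : ContDiffBump z₀ := ⟨r / 2, r, by positivity, by linarith⟩
  obtain ⟨w, hw, hwd, -⟩ := (hU.add_const (κ / 2)).exists_contDiff_approx (n := 2)
    (ε := fun _ => κ / 2) continuous_const (fun _ => by positivity)
  have hw' : ∀ z, U z ≤ w z ∧ w z ≤ U z + κ := fun z => by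
    have := hwd z
    rw [Real.dist_eq, abs_lt] at this
    constructor <;> linarith [this.1, this.2]
  refine ⟨fun z => χ z * P z + (1 - χ z) * w z, ?_, ?_, fun z => ?_⟩
  · exact (χ.contDiff.mul hP).add ((contDiff_const.sub χ.contDiff).mul (by exact_mod_cast hw))
  · filter_upwards [χ.eventuallyEq_one] with z hz
    simp [hz]
  · by_cases hz : z ∈ ball z₀ r
    · have h1 := hball z hz
      have h2 := hw' z
      have h3 := χ.nonneg (x := z)
      have h4 := χ.le_one (x := z)
      constructor <;> nlinarith
    · have h5 : χ z = 0 := χ.zero_of_le_dist (by simpa using hz)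
      simpa [h5] using hw' z

/-- A parabolic jet is realised by a globally touching test function. -/
lemma ParabolicJet.exists_testFunction {U : ℝ → Vec d → ℝ}
    (hU : Continuous fun z : ℝ × Vec d => U z.1 z.2) {t₀ a : ℝ} {x₀ p : Vec d}
    {X : Vec d →L[ℝ] Vec d} (h : ParabolicJet U t₀ x₀ a p X) {κ : ℝ} (hκ : 0 < κ) :
    ∃ φ : C12 d, (∀ t x, U t x ≤ φ.toFun t x ∧ φ.toFun t x ≤ U t x + κ) ∧
      φ.toFun t₀ x₀ = U t₀ x₀ ∧ φ.dt t₀ x₀ = a ∧ φ.grad t₀ x₀ = p ∧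
      ∀ v, ⟪Matrix.toEuclideanLin (φ.hess t₀ x₀) v, v⟫ = ⟪X v, v⟫ + κ * ‖v‖ ^ 2 := by
  obtain ⟨K, hK⟩ := h (κ / 2) (by positivity)
  set P : ℝ × Vec d → ℝ := fun z => U t₀ x₀ + a * (z.1 - t₀) + ⟪p, z.2 - x₀⟫
    + 1 / 2 * ⟪X (z.2 - x₀), z.2 - x₀⟫ + κ / 2 * ‖z.2 - x₀‖ ^ 2 + K * (z.1 - t₀) ^ 2 with hPdef
  have hP : ContDiff ℝ 2 P := by
    have h2 : ContDiff ℝ 2 fun z : ℝ × Vec d => z.2 - x₀ := by fun_prop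
    have h3 : ContDiff ℝ 2 fun z : ℝ × Vec d => ⟪p, z.2 - x₀⟫ := contDiff_const.inner ℝ h2
    have h4 : ContDiff ℝ 2 fun z : ℝ × Vec d => ⟪X (z.2 - x₀), z.2 - x₀⟫ :=
      (X.contDiff.comp h2).inner ℝ h2
    have h5 : ContDiff ℝ 2 fun z : ℝ × Vec d => ‖z.2 - x₀‖ ^ 2 := h2.norm_sq ℝ
    fun_prop
  obtain ⟨F, hF, hFP, hFU⟩ := exists_contDiff_touching (z₀ := (t₀, x₀)) hU hP hK
    (by simp [hPdef]) hκ
  obtain ⟨φ, hφ⟩ := C12.exists_of_contDiff hF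
  have hφP : ∀ᶠ z in 𝓝 (t₀, x₀), φ.toFun z.1 z.2 = P z := hFP.mono fun z hz => by rw [hφ, hz]
  have htl : Tendsto (fun t : ℝ => (t, x₀)) (𝓝 t₀) (𝓝 (t₀, x₀)) :=
    (Continuous.prodMk_left x₀).tendsto t₀
  have hxl : Tendsto (fun x : Vec d => (t₀, x)) (𝓝 x₀) (𝓝 (t₀, x₀)) :=
    (Continuous.prodMk_right t₀).tendsto x₀
  set L : Vec d →L[ℝ] Vec d := (1 / 2 : ℝ) • (X + X.adjoint) + κ • ContinuousLinearMap.id ℝ (Vec d)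
    with hL
  have hgradP : ∀ x, HasGradientAt (fun x => P (t₀, x)) (p + L (x - x₀)) x := by
    intro x
    rw [hasGradientAt_iff_hasFDerivAt]
    have d1 : HasFDerivAt (fun y : Vec d => y - x₀) (ContinuousLinearMap.id ℝ (Vec d)) x :=
      (hasFDerivAt_id x).sub_const x₀
    have d2 := (hasFDerivAt_const p x).inner ℝ d1
    have d3 := (X.hasFDerivAt.comp x d1).inner ℝ d1
    have d4 := d1.norm_sq
    have d5 := (((d2.const_add (U t₀ x₀ + a * (t₀ - t₀))).add (d3.const_mul (1 / 2))).add
      (d4.const_mul (κ / 2))).add_const (K * (t₀ - t₀) ^ 2)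
    refine d5.congr_fderiv ?_
    ext v
    simp [hL, inner_sub_left, inner_sub_right,
      ContinuousLinearMap.adjoint_inner_left, real_inner_comm]
    ring
  have hgrad : ∀ᶠ x in 𝓝 x₀, φ.grad t₀ x = p + L (x - x₀) := by
    filter_upwards [(hxl.eventually hφP).eventually_nhds] with x hx
    exact (φ.hasGrad t₀ x).unique ((hgradP x).congr_of_eventuallyEq hx)
  refine ⟨φ, fun t x => by rw [hφ]; exact hFU (t, x), ?_, ?_, ?_, fun v => ?_⟩
  · rw [hφP.self_of_nhds]
    simp [hPdef]
  · have e1 : HasDerivAt (fun t => P (t, x₀)) a t₀ := by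
      have d1 : HasDerivAt (fun t : ℝ => t - t₀) 1 t₀ := (hasDerivAt_id t₀).sub_const t₀
      have d2 := (((d1.const_mul a).const_add (U t₀ x₀)).add ((d1.pow 2).const_mul K))
      refine (d2.congr_deriv (by simp)).congr_of_eventuallyEq (Eventually.of_forall fun t => ?_)
      simp [hPdef]
    exact (φ.hasDt t₀ x₀).unique (e1.congr_of_eventuallyEq (htl.eventually hφP))
  · simpa using hgrad.self_of_nhds
  · have e1 : HasFDerivAt (fun x => p + L (x - x₀)) L x₀ := by
      have := (L.hasFDerivAt.comp x₀ ((hasFDerivAt_id x₀).sub_const x₀)).const_add p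
      exact this
    have e2 := (φ.hasHess t₀ x₀).unique (e1.congr_of_eventuallyEq hgrad)
    have e3 : Matrix.toEuclideanLin (φ.hess t₀ x₀) v = L v := congrArg (fun f => f v) e2
    rw [e3, hL]
    simp [inner_add_left, inner_smul_left, ContinuousLinearMap.adjoint_inner_left, real_inner_comm]
    ring

/-- The `j`-th column of a matrix. -/
def colE (S : Matrix (Fin d) (Fin d) ℝ) (j : Fin d) : Vec d := WithLp.toLp 2 fun i => S i j

lemma trace_mul_transpose_mul (S H : Matrix (Fin d) (Fin d) ℝ) :
    Matrix.trace (S * Sᵀ * H) = ∑ j, ⟪Matrix.toEuclideanLin H (colE S j), colE S j⟫ := by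
  rw [Matrix.mul_assoc, Matrix.trace_mul_comm, Matrix.trace]
  refine Finset.sum_congr rfl fun j _ => ?_
  simp only [Matrix.diag_apply, Matrix.mul_apply, PiLp.inner_apply, Matrix.transpose_apply, colE,
    Matrix.toLpLin_apply, Matrix.mulVec, dotProduct, RCLike.inner_apply, conj_trivial,
    Finset.sum_mul, Finset.mul_sum]
  rw [Finset.sum_comm]
  exact Finset.sum_congr rfl fun _ _ => Finset.sum_congr rfl fun _ _ => by ring

lemma mvE_transpose_apply (S : Matrix (Fin d) (Fin d) ℝ) (p : Vec d) (j : Fin d) :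
    mvE Sᵀ p j = ⟪colE S j, p⟫ := by
  simp [mvE, colE, Matrix.mulVec, dotProduct, PiLp.inner_apply, mul_comm]

end TestFunctions

section Coefficients

lemma le_add_of_young {G G' δ : ℝ} (hG' : 0 ≤ G') (hδ : 0 ≤ δ)
    (h : ∀ s > 0, G ^ 2 ≤ (1 + s) * G' ^ 2 + (1 + 1 / s) * δ ^ 2) : G ≤ G' + δ := by
  refine abs_le_of_sq_le_sq' ?_ (by positivity) |>.2
  refine le_of_forall_pos_le_add fun e he => ?_
  set t := e / (G' + δ + 1) with ht
  have ht0 : 0 < t := by positivity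
  have hte : t * (G' + δ + 1) = e := by rw [ht]; field_simp
  have h1 := h ((δ + t) / (G' + t)) (by positivity)
  have h2 : (δ + t) / (G' + t) * G' ^ 2 ≤ (δ + t) * G' := by
    rw [div_mul_eq_mul_div, div_le_iff₀ (by positivity)]
    nlinarith [mul_nonneg (mul_nonneg hδ hG') ht0.le, mul_nonneg (mul_nonneg ht0.le hG') ht0.le]
  have h3 : 1 / ((δ + t) / (G' + t)) * δ ^ 2 ≤ (G' + t) * δ := by
    rw [one_div_div, div_mul_eq_mul_div, div_le_iff₀ (by positivity)]
    nlinarith [mul_nonneg (mul_nonneg hδ hG') ht0.le, mul_nonneg (mul_nonneg ht0.le hδ) ht0.le]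
  nlinarith

lemma norm_le_sum_abs (v : Vec d) : ‖v‖ ≤ ∑ i, |v i| := by
  rw [EuclideanSpace.norm_eq]
  refine Real.sqrt_le_iff.2 ⟨by positivity, ?_⟩
  simpa using Finset.sum_sq_le_sq_sum_of_nonneg (s := Finset.univ) (f := fun i => |v i|)
    fun i _ => abs_nonneg _

lemma abs_apply_le_norm (v : Vec d) (i : Fin d) : |v i| ≤ ‖v‖ := by
  simpa using PiLp.norm_apply_le v i

/-- A reverse triangle inequality for the `ℝ × L²` norm. -/
lemma sqrt_sq_add_integral_le {X : Type*} [MeasurableSpace X] {μ : Measure X} {F F' : X → ℝ}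
    (hF : Integrable (fun e => F e ^ 2) μ) (hF' : Integrable (fun e => F' e ^ 2) μ)
    (hFF : Integrable (fun e => (F e - F' e) ^ 2) μ) (a a' : ℝ) :
    √(a ^ 2 + ∫ e, F e ^ 2 ∂μ) ≤ √(a' ^ 2 + ∫ e, F' e ^ 2 ∂μ)
      + √((a - a') ^ 2 + ∫ e, (F e - F' e) ^ 2 ∂μ) := by
  refine le_add_of_young (Real.sqrt_nonneg _) (Real.sqrt_nonneg _) fun s hs => ?_
  have i1 : 0 ≤ ∫ e, F e ^ 2 ∂μ := integral_nonneg fun e => sq_nonneg _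
  have i2 : 0 ≤ ∫ e, F' e ^ 2 ∂μ := integral_nonneg fun e => sq_nonneg _
  have i3 : 0 ≤ ∫ e, (F e - F' e) ^ 2 ∂μ := integral_nonneg fun e => sq_nonneg _
  rw [Real.sq_sqrt (by positivity), Real.sq_sqrt (by positivity), Real.sq_sqrt (by positivity)]
  have key : ∀ x y : ℝ, x ^ 2 ≤ (1 + s) * y ^ 2 + (1 + 1 / s) * (x - y) ^ 2 := fun x y => by
    have h1 : 0 ≤ (s * y - (x - y)) ^ 2 / s := by positivity
    have h2 : (s * y - (x - y)) ^ 2 / s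
        = (1 + s) * y ^ 2 + (1 + 1 / s) * (x - y) ^ 2 - x ^ 2 := by
      field_simp
      ring
    linarith
  have h4 : ∫ e, F e ^ 2 ∂μ ≤ (1 + s) * ∫ e, F' e ^ 2 ∂μ
      + (1 + 1 / s) * ∫ e, (F e - F' e) ^ 2 ∂μ := by
    rw [← integral_const_mul, ← integral_const_mul,
      ← integral_add (hF'.const_mul _) (hFF.const_mul _)]
    exact integral_mono hF ((hF'.const_mul _).add (hFF.const_mul _)) fun e => key _ _
  linarith [key a a']

lemma norm_mvE_sub_le (S S' : Matrix (Fin d) (Fin d) ℝ) (p p' : Vec d) :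
    ‖mvE Sᵀ p - mvE S'ᵀ p'‖ ≤
      ∑ j, (‖colE S j - colE S' j‖ * ‖p‖ + ‖colE S' j‖ * ‖p - p'‖) := by
  refine (norm_le_sum_abs _).trans (Finset.sum_le_sum fun j _ => ?_)
  rw [PiLp.sub_apply, mvE_transpose_apply, mvE_transpose_apply]
  have : ⟪colE S j, p⟫ - ⟪colE S' j, p'⟫ = ⟪colE S j - colE S' j, p⟫ + ⟪colE S' j, p - p'⟫ := by
    rw [inner_sub_left, inner_sub_right]; ring
  rw [this]
  exact (abs_add_le _ _).trans (add_le_add (abs_real_inner_le_norm _ _) (abs_real_inner_le_norm _ _))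

variable {ν : Measure (Vec n)} {A : Set (Vec m)} {T : ℝ}
  {b : Vec m → Vec d → Vec d} {σ : Vec m → Vec d → Matrix (Fin d) (Fin d) ℝ}
  {η : Vec m → Vec d → Vec n → Vec d} {γ : Vec d → Vec n → ℝ}
  {f : Vec m → ℝ → Vec d → ℝ → Vec d → ℝ → ℝ}
  {ζ : ℝ → Vec d → ℝ} {g : Vec d → ℝ} {C : ℝ} {ε : ℝ}

lemma min_one_norm_sq (e : Vec n) : (min 1 ‖e‖) ^ 2 = min 1 (‖e‖ ^ 2) := by
  rcases le_total 1 ‖e‖ with h | h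
  · rw [min_eq_left h, min_eq_left (by nlinarith)]; norm_num
  · rw [min_eq_right h, min_eq_right (by nlinarith [norm_nonneg e])]

namespace AssumptionA

lemma isFiniteMeasure (hA : AssumptionA ν A T b σ η γ f ζ g C) (hε : 0 < ε) :
    IsFiniteMeasure (ν.restrict {e : Vec n | ε < ‖e‖}) := by
  refine ⟨?_⟩
  rw [Measure.restrict_apply_univ]
  refine lt_of_le_of_lt (measure_mono ?_)
    (hA.hν_int.measure_norm_ge_lt_top (ε := min 1 (ε ^ 2)) (by positivity))
  intro e he
  simp only [mem_ofPred_eq] at he ⊢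
  rw [Real.norm_of_nonneg (by positivity)]
  exact min_le_min le_rfl (by gcongr)

lemma exists_lipschitz (hA : AssumptionA ν A T b σ η γ f ζ g C) (ε : ℝ) :
    ∃ L > 0, (∀ α ∈ A, ∀ α' ∈ A, ∀ x x' j,
        ‖colE (sigmaTilde ν σ η ε α x) j - colE (sigmaTilde ν σ η ε α' x') j‖ ≤
          L * (‖x - x'‖ + ‖α - α'‖)) ∧
      (∀ α ∈ A, ∀ x j, ‖colE (sigmaTilde ν σ η ε α x) j‖ ≤ L * (1 + ‖x‖)) ∧
      ∀ α ∈ A, ∀ x, ‖b α x‖ ≤ L * (1 + ‖x‖) := by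
  have hC := hA.hC
  set I := ∫ e, min 1 (‖e‖ ^ 2) ∂ν with hI
  have hI0 : 0 ≤ I := integral_nonneg fun e => by positivity
  set μ := ν.restrict {e : Vec n | ‖e‖ < ε} with hμ
  have hint : Integrable (fun e : Vec n => min 1 (‖e‖ ^ 2)) μ := hA.hν_int.restrict
  have hIμ : ∫ e, min 1 (‖e‖ ^ 2) ∂μ ≤ I :=
    setIntegral_le_integral hA.hν_int (Eventually.of_forall fun e => by positivity)
  have hηsq : ∀ α ∈ A, ∀ x i, Integrable (fun e => (η α x e i) ^ 2) μ := by
    intro α hα x i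
    refine (hint.const_mul (C ^ 2)).mono' ?_ (Eventually.of_forall fun e => ?_)
    · exact (((EuclideanSpace.proj i : Vec d →L[ℝ] ℝ).continuous.measurable.comp
        (hA.hη_meas α x)).pow_const 2).aestronglyMeasurable
    · rw [Real.norm_of_nonneg (sq_nonneg _), ← min_one_norm_sq, ← mul_pow, ← sq_abs]
      gcongr
      exact (abs_apply_le_norm _ _).trans (hA.hη_bdd α hα x e)
  have hηd : ∀ α ∈ A, ∀ α' ∈ A, ∀ x x' i e, (η α x e i - η α' x' e i) ^ 2 ≤
      (C * (‖x - x'‖ + ‖α - α'‖)) ^ 2 * min 1 (‖e‖ ^ 2) := by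
    intro α hα α' hα' x x' i e
    rw [← min_one_norm_sq, ← mul_pow, ← sq_abs]
    gcongr
    exact (abs_apply_le_norm (η α x e - η α' x' e) i).trans (hA.hη_lip α hα α' hα' x x' e)
  have hηdi : ∀ α ∈ A, ∀ α' ∈ A, ∀ x x' i,
      Integrable (fun e => (η α x e i - η α' x' e i) ^ 2) μ := by
    intro α hα α' hα' x x' i
    refine (hint.const_mul ((C * (‖x - x'‖ + ‖α - α'‖)) ^ 2)).mono' ?_
      (Eventually.of_forall fun e => ?_)
    · exact (((EuclideanSpace.proj i : Vec d →L[ℝ] ℝ).continuous.measurable.comp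
        ((hA.hη_meas α x).sub (hA.hη_meas α' x'))).pow_const 2).aestronglyMeasurable
    · rw [Real.norm_of_nonneg (sq_nonneg _)]
      exact hηd α hα α' hα' x x' i e
  set L₀ := C * √(1 + I) with hL₀
  have hsq1 : 1 ≤ √(1 + I) := Real.one_le_sqrt.2 (by linarith)
  have hCL : C ≤ L₀ := by rw [hL₀]; nlinarith
  have hσ : ∀ α ∈ A, ∀ α' ∈ A, ∀ x x' i j, |σ α x i j - σ α' x' i j| ≤
      C * (‖x - x'‖ + ‖α - α'‖) := by
    intro α hα α' hα' x x' i j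
    have h1 := hA.hb α hα α' hα' x x'
    have h2 : ‖(σ α x - σ α' x') i j‖ ≤ ‖σ α x - σ α' x'‖ := Matrix.norm_entry_le_entrywise_sup_norm _
    rw [Real.norm_eq_abs, Matrix.sub_apply] at h2
    linarith [norm_nonneg (b α x - b α' x')]
  have hdiag : ∀ α ∈ A, ∀ α' ∈ A, ∀ x x' i,
      sigmaTilde ν σ η ε α x i i ≤ sigmaTilde ν σ η ε α' x' i i
        + L₀ * (‖x - x'‖ + ‖α - α'‖) := by
    intro α hα α' hα' x x' i
    have h1 := sqrt_sq_add_integral_le (hηsq α hα x i) (hηsq α' hα' x' i)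
      (hηdi α hα α' hα' x x' i) (σ α x i i) (σ α' x' i i)
    simp only [sigmaTilde, Matrix.of_apply, if_true]
    refine h1.trans (add_le_add le_rfl (Real.sqrt_le_iff.2 ⟨by positivity, ?_⟩))
    have h2 : ∫ e, (η α x e i - η α' x' e i) ^ 2 ∂μ ≤
        (C * (‖x - x'‖ + ‖α - α'‖)) ^ 2 * I := by
      refine (integral_mono (hηdi α hα α' hα' x x' i) (hint.const_mul _)
        (hηd α hα α' hα' x x' i)).trans ?_
      rw [integral_const_mul]
      gcongr
    have h3 : (σ α x i i - σ α' x' i i) ^ 2 ≤ (C * (‖x - x'‖ + ‖α - α'‖)) ^ 2 := by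
      rw [← sq_abs]
      gcongr
      exact hσ α hα α' hα' x x' i i
    rw [hL₀, mul_pow, mul_pow, Real.sq_sqrt (by positivity)]
    rw [mul_pow] at h2 h3
    linarith
  have hent : ∀ α ∈ A, ∀ α' ∈ A, ∀ x x' i j,
      |sigmaTilde ν σ η ε α x i j - sigmaTilde ν σ η ε α' x' i j| ≤
        L₀ * (‖x - x'‖ + ‖α - α'‖) := by
    intro α hα α' hα' x x' i j
    by_cases hij : i = j
    · subst hij
      have h1 := hdiag α hα α' hα' x x' i
      have h2 := hdiag α' hα' α hα x' x i
      rw [norm_sub_rev x' x, norm_sub_rev α' α] at h2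
      exact abs_le.2 ⟨by linarith, by linarith⟩
    · simp only [sigmaTilde, Matrix.of_apply, if_neg hij]
      refine (hσ α hα α' hα' x x' i j).trans ?_
      gcongr
  set L₁ := d * L₀ with hL₁
  have hL₁0 : 0 ≤ L₁ := by positivity
  have hcol : ∀ α ∈ A, ∀ α' ∈ A, ∀ x x' j,
        ‖colE (sigmaTilde ν σ η ε α x) j - colE (sigmaTilde ν σ η ε α' x') j‖ ≤
          L₁ * (‖x - x'‖ + ‖α - α'‖) := by
    intro α hα α' hα' x x' j
    refine (norm_le_sum_abs _).trans ((Finset.sum_le_sum fun i _ =>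
      hent α hα α' hα' x x' i j).trans ?_)
    simp [hL₁, mul_assoc]
  obtain ⟨α₀, hα₀⟩ := hA.hAne
  obtain ⟨R, hR⟩ := hA.hAcpt.isBounded.exists_norm_le
  have hR0 : 0 ≤ R := (norm_nonneg _).trans (hR α₀ hα₀)
  set B₀ := ‖b α₀ 0‖ + ∑ j, ‖colE (sigmaTilde ν σ η ε α₀ 0) j‖ with hB₀
  have hB0 : 0 ≤ B₀ := by positivity
  have hRR : ∀ α ∈ A, ‖α - α₀‖ ≤ 2 * R := fun α hα =>
    (norm_sub_le _ _).trans (by linarith [hR α hα, hR α₀ hα₀])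
  refine ⟨B₀ + (L₁ + C) * (1 + 2 * R), by positivity, ?_, ?_, ?_⟩
  · intro α hα α' hα' x x' j
    refine (hcol α hα α' hα' x x' j).trans ?_
    gcongr
    nlinarith [mul_nonneg hL₁0 hR0, mul_nonneg hC.le hR0]
  · intro α hα x j
    have h1 := hcol α hα α₀ hα₀ x 0 j
    have h2 := norm_le_norm_add_norm_sub (colE (sigmaTilde ν σ η ε α₀ 0) j)
      (colE (sigmaTilde ν σ η ε α x) j)
    rw [norm_sub_rev] at h2
    have h3 : ‖colE (sigmaTilde ν σ η ε α₀ 0) j‖ ≤ B₀ :=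
      (Finset.single_le_sum (f := fun j => ‖colE (sigmaTilde ν σ η ε α₀ 0) j‖)
        (fun i _ => norm_nonneg _) (Finset.mem_univ j)).trans (by
          rw [hB₀]; linarith [norm_nonneg (b α₀ 0)])
    rw [sub_zero] at h1
    have h4 : L₁ * (‖x‖ + ‖α - α₀‖) ≤ L₁ * (‖x‖ + 2 * R) := by
      gcongr; exact hRR α hα
    nlinarith [norm_nonneg x, mul_nonneg hL₁0 hR0, mul_nonneg hC.le hR0, mul_nonneg hB0 (norm_nonneg x),
      mul_nonneg (mul_nonneg hL₁0 hR0) (norm_nonneg x), mul_nonneg (mul_nonneg hC.le hR0) (norm_nonneg x),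
      mul_nonneg hC.le (norm_nonneg x), mul_nonneg hL₁0 (norm_nonneg x)]
  · intro α hα x
    have h1 := hA.hb α hα α₀ hα₀ x 0
    have h2 := norm_le_norm_add_norm_sub (b α₀ 0) (b α x)
    rw [norm_sub_rev] at h2
    have h3 : ‖b α₀ 0‖ ≤ B₀ := by
      rw [hB₀]
      linarith [Finset.sum_nonneg (s := Finset.univ) fun j (_ : j ∈ Finset.univ) =>
        norm_nonneg (colE (sigmaTilde ν σ η ε α₀ 0) j)]
    rw [sub_zero] at h1
    have h4 : C * (‖x‖ + ‖α - α₀‖) ≤ C * (‖x‖ + 2 * R) := by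
      gcongr; exact hRR α hα
    nlinarith [norm_nonneg x, mul_nonneg hL₁0 hR0, mul_nonneg hC.le hR0, mul_nonneg hB0 (norm_nonneg x),
      mul_nonneg (mul_nonneg hL₁0 hR0) (norm_nonneg x), mul_nonneg (mul_nonneg hC.le hR0) (norm_nonneg x),
      mul_nonneg hC.le (norm_nonneg x), mul_nonneg hL₁0 (norm_nonneg x), norm_nonneg (σ α x - σ α₀ 0)]

end AssumptionA

end Coefficients

section JetConditions

/-- The compensated jump operator evaluated at a function and a slope. -/
def jumpK (ν : Measure (Vec n)) (η : Vec m → Vec d → Vec n → Vec d) (ε : ℝ) (w : Vec d → ℝ)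
    (p : Vec d) (α : Vec m) (x : Vec d) : ℝ :=
  ∫ e, (w (x + η α x e) - w x - ⟪η α x e, p⟫) ∂ν.restrict {e : Vec n | ε < ‖e‖}

/-- The weighted jump operator evaluated at a function. -/
def jumpB (ν : Measure (Vec n)) (η : Vec m → Vec d → Vec n → Vec d) (γ : Vec d → Vec n → ℝ)
    (ε : ℝ) (w : Vec d → ℝ) (α : Vec m) (x : Vec d) : ℝ :=
  ∫ e, (w (x + η α x e) - w x) * γ x e ∂ν.restrict {e : Vec n | ε < ‖e‖}

/-- The Hamiltonian for the control `α` evaluated on a parabolic jet of `u`. -/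
def jetHam (ν : Measure (Vec n)) (b : Vec m → Vec d → Vec d)
    (σ : Vec m → Vec d → Matrix (Fin d) (Fin d) ℝ) (η : Vec m → Vec d → Vec n → Vec d)
    (γ : Vec d → Vec n → ℝ) (f : Vec m → ℝ → Vec d → ℝ → Vec d → ℝ → ℝ) (ε : ℝ)
    (u : ℝ → Vec d → ℝ) (t : ℝ) (x : Vec d) (a : ℝ) (p : Vec d) (X : Vec d →L[ℝ] Vec d)
    (α : Vec m) : ℝ :=
  a - 1 / 2 * ∑ j, ⟪X (colE (sigmaTilde ν σ η ε α x) j), colE (sigmaTilde ν σ η ε α x) j⟫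
    - ⟪b α x, p⟫ - jumpK ν η ε (u t) p α x
    - f α t x (u t x) (mvE (sigmaTilde ν σ η ε α x)ᵀ p) (jumpB ν η γ ε (u t) α x)

/-- The subsolution inequality for jets. -/
def SubsolnJets (ν : Measure (Vec n)) (S : Set (Vec m)) (T : ℝ) (b : Vec m → Vec d → Vec d)
    (σ : Vec m → Vec d → Matrix (Fin d) (Fin d) ℝ) (η : Vec m → Vec d → Vec n → Vec d)
    (γ : Vec d → Vec n → ℝ) (f : Vec m → ℝ → Vec d → ℝ → Vec d → ℝ → ℝ) (ζ : ℝ → Vec d → ℝ)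
    (ε : ℝ) (u : ℝ → Vec d → ℝ) : Prop :=
  ∀ t₀ ∈ Ioc (0 : ℝ) T, ∀ x₀ a p X, ParabolicJet u t₀ x₀ a p X →
    u t₀ x₀ ≤ ζ t₀ x₀ ∨ ∀ κ > 0, ∃ α ∈ S, jetHam ν b σ η γ f ε u t₀ x₀ a p X α ≤ κ

/-- The supersolution inequality for jets. -/
def SupersolnJets (ν : Measure (Vec n)) (S : Set (Vec m)) (T : ℝ) (b : Vec m → Vec d → Vec d)
    (σ : Vec m → Vec d → Matrix (Fin d) (Fin d) ℝ) (η : Vec m → Vec d → Vec n → Vec d)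
    (γ : Vec d → Vec n → ℝ) (f : Vec m → ℝ → Vec d → ℝ → Vec d → ℝ → ℝ) (ζ : ℝ → Vec d → ℝ)
    (ε : ℝ) (v : ℝ → Vec d → ℝ) : Prop :=
  ∀ t₀ ∈ Ioc (0 : ℝ) T, ∀ x₀ a p X, ParabolicJet (fun t x => -v t x) t₀ x₀ a p X →
    ζ t₀ x₀ ≤ v t₀ x₀ ∧ ∀ α ∈ S, 0 ≤ jetHam ν b σ η γ f ε v t₀ x₀ (-a) (-p) (-X) α

/-- The negative of a test function. -/
def C12.neg (φ : C12 d) : C12 d where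
  toFun t x := -φ.toFun t x
  dt t x := -φ.dt t x
  grad t x := -φ.grad t x
  hess t x := -φ.hess t x
  hasDt t x := (φ.hasDt t x).neg
  hasGrad t x := by
    have := (φ.hasGrad t x).hasFDerivAt.neg
    rw [hasGradientAt_iff_hasFDerivAt, map_neg]
    exact this
  hasHess t x := by
    refine (φ.hasHess t x).neg.congr_fderiv ?_
    ext v
    simp
  cont := φ.cont.neg
  cont_dt := φ.cont_dt.neg
  cont_grad := φ.cont_grad.neg
  cont_hess := φ.cont_hess.neg

variable {ν : Measure (Vec n)} {A : Set (Vec m)} {T : ℝ}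
  {b : Vec m → Vec d → Vec d} {σ : Vec m → Vec d → Matrix (Fin d) (Fin d) ℝ}
  {η : Vec m → Vec d → Vec n → Vec d} {γ : Vec d → Vec n → ℝ}
  {f : Vec m → ℝ → Vec d → ℝ → Vec d → ℝ → ℝ}
  {ζ : ℝ → Vec d → ℝ} {g : Vec d → ℝ} {C : ℝ} {ε : ℝ}

namespace AssumptionA

lemma norm_eta_le (hA : AssumptionA ν A T b σ η γ f ζ g C) {α : Vec m} (hα : α ∈ A) (x : Vec d)
    (e : Vec n) : ‖η α x e‖ ≤ C :=
  (hA.hη_bdd α hα x e).trans (mul_le_of_le_one_right hA.hC.le (min_le_left _ _))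

lemma abs_gamma_le (hA : AssumptionA ν A T b σ η γ f ζ g C) (x : Vec d) (e : Vec n) :
    |γ x e| ≤ C := by
  rw [abs_of_nonneg (hA.hγ_nonneg x e)]
  exact (hA.hγ_bdd x e).trans (mul_le_of_le_one_right hA.hC.le (min_le_left _ _))

lemma integrable_jumpK (hA : AssumptionA ν A T b σ η γ f ζ g C) (hε : 0 < ε) {α : Vec m}
    (hα : α ∈ A) {w : Vec d → ℝ} (hw : Continuous w) {M : ℝ} (hM : ∀ x, |w x| ≤ M)
    (p x : Vec d) : Integrable (fun e => w (x + η α x e) - w x - ⟪η α x e, p⟫)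
      (ν.restrict {e : Vec n | ε < ‖e‖}) := by
  have _ := hA.isFiniteMeasure hε
  refine Integrable.of_bound (C := 2 * M + C * ‖p‖) ?_ (Eventually.of_forall fun e => ?_)
  · have h1 : Measurable fun e => w (x + η α x e) :=
      hw.measurable.comp ((hA.hη_meas α x).const_add x)
    exact ((h1.sub_const _).sub ((hA.hη_meas α x).inner_const)).aestronglyMeasurable
  · have h1 : |⟪η α x e, p⟫| ≤ C * ‖p‖ := (abs_real_inner_le_norm _ _).trans
      (mul_le_mul_of_nonneg_right (hA.norm_eta_le hα x e) (norm_nonneg _))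
    have h2 := hM (x + η α x e)
    have h3 := hM x
    rw [Real.norm_eq_abs]
    rw [abs_le] at *
    constructor <;> linarith [h1.1, h1.2, h2.1, h2.2, h3.1, h3.2]

lemma integrable_jumpB (hA : AssumptionA ν A T b σ η γ f ζ g C) (hε : 0 < ε) (α : Vec m)
    {w : Vec d → ℝ} (hw : Continuous w) {M : ℝ} (hM : ∀ x, |w x| ≤ M)
    (x : Vec d) : Integrable (fun e => (w (x + η α x e) - w x) * γ x e)
      (ν.restrict {e : Vec n | ε < ‖e‖}) := by
  have _ := hA.isFiniteMeasure hε
  refine Integrable.of_bound (C := 2 * M * C) ?_ (Eventually.of_forall fun e => ?_)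
  · have h1 : Measurable fun e => w (x + η α x e) :=
      hw.measurable.comp ((hA.hη_meas α x).const_add x)
    exact ((h1.sub_const _).mul (hA.hγ_meas x)).aestronglyMeasurable
  · rw [norm_mul]
    have h2 := hM (x + η α x e)
    have h3 := hM x
    have h0 : 0 ≤ M := (abs_nonneg _).trans h3
    refine mul_le_mul ?_ (hA.abs_gamma_le x e) (norm_nonneg _) (by positivity)
    rw [Real.norm_eq_abs]
    rw [abs_le] at *
    constructor <;> linarith [h2.1, h2.2, h3.1, h3.2]

lemma abs_integral_sub_le {μ : Measure (Vec n)} [IsFiniteMeasure μ] {F G : Vec n → ℝ}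
    (hF : Integrable F μ) (hG : Integrable G μ) {k : ℝ} (h : ∀ e, |F e - G e| ≤ k) :
    |∫ e, F e ∂μ - ∫ e, G e ∂μ| ≤ k * μ.real univ := by
  rw [← integral_sub hF hG, ← Real.norm_eq_abs]
  exact norm_integral_le_of_norm_le_const (Eventually.of_forall h)

/-- Replacing a function by a nearby test function with the same local behaviour changes the
Hamiltonian by a comparable amount, uniformly in the control. -/
lemma exists_abs_sub_jetHam_le (hA : AssumptionA ν A T b σ η γ f ζ g C) (hε : 0 < ε)
    {w : ℝ → Vec d → ℝ} (hw : Continuous fun z : ℝ × Vec d => w z.1 z.2) {M : ℝ}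
    (hM : ∀ t x, |w t x| ≤ M) {t₀ : ℝ} (ht₀ : t₀ ∈ Icc 0 T) (x₀ : Vec d)
    (X : Vec d →L[ℝ] Vec d) :
    ∃ Q ≥ 0, ∀ κ ≥ 0, ∀ φ : C12 d, (∀ x, |φ.toFun t₀ x - w t₀ x| ≤ κ) →
      φ.toFun t₀ x₀ = w t₀ x₀ →
      (∀ v, |⟪Matrix.toEuclideanLin (φ.hess t₀ x₀) v, v⟫ - ⟪X v, v⟫| ≤ κ * ‖v‖ ^ 2) →
      ∀ α ∈ A, |φ.dt t₀ x₀ + (-(Ltr ν b σ η ε φ α t₀ x₀)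
        - f α t₀ x₀ (w t₀ x₀) (mvE ((sigmaTilde ν σ η ε α x₀)ᵀ) (φ.grad t₀ x₀))
            (Btr ν η γ ε φ α t₀ x₀))
        - jetHam ν b σ η γ f ε w t₀ x₀ (φ.dt t₀ x₀) (φ.grad t₀ x₀) X α| ≤ Q * κ := by
  have _ := hA.isFiniteMeasure hε
  have hC := hA.hC
  obtain ⟨L, hL, -, hcol, -⟩ := hA.exists_lipschitz ε
  set N := (ν.restrict {e : Vec n | ε < ‖e‖}).real univ with hN
  refine ⟨1 / 2 * (d * (L * (1 + ‖x₀‖)) ^ 2) + N + C * (C * N), by positivity,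
    fun κ hκ φ hφ h0 hH α hα => ?_⟩
  have hwt : Continuous (w t₀) := hw.comp (Continuous.prodMk_right t₀)
  have hφt : Continuous (φ.toFun t₀) := φ.cont.comp (Continuous.prodMk_right t₀)
  have hφM : ∀ x, |φ.toFun t₀ x| ≤ M + κ := fun x => by
    have h1 := hφ x
    have h2 := hM t₀ x
    rw [abs_le] at *
    constructor <;> linarith [h1.1, h1.2, h2.1, h2.2]
  have hK : |Ktr ν η ε φ α t₀ x₀ - jumpK ν η ε (w t₀) (φ.grad t₀ x₀) α x₀| ≤ κ * N := by
    refine abs_integral_sub_le (hA.integrable_jumpK hε hα hφt hφM (φ.grad t₀ x₀) x₀)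
      (hA.integrable_jumpK hε hα hwt (hM t₀) (φ.grad t₀ x₀) x₀) fun e => ?_
    rw [h0]
    convert hφ (x₀ + η α x₀ e) using 2
    ring
  have hB : |Btr ν η γ ε φ α t₀ x₀ - jumpB ν η γ ε (w t₀) α x₀| ≤ κ * C * N := by
    refine abs_integral_sub_le (hA.integrable_jumpB hε α hφt hφM x₀)
      (hA.integrable_jumpB hε α hwt (hM t₀) x₀) fun e => ?_
    rw [h0, ← sub_mul, abs_mul, sub_sub_sub_cancel_right]
    exact mul_le_mul (hφ _) (hA.abs_gamma_le x₀ e) (abs_nonneg _) hκ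
  have htr : |Matrix.trace (sigmaTilde ν σ η ε α x₀ * (sigmaTilde ν σ η ε α x₀)ᵀ * φ.hess t₀ x₀)
      - ∑ j, ⟪X (colE (sigmaTilde ν σ η ε α x₀) j), colE (sigmaTilde ν σ η ε α x₀) j⟫| ≤
      κ * (d * (L * (1 + ‖x₀‖)) ^ 2) := by
    rw [trace_mul_transpose_mul, ← Finset.sum_sub_distrib]
    refine (Finset.abs_sum_le_sum_abs _ _).trans ((Finset.sum_le_sum
      (g := fun _ => κ * (L * (1 + ‖x₀‖)) ^ 2) fun j _ => (hH _).trans ?_).trans (le_of_eq ?_))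
    · gcongr
      exact hcol α hα x₀ j
    · simp
      ring
  have hf := hA.hf_lip α hα α hα t₀ ht₀ x₀ (w t₀ x₀) (w t₀ x₀)
    (mvE ((sigmaTilde ν σ η ε α x₀)ᵀ) (φ.grad t₀ x₀))
    (mvE ((sigmaTilde ν σ η ε α x₀)ᵀ) (φ.grad t₀ x₀)) (Btr ν η γ ε φ α t₀ x₀)
    (jumpB ν η γ ε (w t₀) α x₀)
  simp only [sub_self, norm_zero, abs_zero, zero_add] at hf
  have hf' := hf.trans (mul_le_mul_of_nonneg_left hB hC.le)
  simp only [Ltr, jetHam]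
  rw [abs_le] at *
  constructor <;> nlinarith [htr.1, htr.2, hK.1, hK.2, hf'.1, hf'.2]

/-- The Hamiltonian on a fixed jet is bounded uniformly in the control. -/
lemma exists_abs_jetHam_le (hA : AssumptionA ν A T b σ η γ f ζ g C) (hε : 0 < ε)
    {w : ℝ → Vec d → ℝ} {M : ℝ}
    (hM : ∀ t x, |w t x| ≤ M) {t₀ : ℝ} (ht₀ : t₀ ∈ Icc 0 T) (x₀ : Vec d) (a : ℝ) (p : Vec d)
    (X : Vec d →L[ℝ] Vec d) :
    ∃ Q, ∀ α ∈ A, |jetHam ν b σ η γ f ε w t₀ x₀ a p X α| ≤ Q := by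
  have _ := hA.isFiniteMeasure hε
  have hC := hA.hC
  obtain ⟨L, hL, -, hcol, hb⟩ := hA.exists_lipschitz ε
  set N := (ν.restrict {e : Vec n | ε < ‖e‖}).real univ with hN
  have hM0 : 0 ≤ M := (abs_nonneg _).trans (hM 0 0)
  set R := L * (1 + ‖x₀‖) with hR
  have hR0 : 0 ≤ R := by positivity
  refine ⟨|a| + 1 / 2 * (d * (‖X‖ * R ^ 2)) + R * ‖p‖ + (2 * M + C * ‖p‖) * N
    + (C + C * (M + d * (R * ‖p‖) + 2 * M * C * N)), fun α hα => ?_⟩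
  have h1 : |∑ j, ⟪X (colE (sigmaTilde ν σ η ε α x₀) j), colE (sigmaTilde ν σ η ε α x₀) j⟫| ≤
      d * (‖X‖ * R ^ 2) := by
    refine (Finset.abs_sum_le_sum_abs _ _).trans ((Finset.sum_le_sum
      (g := fun _ => ‖X‖ * R ^ 2) fun j _ => (abs_real_inner_le_norm _ _).trans ?_).trans
        (le_of_eq ?_))
    · have h2 := hcol α hα x₀ j
      calc _ ≤ ‖X‖ * ‖colE (sigmaTilde ν σ η ε α x₀) j‖ * ‖colE (sigmaTilde ν σ η ε α x₀) j‖ := by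
            gcongr
            exact X.le_opNorm _
        _ ≤ ‖X‖ * R * R := by gcongr
        _ = ‖X‖ * R ^ 2 := by ring
    · simp
  have h2 : |⟪b α x₀, p⟫| ≤ R * ‖p‖ := (abs_real_inner_le_norm _ _).trans
    (mul_le_mul_of_nonneg_right (hb α hα x₀) (norm_nonneg _))
  have h3 : |jumpK ν η ε (w t₀) p α x₀| ≤ (2 * M + C * ‖p‖) * N := by
    rw [jumpK, ← Real.norm_eq_abs]
    refine norm_integral_le_of_norm_le_const (Eventually.of_forall fun e => ?_)
    have h1 : |⟪η α x₀ e, p⟫| ≤ C * ‖p‖ := (abs_real_inner_le_norm _ _).trans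
      (mul_le_mul_of_nonneg_right (hA.norm_eta_le hα x₀ e) (norm_nonneg _))
    have h2 := hM t₀ (x₀ + η α x₀ e)
    have h3 := hM t₀ x₀
    rw [Real.norm_eq_abs]
    rw [abs_le] at *
    constructor <;> linarith [h1.1, h1.2, h2.1, h2.2, h3.1, h3.2]
  have h4 : |jumpB ν η γ ε (w t₀) α x₀| ≤ 2 * M * C * N := by
    rw [jumpB, ← Real.norm_eq_abs]
    refine norm_integral_le_of_norm_le_const (Eventually.of_forall fun e => ?_)
    rw [norm_mul]
    refine mul_le_mul ?_ (hA.abs_gamma_le x₀ e) (norm_nonneg _) (by positivity)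
    have h2 := hM t₀ (x₀ + η α x₀ e)
    have h3 := hM t₀ x₀
    rw [Real.norm_eq_abs]
    rw [abs_le] at *
    constructor <;> linarith [h2.1, h2.2, h3.1, h3.2]
  have h5 : ‖mvE (sigmaTilde ν σ η ε α x₀)ᵀ p‖ ≤ d * (R * ‖p‖) := by
    refine (norm_le_sum_abs _).trans ((Finset.sum_le_sum (g := fun _ => R * ‖p‖) fun j _ =>
      ?_).trans (le_of_eq (by simp)))
    rw [mvE_transpose_apply]
    exact (abs_real_inner_le_norm _ _).trans
      (mul_le_mul_of_nonneg_right (hcol α hα x₀ j) (norm_nonneg _))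
  have h6 := hA.hf_lip α hα α hα t₀ ht₀ x₀ (w t₀ x₀) 0
    (mvE ((sigmaTilde ν σ η ε α x₀)ᵀ) p) 0 (jumpB ν η γ ε (w t₀) α x₀) 0
  simp only [sub_self, norm_zero, zero_add, sub_zero] at h6
  have h7 := hA.hf_bdd α hα t₀ ht₀ x₀
  have h8 : C * (|w t₀ x₀| + ‖mvE (sigmaTilde ν σ η ε α x₀)ᵀ p‖ + |jumpB ν η γ ε (w t₀) α x₀|) ≤
      C * (M + d * (R * ‖p‖) + 2 * M * C * N) := by
    gcongr
    exact hM _ _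
  have h9 := h6.trans h8
  simp only [jetHam]
  have ha := le_abs_self a
  have ha' := neg_abs_le a
  rw [abs_le] at h1 h2 h3 h7 h9 ⊢
  constructor <;> linarith [h1.1, h1.2, h2.1, h2.2, h3.1, h3.2, h7.1, h7.2, h9.1, h9.2]

lemma subsolnJets (hA : AssumptionA ν A T b σ η γ f ζ g C) (hε : 0 < ε) {S : Set (Vec m)}
    (hS : S ⊆ A) (hSne : S.Nonempty) {u : ℝ → Vec d → ℝ}
    (hu : Continuous fun z : ℝ × Vec d => u z.1 z.2) {M : ℝ} (hM : ∀ t x, |u t x| ≤ M)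
    (hsub : SubsolnHJBVIe ν S T b σ η γ f ζ ε u) : SubsolnJets ν S T b σ η γ f ζ ε u := by
  intro t₀ ht₀ x₀ a p X hjet
  by_cases hob : u t₀ x₀ ≤ ζ t₀ x₀
  · exact Or.inl hob
  refine Or.inr fun κ hκ => ?_
  obtain ⟨Q, hQ, hQle⟩ := hA.exists_abs_sub_jetHam_le hε hu hM ⟨ht₀.1.le, ht₀.2⟩ x₀ X
  set k := κ / (Q + 1) with hk
  have hk0 : 0 < k := by positivity
  have hkQ : k * (Q + 1) = κ := by rw [hk]; field_simp
  obtain ⟨φ, hφ, h0, hdt, hgrad, hhess⟩ := hjet.exists_testFunction hu hk0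
  have h1 := hsub φ t₀ x₀ ht₀ fun t _ x => by linarith [(hφ t x).1]
  have h2 := (min_le_iff.1 h1).resolve_left (by linarith)
  have _ : Nonempty S := hSne.to_subtype
  have h3 := exists_lt_of_ciInf_lt (show (⨅ α : S, (-(Ltr ν b σ η ε φ (↑α) t₀ x₀)
        - f (↑α) t₀ x₀ (u t₀ x₀) (mvE ((sigmaTilde ν σ η ε (↑α) x₀)ᵀ) (φ.grad t₀ x₀))
            (Btr ν η γ ε φ (↑α) t₀ x₀))) < -φ.dt t₀ x₀ + k by linarith)
  obtain ⟨⟨α, hα⟩, h4⟩ := h3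
  have h5 := hQle k hk0.le φ (fun x => abs_le.2 ⟨by linarith [(hφ t₀ x).1], by
    linarith [(hφ t₀ x).2]⟩) h0 (fun v => by
      rw [hhess, add_sub_cancel_left, abs_of_nonneg (by positivity)]) α (hS hα)
  refine ⟨α, hα, ?_⟩
  rw [hdt, hgrad] at *
  rw [abs_le] at h5
  nlinarith [h5.1]

lemma supersolnJets (hA : AssumptionA ν A T b σ η γ f ζ g C) (hε : 0 < ε) {S : Set (Vec m)}
    (hS : S ⊆ A) {v : ℝ → Vec d → ℝ}
    (hv : Continuous fun z : ℝ × Vec d => v z.1 z.2) {M : ℝ} (hM : ∀ t x, |v t x| ≤ M)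
    (hsuper : SupersolnHJBVIe ν S T b σ η γ f ζ ε v) : SupersolnJets ν S T b σ η γ f ζ ε v := by
  intro t₀ ht₀ x₀ a p X hjet
  have ht₀' : t₀ ∈ Icc 0 T := ⟨ht₀.1.le, ht₀.2⟩
  obtain ⟨Q, hQ, hQle⟩ := hA.exists_abs_sub_jetHam_le hε hv hM ht₀' x₀ (-X)
  have key : ∀ k > 0, ζ t₀ x₀ ≤ v t₀ x₀ ∧
      ∀ α ∈ S, 0 ≤ jetHam ν b σ η γ f ε v t₀ x₀ (-a) (-p) (-X) α + Q * k := by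
    intro k hk0
    obtain ⟨φ, hφ, h0, hdt, hgrad, hhess⟩ := hjet.exists_testFunction hv.neg hk0
    have h1 := hsuper φ.neg t₀ x₀ ht₀ fun t _ x => by
      simp only [C12.neg]
      linarith [(hφ t x).1]
    obtain ⟨h2, h3⟩ := le_min_iff.1 h1
    refine ⟨by linarith, fun α hα => ?_⟩
    have hQ2 := fun α (hα : α ∈ S) => hQle k hk0.le φ.neg (fun x => by
      simp only [C12.neg]
      exact abs_le.2 ⟨by linarith [(hφ t₀ x).2], by linarith [(hφ t₀ x).1]⟩)
      (by simp only [C12.neg]; linarith) (fun w => by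
        have := hhess w
        have e1 : ⟪Matrix.toEuclideanLin (φ.neg.hess t₀ x₀) w, w⟫ =
          -⟪Matrix.toEuclideanLin (φ.hess t₀ x₀) w, w⟫ := by
            simp only [C12.neg, map_neg, LinearMap.neg_apply, inner_neg_left]
        rw [e1, this, _root_.neg_apply, inner_neg_left, abs_le]
        constructor <;> nlinarith [sq_nonneg ‖w‖]) α (hS hα)
    have e2 : φ.neg.dt t₀ x₀ = -a := by simp only [C12.neg, hdt]
    have e3 : φ.neg.grad t₀ x₀ = -p := by simp only [C12.neg, hgrad]
    obtain ⟨B, hB⟩ := hA.exists_abs_jetHam_le hε hM ht₀' x₀ (-a) (-p) (-X)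
    rw [e2, e3] at hQ2 h3
    have hbdd : BddBelow (range fun α : S => (-(Ltr ν b σ η ε φ.neg (↑α) t₀ x₀)
        - f (↑α) t₀ x₀ (v t₀ x₀) (mvE ((sigmaTilde ν σ η ε (↑α) x₀)ᵀ) (-p))
            (Btr ν η γ ε φ.neg (↑α) t₀ x₀))) := by
      refine ⟨a - B - Q * k, ?_⟩
      rintro _ ⟨⟨α, hα⟩, rfl⟩
      have h4 := (abs_le.1 (hQ2 α hα)).1
      have h5 := (abs_le.1 (hB α (hS hα))).1
      simp only
      linarith
    have h6 := ciInf_le hbdd ⟨α, hα⟩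
    have h7 := (abs_le.1 (hQ2 α hα)).2
    simp only at h6
    linarith
  refine ⟨(key 1 one_pos).1, fun α hα => ?_⟩
  refine le_of_forall_pos_le_add fun e he => ?_
  have h1 := (key (e / (Q + 1)) (by positivity)).2 α hα
  have h2 : Q * (e / (Q + 1)) ≤ e := by
    rw [mul_div_assoc', div_le_iff₀ (by positivity)]
    nlinarith
  linarith

end AssumptionA

end JetConditions

section Limits

variable {ν : Measure (Vec n)} {A : Set (Vec m)} {T : ℝ}
  {b : Vec m → Vec d → Vec d} {σ : Vec m → Vec d → Matrix (Fin d) (Fin d) ℝ}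
  {η : Vec m → Vec d → Vec n → Vec d} {γ : Vec d → Vec n → ℝ}
  {f : Vec m → ℝ → Vec d → ℝ → Vec d → ℝ → ℝ}
  {ζ : ℝ → Vec d → ℝ} {g : Vec d → ℝ} {C : ℝ} {ε : ℝ}

/-- The part of the Hamiltonian which does not involve second derivatives. -/
def lowHam (ν : Measure (Vec n)) (b : Vec m → Vec d → Vec d)
    (σ : Vec m → Vec d → Matrix (Fin d) (Fin d) ℝ) (η : Vec m → Vec d → Vec n → Vec d)
    (γ : Vec d → Vec n → ℝ) (f : Vec m → ℝ → Vec d → ℝ → Vec d → ℝ → ℝ) (ε : ℝ)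
    (u : ℝ → Vec d → ℝ) (t : ℝ) (x : Vec d) (p : Vec d) (α : Vec m) : ℝ :=
  ⟪b α x, p⟫ + jumpK ν η ε (u t) p α x
    + f α t x (u t x) (mvE (sigmaTilde ν σ η ε α x)ᵀ p) (jumpB ν η γ ε (u t) α x)

namespace AssumptionA

lemma continuous_zeta (hA : AssumptionA ν A T b σ η γ f ζ g C) :
    Continuous fun z : ℝ × Vec d => ζ z.1 z.2 := by
  refine continuous_prod_of_continuous_lipschitzWith' _ (Real.toNNReal C) (fun t => ?_)
    hA.hζ_t_cont
  refine LipschitzWith.of_dist_le_mul fun x y => ?_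
  rw [Real.coe_toNNReal _ hA.hC.le, Real.dist_eq, dist_eq_norm]
  linarith [hA.hζg_lip t x y, abs_nonneg (g x - g y)]

variable {tk : ℕ → ℝ} {xk pk : ℕ → Vec d} {αk : ℕ → Vec m} {t : ℝ} {x p : Vec d} {α : Vec m}

lemma tendsto_of_norm_sub_le {E F : Type*} [SeminormedAddCommGroup E] [SeminormedAddCommGroup F]
    (L : ℝ) {G : ℕ → F} {G₀ : F} {yk : ℕ → E} {y : E}
    (hx : Tendsto xk atTop (𝓝 x)) (hy : Tendsto yk atTop (𝓝 y))
    (h : ∀ k, ‖G k - G₀‖ ≤ L * (‖xk k - x‖ + ‖yk k - y‖)) : Tendsto G atTop (𝓝 G₀) := by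
  rw [tendsto_iff_norm_sub_tendsto_zero]
  have h1 := ((tendsto_iff_norm_sub_tendsto_zero.1 hx).add
    (tendsto_iff_norm_sub_tendsto_zero.1 hy)).const_mul L
  rw [add_zero, mul_zero] at h1
  exact squeeze_zero (fun k => norm_nonneg _) h h1

lemma tendsto_eta (hA : AssumptionA ν A T b σ η γ f ζ g C) (hαk : ∀ k, αk k ∈ A) (hα : α ∈ A)
    (hx : Tendsto xk atTop (𝓝 x)) (hαt : Tendsto αk atTop (𝓝 α)) (e : Vec n) :
    Tendsto (fun k => η (αk k) (xk k) e) atTop (𝓝 (η α x e)) :=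
  tendsto_of_norm_sub_le C hx hαt fun k => (hA.hη_lip _ (hαk k) _ hα _ _ e).trans
    (mul_le_of_le_one_right (by have := hA.hC; positivity) (min_le_left _ _))

lemma tendsto_jumpK (hA : AssumptionA ν A T b σ η γ f ζ g C) (hε : 0 < ε)
    {w : ℝ → Vec d → ℝ} (hw : Continuous fun z : ℝ × Vec d => w z.1 z.2) {M : ℝ}
    (hM : ∀ t x, |w t x| ≤ M) (hαk : ∀ k, αk k ∈ A) (hα : α ∈ A)
    (ht : Tendsto tk atTop (𝓝 t)) (hx : Tendsto xk atTop (𝓝 x)) (hp : Tendsto pk atTop (𝓝 p))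
    (hαt : Tendsto αk atTop (𝓝 α)) :
    Tendsto (fun k => jumpK ν η ε (w (tk k)) (pk k) (αk k) (xk k)) atTop
      (𝓝 (jumpK ν η ε (w t) p α x)) := by
  have _ := hA.isFiniteMeasure hε
  obtain ⟨P, hP⟩ := hp.norm.bddAbove_range
  have hP' : ∀ k, ‖pk k‖ ≤ P := fun k => hP ⟨k, rfl⟩
  have hwt : ∀ s, Continuous (w s) := fun s => hw.comp (Continuous.prodMk_right s)
  have hC := hA.hC
  refine tendsto_integral_of_dominated_convergence (fun _ => 2 * M + C * P)
    (fun k => (hA.integrable_jumpK hε (hαk k) (hwt _) (hM _) _ _).aestronglyMeasurable)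
    (integrable_const _) (fun k => Eventually.of_forall fun e => ?_)
    (Eventually.of_forall fun e => ?_)
  · have h1 : |⟪η (αk k) (xk k) e, pk k⟫| ≤ C * P := (abs_real_inner_le_norm _ _).trans
      (mul_le_mul (hA.norm_eta_le (hαk k) _ e) (hP' k) (norm_nonneg _) hC.le)
    have h2 := hM (tk k) (xk k + η (αk k) (xk k) e)
    have h3 := hM (tk k) (xk k)
    rw [Real.norm_eq_abs]
    rw [abs_le] at *
    constructor <;> linarith [h1.1, h1.2, h2.1, h2.2, h3.1, h3.2]
  · have h1 := hA.tendsto_eta hαk hα hx hαt e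
    exact (((hw.tendsto (t, x + η α x e)).comp (ht.prodMk_nhds (hx.add h1))).sub
      ((hw.tendsto (t, x)).comp (ht.prodMk_nhds hx))).sub (h1.inner hp)

lemma tendsto_jumpB (hA : AssumptionA ν A T b σ η γ f ζ g C) (hε : 0 < ε)
    {w : ℝ → Vec d → ℝ} (hw : Continuous fun z : ℝ × Vec d => w z.1 z.2) {M : ℝ}
    (hM : ∀ t x, |w t x| ≤ M) (hαk : ∀ k, αk k ∈ A) (hα : α ∈ A)
    (ht : Tendsto tk atTop (𝓝 t)) (hx : Tendsto xk atTop (𝓝 x))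
    (hαt : Tendsto αk atTop (𝓝 α)) :
    Tendsto (fun k => jumpB ν η γ ε (w (tk k)) (αk k) (xk k)) atTop
      (𝓝 (jumpB ν η γ ε (w t) α x)) := by
  have _ := hA.isFiniteMeasure hε
  have hwt : ∀ s, Continuous (w s) := fun s => hw.comp (Continuous.prodMk_right s)
  have hC := hA.hC
  have hM0 : 0 ≤ M := (abs_nonneg _).trans (hM 0 0)
  refine tendsto_integral_of_dominated_convergence (fun _ => 2 * M * C)
    (fun k => (hA.integrable_jumpB hε _ (hwt _) (hM _) _).aestronglyMeasurable)
    (integrable_const _) (fun k => Eventually.of_forall fun e => ?_)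
    (Eventually.of_forall fun e => ?_)
  · rw [norm_mul]
    refine mul_le_mul ?_ (hA.abs_gamma_le (xk k) e) (norm_nonneg _) (by positivity)
    have h2 := hM (tk k) (xk k + η (αk k) (xk k) e)
    have h3 := hM (tk k) (xk k)
    rw [Real.norm_eq_abs]
    rw [abs_le] at *
    constructor <;> linarith [h2.1, h2.2, h3.1, h3.2]
  · have h1 := hA.tendsto_eta hαk hα hx hαt e
    have h2 : Tendsto (fun k => γ (xk k) e) atTop (𝓝 (γ x e)) := by
      refine tendsto_of_norm_sub_le C hx hαt fun k => (hA.hγ_lip _ _ e).trans ?_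
      refine (mul_le_of_le_one_right (by positivity) (min_le_left _ _)).trans ?_
      have := norm_nonneg (αk k - α)
      gcongr
      linarith
    exact (((hw.tendsto (t, x + η α x e)).comp (ht.prodMk_nhds (hx.add h1))).sub
      ((hw.tendsto (t, x)).comp (ht.prodMk_nhds hx))).mul h2

lemma tendsto_colE (hA : AssumptionA ν A T b σ η γ f ζ g C) (hαk : ∀ k, αk k ∈ A) (hα : α ∈ A)
    (hx : Tendsto xk atTop (𝓝 x)) (hαt : Tendsto αk atTop (𝓝 α)) (j : Fin d) :
    Tendsto (fun k => colE (sigmaTilde ν σ η ε (αk k) (xk k)) j) atTop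
      (𝓝 (colE (sigmaTilde ν σ η ε α x) j)) := by
  obtain ⟨L, -, h, -⟩ := hA.exists_lipschitz ε
  exact tendsto_of_norm_sub_le L hx hαt fun k => h _ (hαk k) _ hα _ _ j

lemma tendsto_f (hA : AssumptionA ν A T b σ η γ f ζ g C) (hαk : ∀ k, αk k ∈ A) (hα : α ∈ A)
    (htk : ∀ k, tk k ∈ Icc 0 T) {uk kk : ℕ → ℝ} {u k₀ : ℝ}
    (ht : Tendsto tk atTop (𝓝 t)) (hx : Tendsto xk atTop (𝓝 x)) (hp : Tendsto pk atTop (𝓝 p))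
    (hαt : Tendsto αk atTop (𝓝 α)) (hu : Tendsto uk atTop (𝓝 u)) (hk : Tendsto kk atTop (𝓝 k₀)) :
    Tendsto (fun k => f (αk k) (tk k) (xk k) (uk k) (pk k) (kk k)) atTop
      (𝓝 (f α t x u p k₀)) := by
  have hC := hA.hC
  obtain ⟨P, hP⟩ := hx.norm.bddAbove_range
  have hP' : ∀ k, ‖xk k‖ ≤ P := fun k => hP ⟨k, rfl⟩
  have hPx : ‖x‖ ≤ P := le_of_tendsto' hx.norm hP'
  have hP0 : 0 ≤ P := (norm_nonneg _).trans hPx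
  obtain ⟨mR, hmc, hm0, -, hmR⟩ := hA.hf_x (P + |u| + 1) (by positivity)
  have h1 : Tendsto (fun k => C * (‖αk k - α‖ + |uk k - u| + ‖pk k - p‖ + |kk k - k₀|)) atTop
      (𝓝 0) := by
    have := ((((tendsto_iff_norm_sub_tendsto_zero.1 hαt).add
      (tendsto_iff_norm_sub_tendsto_zero.1 hu)).add
      (tendsto_iff_norm_sub_tendsto_zero.1 hp)).add
      (tendsto_iff_norm_sub_tendsto_zero.1 hk)).const_mul C
    simpa using this
  have h2 : Tendsto (fun k => mR (‖xk k - x‖ * (1 + ‖p‖))) atTop (𝓝 0) := by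
    have h3 := (tendsto_iff_norm_sub_tendsto_zero.1 hx).mul_const (1 + ‖p‖)
    rw [zero_mul] at h3
    have := (hmc.tendsto 0).comp h3
    rwa [hm0] at this
  have h3 : Tendsto (fun k => |f α (tk k) x u p k₀ - f α t x u p k₀|) atTop (𝓝 0) :=
    tendsto_iff_norm_sub_tendsto_zero.1 (((hA.hf_t_cont α x u p k₀).tendsto t).comp ht)
  rw [tendsto_iff_norm_sub_tendsto_zero]
  have h4 := (h1.add h2).add h3
  rw [add_zero, add_zero] at h4
  refine squeeze_zero (fun k => norm_nonneg _) (fun k => ?_) h4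
  have e1 := hA.hf_lip _ (hαk k) _ hα (tk k) (htk k) (xk k) (uk k) u (pk k) p (kk k) k₀
  have e2 := hmR α hα (tk k) (htk k) (xk k) x u p k₀ (by linarith [hP' k, abs_nonneg u])
    (by linarith [abs_nonneg u]) (by linarith)
  have e3 := abs_sub_le (f (αk k) (tk k) (xk k) (uk k) (pk k) (kk k))
    (f α (tk k) (xk k) u p k₀) (f α t x u p k₀)
  have e4 := abs_sub_le (f α (tk k) (xk k) u p k₀) (f α (tk k) x u p k₀) (f α t x u p k₀)
  rw [Real.norm_eq_abs]
  linarith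

lemma tendsto_lowHam (hA : AssumptionA ν A T b σ η γ f ζ g C) (hε : 0 < ε)
    {w : ℝ → Vec d → ℝ} (hw : Continuous fun z : ℝ × Vec d => w z.1 z.2) {M : ℝ}
    (hM : ∀ t x, |w t x| ≤ M) (hαk : ∀ k, αk k ∈ A) (hα : α ∈ A) (htk : ∀ k, tk k ∈ Icc 0 T)
    (ht : Tendsto tk atTop (𝓝 t)) (hx : Tendsto xk atTop (𝓝 x)) (hp : Tendsto pk atTop (𝓝 p))
    (hαt : Tendsto αk atTop (𝓝 α)) :
    Tendsto (fun k => lowHam ν b σ η γ f ε w (tk k) (xk k) (pk k) (αk k)) atTop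
      (𝓝 (lowHam ν b σ η γ f ε w t x p α)) := by
  have hb : Tendsto (fun k => b (αk k) (xk k)) atTop (𝓝 (b α x)) :=
    tendsto_of_norm_sub_le C hx hαt fun k => by
      linarith [hA.hb _ (hαk k) _ hα (xk k) x, norm_nonneg (σ (αk k) (xk k) - σ α x)]
  have hP : Tendsto (fun k => mvE (sigmaTilde ν σ η ε (αk k) (xk k))ᵀ (pk k)) atTop
      (𝓝 (mvE (sigmaTilde ν σ η ε α x)ᵀ p)) := by
    have h1 : ∀ (S : Matrix (Fin d) (Fin d) ℝ) (q : Vec d),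
        mvE Sᵀ q = WithLp.toLp 2 fun j => ⟪colE S j, q⟫ := fun S q => by
      ext j
      exact mvE_transpose_apply S q j
    simp only [h1]
    exact ((PiLp.continuous_toLp 2 _).tendsto _).comp
      (tendsto_pi_nhds.2 fun j => (hA.tendsto_colE hαk hα hx hαt j).inner hp)
  exact ((hb.inner hp).add (hA.tendsto_jumpK hε hw hM hαk hα ht hx hp hαt)).add
    (hA.tendsto_f hαk hα htk ht hx hP hαt ((hw.tendsto (t, x)).comp (ht.prodMk_nhds hx))
      (hA.tendsto_jumpB hε hw hM hαk hα ht hx hαt))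

end AssumptionA

end Limits

section Penalization

/-- A penalization at infinity with slow growth. -/
def logPen (x : Vec d) : ℝ := Real.log (1 + ‖x‖ ^ 2)

/-- The gradient of `logPen`. -/
def logGrad (x : Vec d) : Vec d := (2 / (1 + ‖x‖ ^ 2)) • x

/-- A penalization of the times after `s`. -/
def rampSq (K s t : ℝ) : ℝ := K * (max (t - s) 0) ^ 2

lemma logPen_nonneg (x : Vec d) : 0 ≤ logPen x :=
  Real.log_nonneg (by linarith [sq_nonneg ‖x‖])

lemma continuous_logPen : Continuous (logPen : Vec d → ℝ) :=
  (by fun_prop : Continuous fun x : Vec d => 1 + ‖x‖ ^ 2).log fun x => by positivity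

lemma continuous_logGrad : Continuous (logGrad : Vec d → Vec d) := by
  have h : Continuous fun x : Vec d => 2 / (1 + ‖x‖ ^ 2) :=
    continuous_const.div (by fun_prop) fun x => by positivity
  exact h.smul continuous_id

lemma logPen_le (x₀ x : Vec d) :
    logPen x ≤ logPen x₀ + ⟪logGrad x₀, x - x₀⟫ + 1 / (1 + ‖x₀‖ ^ 2) * ‖x - x₀‖ ^ 2 := by
  have h0 : 0 < 1 + ‖x₀‖ ^ 2 := by positivity
  have h1 : 0 < 1 + ‖x‖ ^ 2 := by positivity
  have h2 := Real.log_le_sub_one_of_pos (div_pos h1 h0)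
  rw [Real.log_div h1.ne' h0.ne'] at h2
  have h3 : ‖x‖ ^ 2 = ‖x₀‖ ^ 2 + 2 * ⟪x₀, x - x₀⟫ + ‖x - x₀‖ ^ 2 := by
    rw [← norm_add_sq_real, add_sub_cancel]
  have h4 : (1 + ‖x‖ ^ 2) / (1 + ‖x₀‖ ^ 2) - 1 =
      ⟪logGrad x₀, x - x₀⟫ + 1 / (1 + ‖x₀‖ ^ 2) * ‖x - x₀‖ ^ 2 := by
    rw [logGrad, real_inner_smul_left, h3]
    field_simp
    ring
  rw [h4] at h2
  simp only [logPen]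
  linarith

lemma norm_logGrad_mul_le (x : Vec d) : ‖logGrad x‖ * (1 + ‖x‖) ≤ 3 := by
  have h0 : 0 < 1 + ‖x‖ ^ 2 := by positivity
  rw [logGrad, norm_smul, Real.norm_of_nonneg (by positivity), div_mul_eq_mul_div,
    div_mul_eq_mul_div, div_le_iff₀ h0]
  nlinarith [sq_nonneg (‖x‖ - 1)]

lemma norm_logGrad_le (x : Vec d) : ‖logGrad x‖ ≤ 3 :=
  (le_mul_of_one_le_right (norm_nonneg _) (by linarith [norm_nonneg x])).trans
    (norm_logGrad_mul_le x)

lemma rampSq_le {K : ℝ} (hK : 0 ≤ K) (s t₀ t : ℝ) :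
    rampSq K s t ≤ rampSq K s t₀ + 2 * K * max (t₀ - s) 0 * (t - t₀) + K * (t - t₀) ^ 2 := by
  have h : (max (t - s) 0) ^ 2 ≤ (max (t₀ - s) 0 + (t - t₀)) ^ 2 := by
    rcases le_total t₀ s with h1 | h1 <;> rcases le_total t s with h2 | h2
    · rw [max_eq_right (by linarith), zero_pow two_ne_zero]
      positivity
    · rw [max_eq_left (by linarith), max_eq_right (by linarith)]
      nlinarith
    · rw [max_eq_right (by linarith), zero_pow two_ne_zero]
      positivity
    · rw [max_eq_left (by linarith), max_eq_left (by linarith)]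
      apply le_of_eq
      ring
  simp only [rampSq]
  nlinarith

lemma continuous_rampSq (K s : ℝ) : Continuous (rampSq K s) := by
  unfold rampSq
  fun_prop

lemma rampSq_nonneg {K : ℝ} (hK : 0 ≤ K) (s t : ℝ) : 0 ≤ rampSq K s t := by
  unfold rampSq
  positivity

variable {ν : Measure (Vec n)} {A : Set (Vec m)} {T : ℝ}
  {b : Vec m → Vec d → Vec d} {σ : Vec m → Vec d → Matrix (Fin d) (Fin d) ℝ}
  {η : Vec m → Vec d → Vec n → Vec d} {γ : Vec d → Vec n → ℝ}
  {f : Vec m → ℝ → Vec d → ℝ → Vec d → ℝ → ℝ}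
  {ζ : ℝ → Vec d → ℝ} {g : Vec d → ℝ} {C : ℝ} {ε : ℝ}

/-- `(t₀, x₀, y₀)` maximizes the function obtained by doubling the space variable. -/
def IsDoubledMax (u v : ℝ → Vec d → ℝ) (K s β c t₀ : ℝ) (x₀ y₀ : Vec d) : Prop :=
  ∀ t x y, u t x - v t y - rampSq K s t - β * logPen x - c / 2 * ‖x - y‖ ^ 2 ≤
    u t₀ x₀ - v t₀ y₀ - rampSq K s t₀ - β * logPen x₀ - c / 2 * ‖x₀ - y₀‖ ^ 2

/-- The second order terms remaining after doubling. -/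
def diffTerm (ν : Measure (Vec n)) (σ : Vec m → Vec d → Matrix (Fin d) (Fin d) ℝ)
    (η : Vec m → Vec d → Vec n → Vec d) (ε β c κ : ℝ) (x y : Vec d) (α α' : Vec m) : ℝ :=
  1 / 2 * ∑ j, (c * ‖colE (sigmaTilde ν σ η ε α x) j - colE (sigmaTilde ν σ η ε α' y) j‖ ^ 2
    + κ * (‖colE (sigmaTilde ν σ η ε α x) j‖ ^ 2 + ‖colE (sigmaTilde ν σ η ε α' y) j‖ ^ 2)
    + β * (2 / (1 + ‖x‖ ^ 2)) * ‖colE (sigmaTilde ν σ η ε α x) j‖ ^ 2)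

lemma IsDoubledMax.exists_jets {u v : ℝ → Vec d → ℝ} {S S' : Set (Vec m)}
    (hu : Continuous fun z : ℝ × Vec d => u z.1 z.2)
    (hv : Continuous fun z : ℝ × Vec d => v z.1 z.2) {M : ℝ}
    (huM : ∀ t x, |u t x| ≤ M) (hvM : ∀ t x, |v t x| ≤ M)
    (hsub : SubsolnJets ν S T b σ η γ f ζ ε u) (hsuper : SupersolnJets ν S' T b σ η γ f ζ ε v)
    {δ : ℝ} (hSS' : ∀ α ∈ S, ∃ α' ∈ S', ‖α - α'‖ ≤ δ)
    {K s β c t₀ : ℝ} {x₀ y₀ : Vec d} (hK : 0 ≤ K) (hβ : 0 ≤ β) (hc : 0 ≤ c)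
    (hmax : IsDoubledMax u v K s β c t₀ x₀ y₀) {κ : ℝ} (hκ : 0 < κ)
    (ht : ∀ t, |t - t₀| < κ → t ∈ Ioc 0 T) :
    ∃ (t₁ t₂ : ℝ) (x₁ y₂ p₁ p₂ : Vec d),
      |t₁ - t₀| < κ ∧ ‖x₁ - x₀‖ < κ ∧ |t₂ - t₀| < κ ∧ ‖y₂ - y₀‖ < κ ∧
      ‖p₁ - (c • (x₀ - y₀) + β • logGrad x₁)‖ < κ ∧ ‖p₂ - c • (x₀ - y₀)‖ < κ ∧
      ζ t₂ y₂ ≤ v t₂ y₂ ∧ (ζ t₁ x₁ < u t₁ x₁ → ∃ α ∈ S, ∃ α' ∈ S', ‖α - α'‖ ≤ δ ∧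
        0 ≤ 2 * κ + diffTerm ν σ η ε β c κ x₁ y₂ α α' + lowHam ν b σ η γ f ε u t₁ x₁ p₁ α
          - lowHam ν b σ η γ f ε v t₂ y₂ p₂ α') := by
  have hU : Continuous fun z : ℝ × Vec d => u z.1 z.2 + -(rampSq K s z.1 + β * logPen z.2) :=
    hu.add (((continuous_rampSq K s).comp continuous_fst).add
      ((continuous_logPen.comp continuous_snd).const_mul β)).neg
  obtain ⟨t₁, t₂, x₁, y₂, a₁, a₂, p₁, p₂, X, Y, h1, h2, h3, h4, hJ1, hJ2, ha, hp1, hp2, hXY⟩ :=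
    exists_parabolicJet_of_max (U := fun t x => u t x + -(rampSq K s t + β * logPen x))
      (V := fun t x => -v t x) hU hv.neg (M := M) (fun t x => by
        have := rampSq_nonneg hK s t
        have := mul_nonneg hβ (logPen_nonneg x)
        linarith [(abs_le.1 (huM t x)).2]) (fun t x => by linarith [(abs_le.1 (hvM t x)).1]) hc
      (t₀ := t₀) (x₀ := x₀) (y₀ := y₀) (fun t x y => by linarith [hmax t x y]) hκ
  have hJu := hJ1.add (G := fun t x => rampSq K s t + β * logPen x)
    (a' := 2 * K * max (t₁ - s) 0) (p' := β • logGrad x₁) (c := β * (2 / (1 + ‖x₁‖ ^ 2)))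
    (K' := K) fun t x => by
      have e1 := rampSq_le hK s t₁ t
      have e2 := mul_le_mul_of_nonneg_left (logPen_le x₁ x) hβ
      have e3 : 1 / 2 * (β * (2 / (1 + ‖x₁‖ ^ 2)) * ‖x - x₁‖ ^ 2) =
        β * (1 / (1 + ‖x₁‖ ^ 2) * ‖x - x₁‖ ^ 2) := by ring
      rw [e3, real_inner_smul_left]
      linarith
  have hue : (fun t x => u t x + -(rampSq K s t + β * logPen x) + (rampSq K s t + β * logPen x))
      = u := by
    funext t x
    ring
  rw [hue] at hJu
  obtain ⟨hob, hs⟩ := hsuper t₂ (ht t₂ h3) y₂ a₂ p₂ Y hJ2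
  refine ⟨t₁, t₂, x₁, y₂, p₁ + β • logGrad x₁, -p₂, h1, h2, h3, h4, ?_, ?_, hob, fun hζ => ?_⟩
  · rwa [add_sub_add_right_eq_sub]
  · rwa [← norm_neg, neg_sub, sub_neg_eq_add, add_comm]
  obtain ⟨α, hα, h5⟩ := ((hsub t₁ (ht t₁ h1) x₁ _ _ _ hJu).resolve_left (not_le.2 hζ)) κ hκ
  obtain ⟨α', hα', h6⟩ := hSS' α hα
  refine ⟨α, hα, α', hα', h6, ?_⟩
  have h7 := hs α' hα'
  set c₁ := colE (sigmaTilde ν σ η ε α x₁) with hc₁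
  set c₂ := colE (sigmaTilde ν σ η ε α' y₂) with hc₂
  have h8 : ∑ j, (⟪X (c₁ j), c₁ j⟫ + ⟪Y (c₂ j), c₂ j⟫
      + β * (2 / (1 + ‖x₁‖ ^ 2)) * ‖c₁ j‖ ^ 2) ≤
      ∑ j, (c * ‖c₁ j - c₂ j‖ ^ 2 + κ * (‖c₁ j‖ ^ 2 + ‖c₂ j‖ ^ 2)
        + β * (2 / (1 + ‖x₁‖ ^ 2)) * ‖c₁ j‖ ^ 2) :=
    Finset.sum_le_sum fun j _ => by linarith [hXY (c₁ j) (c₂ j)]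
  have h9 : ∑ j, ⟪(X + (β * (2 / (1 + ‖x₁‖ ^ 2))) • ContinuousLinearMap.id ℝ (Vec d)) (c₁ j), c₁ j⟫
      + ∑ j, ⟪Y (c₂ j), c₂ j⟫ = ∑ j, (⟪X (c₁ j), c₁ j⟫ + ⟪Y (c₂ j), c₂ j⟫
      + β * (2 / (1 + ‖x₁‖ ^ 2)) * ‖c₁ j‖ ^ 2) := by
    rw [← Finset.sum_add_distrib]
    refine Finset.sum_congr rfl fun j _ => ?_
    rw [_root_.add_apply, _root_.smul_apply, ContinuousLinearMap.id_apply, inner_add_left,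
      real_inner_smul_left, real_inner_self_eq_norm_sq]
    ring
  have h10 : ∑ j, ⟪(-Y) (c₂ j), c₂ j⟫ = -∑ j, ⟪Y (c₂ j), c₂ j⟫ := by
    rw [← Finset.sum_neg_distrib]
    exact Finset.sum_congr rfl fun j _ => by rw [_root_.neg_apply, inner_neg_left]
  simp only [jetHam] at h5 h7
  rw [← hc₂, h10] at h7
  rw [← hc₁] at h5
  have h11 : 0 ≤ 2 * K * max (t₁ - s) 0 := by positivity
  have h12 := (abs_lt.1 ha).1
  simp only [lowHam, diffTerm, ← hc₁, ← hc₂]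
  linarith

end Penalization

section LimitInequality

variable {ν : Measure (Vec n)} {A : Set (Vec m)} {T : ℝ}
  {b : Vec m → Vec d → Vec d} {σ : Vec m → Vec d → Matrix (Fin d) (Fin d) ℝ}
  {η : Vec m → Vec d → Vec n → Vec d} {γ : Vec d → Vec n → ℝ}
  {f : Vec m → ℝ → Vec d → ℝ → Vec d → ℝ → ℝ}
  {ζ : ℝ → Vec d → ℝ} {g : Vec d → ℝ} {C : ℝ} {ε : ℝ}

lemma AssumptionA.tendsto_diffTerm (hA : AssumptionA ν A T b σ η γ f ζ g C)
    {xk yk : ℕ → Vec d} {αk αk' : ℕ → Vec m} {κk : ℕ → ℝ} {x y : Vec d} {α α' : Vec m} {κ : ℝ}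
    (hαk : ∀ k, αk k ∈ A) (hα : α ∈ A) (hαk' : ∀ k, αk' k ∈ A) (hα' : α' ∈ A)
    (hx : Tendsto xk atTop (𝓝 x)) (hy : Tendsto yk atTop (𝓝 y))
    (hαt : Tendsto αk atTop (𝓝 α)) (hαt' : Tendsto αk' atTop (𝓝 α'))
    (hκ : Tendsto κk atTop (𝓝 κ)) (β c : ℝ) :
    Tendsto (fun k => diffTerm ν σ η ε β c (κk k) (xk k) (yk k) (αk k) (αk' k)) atTop
      (𝓝 (diffTerm ν σ η ε β c κ x y α α')) := by
  refine (tendsto_finsetSum _ fun j _ => ?_).const_mul _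
  have h1 := hA.tendsto_colE (ε := ε) hαk hα hx hαt j
  have h2 := hA.tendsto_colE (ε := ε) hαk' hα' hy hαt' j
  have h3 : Tendsto (fun k => 2 / (1 + ‖xk k‖ ^ 2)) atTop (𝓝 (2 / (1 + ‖x‖ ^ 2))) :=
    tendsto_const_nhds.div ((hx.norm.pow 2).const_add 1) (by positivity)
  exact ((((h1.sub h2).norm.pow 2).const_mul c).add
    (hκ.mul ((h1.norm.pow 2).add (h2.norm.pow 2)))).add ((h3.const_mul β).mul (h1.norm.pow 2))

lemma tendsto_of_norm_sub_lt {E : Type*} [SeminormedAddCommGroup E] {G H : ℕ → E} {G₀ : E}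
    {κ : ℕ → ℝ} (hκ : Tendsto κ atTop (𝓝 0)) (hH : Tendsto H atTop (𝓝 G₀))
    (h : ∀ k, ‖G k - H k‖ < κ k) : Tendsto G atTop (𝓝 G₀) := by
  have h1 : Tendsto (fun k => G k - H k) atTop (𝓝 0) :=
    squeeze_zero_norm (fun k => (h k).le) hκ
  simpa using h1.add hH

lemma IsDoubledMax.limit_inequality (hA : AssumptionA ν A T b σ η γ f ζ g C) (hε : 0 < ε)
    {u v : ℝ → Vec d → ℝ} {S S' : Set (Vec m)} (hS : S ⊆ A) (hS' : S' ⊆ A)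
    (hu : Continuous fun z : ℝ × Vec d => u z.1 z.2)
    (hv : Continuous fun z : ℝ × Vec d => v z.1 z.2) {M : ℝ}
    (huM : ∀ t x, |u t x| ≤ M) (hvM : ∀ t x, |v t x| ≤ M)
    (hsub : SubsolnJets ν S T b σ η γ f ζ ε u) (hsuper : SupersolnJets ν S' T b σ η γ f ζ ε v)
    {δ : ℝ} (hSS' : ∀ α ∈ S, ∃ α' ∈ S', ‖α - α'‖ ≤ δ)
    {K s β c t₀ : ℝ} {x₀ y₀ : Vec d} (hK : 0 ≤ K) (hβ : 0 ≤ β) (hc : 0 ≤ c)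
    (hmax : IsDoubledMax u v K s β c t₀ x₀ y₀) (ht₀ : t₀ ∈ Ioo 0 T) :
    ζ t₀ y₀ ≤ v t₀ y₀ ∧ (ζ t₀ x₀ < u t₀ x₀ → ∃ α ∈ A, ∃ α' ∈ A, ‖α - α'‖ ≤ δ ∧
      0 ≤ diffTerm ν σ η ε β c 0 x₀ y₀ α α'
        + lowHam ν b σ η γ f ε u t₀ x₀ (c • (x₀ - y₀) + β • logGrad x₀) α
        - lowHam ν b σ η γ f ε v t₀ y₀ (c • (x₀ - y₀)) α') := by
  obtain ⟨ρ, hρ, hρt⟩ := Metric.eventually_nhds_iff.1 (Ioo_mem_nhds ht₀.1 ht₀.2)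
  set κ : ℕ → ℝ := fun k => ρ * (1 / ((k : ℝ) + 1)) with hκdef
  have hκ0 : ∀ k, 0 < κ k := fun k => by positivity
  have hκρ : ∀ k, κ k ≤ ρ := fun k => by
    refine mul_le_of_le_one_right hρ.le ?_
    rw [div_le_one (by positivity)]
    linarith [(Nat.cast_nonneg k : (0 : ℝ) ≤ k)]
  have hκt : Tendsto κ atTop (𝓝 0) := by
    simpa [hκdef] using (tendsto_one_div_add_atTop_nhds_zero_nat (𝕜 := ℝ)).const_mul ρ
  have hmem : ∀ k t, |t - t₀| < κ k → t ∈ Ioo 0 T := fun k t h =>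
    hρt (by rw [Real.dist_eq]; exact h.trans_le (hκρ k))
  choose t₁ t₂ x₁ y₂ p₁ p₂ h1 h2 h3 h4 h5 h6 h7 h8 using fun k =>
    hmax.exists_jets hu hv huM hvM hsub hsuper hSS' hK hβ hc (hκ0 k)
      fun t h => Ioo_subset_Ioc_self (hmem k t h)
  have lt₁ : Tendsto t₁ atTop (𝓝 t₀) := tendsto_of_norm_sub_lt hκt tendsto_const_nhds h1
  have lt₂ : Tendsto t₂ atTop (𝓝 t₀) := tendsto_of_norm_sub_lt hκt tendsto_const_nhds h3
  have lx₁ : Tendsto x₁ atTop (𝓝 x₀) := tendsto_of_norm_sub_lt hκt tendsto_const_nhds h2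
  have ly₂ : Tendsto y₂ atTop (𝓝 y₀) := tendsto_of_norm_sub_lt hκt tendsto_const_nhds h4
  have lp₁ : Tendsto p₁ atTop (𝓝 (c • (x₀ - y₀) + β • logGrad x₀)) :=
    tendsto_of_norm_sub_lt hκt
      ((((continuous_logGrad.tendsto x₀).comp lx₁).const_smul β).const_add _) h5
  have lp₂ : Tendsto p₂ atTop (𝓝 (c • (x₀ - y₀))) :=
    tendsto_of_norm_sub_lt hκt tendsto_const_nhds h6
  have hζ := hA.continuous_zeta
  refine ⟨le_of_tendsto_of_tendsto' ((hζ.tendsto (t₀, y₀)).comp (lt₂.prodMk_nhds ly₂))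
    ((hv.tendsto (t₀, y₀)).comp (lt₂.prodMk_nhds ly₂)) h7, fun hob => ?_⟩
  have hev : ∀ᶠ k in atTop, ζ (t₁ k) (x₁ k) < u (t₁ k) (x₁ k) :=
    Tendsto.eventually_lt ((hζ.tendsto (t₀, x₀)).comp (lt₁.prodMk_nhds lx₁))
      ((hu.tendsto (t₀, x₀)).comp (lt₁.prodMk_nhds lx₁)) hob
  obtain ⟨N, hN⟩ := eventually_atTop.1 hev
  choose αk hαk αk' hαk' hd hineq using fun k => h8 (k + N) (hN _ (Nat.le_add_left _ _))
  obtain ⟨⟨α, α'⟩, hαα', φ, hφ, hlim⟩ := (hA.hAcpt.prod hA.hAcpt).tendsto_subseq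
    (x := fun k => (αk k, αk' k)) fun k => ⟨hS (hαk k), hS' (hαk' k)⟩
  have lα : Tendsto (fun k => αk (φ k)) atTop (𝓝 α) := (continuous_fst.tendsto _).comp hlim
  have lα' : Tendsto (fun k => αk' (φ k)) atTop (𝓝 α') := (continuous_snd.tendsto _).comp hlim
  have hψ : Tendsto (fun k => φ k + N) atTop atTop :=
    (tendsto_add_atTop_nat N).comp hφ.tendsto_atTop
  have hsub' : ∀ k, t₁ (φ k + N) ∈ Icc 0 T := fun k => Ioo_subset_Icc_self (hmem _ _ (h1 _))
  have hsub'' : ∀ k, t₂ (φ k + N) ∈ Icc 0 T := fun k => Ioo_subset_Icc_self (hmem _ _ (h3 _))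
  refine ⟨α, hαα'.1, α', hαα'.2, le_of_tendsto' (lα.sub lα').norm fun k => hd _, ?_⟩
  have lκ := hκt.comp hψ
  have L1 := hA.tendsto_diffTerm (ε := ε) (fun k => hS (hαk (φ k))) hαα'.1
    (fun k => hS' (hαk' (φ k))) hαα'.2 (lx₁.comp hψ) (ly₂.comp hψ) lα lα' lκ β c
  have L2 := hA.tendsto_lowHam hε hu huM (fun k => hS (hαk (φ k))) hαα'.1 hsub'
    (lt₁.comp hψ) (lx₁.comp hψ) (lp₁.comp hψ) lα
  have L3 := hA.tendsto_lowHam hε hv hvM (fun k => hS' (hαk' (φ k))) hαα'.2 hsub''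
    (lt₂.comp hψ) (ly₂.comp hψ) (lp₂.comp hψ) lα'
  have L4 := (((lκ.const_mul 2).add L1).add L2).sub L3
  rw [mul_zero, zero_add] at L4
  exact ge_of_tendsto' L4 fun k => hineq (φ k)

end LimitInequality

section Estimates

variable {ν : Measure (Vec n)} {A : Set (Vec m)} {T : ℝ}
  {b : Vec m → Vec d → Vec d} {σ : Vec m → Vec d → Matrix (Fin d) (Fin d) ℝ}
  {η : Vec m → Vec d → Vec n → Vec d} {γ : Vec d → Vec n → ℝ}
  {f : Vec m → ℝ → Vec d → ℝ → Vec d → ℝ → ℝ}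
  {ζ : ℝ → Vec d → ℝ} {g : Vec d → ℝ} {C : ℝ} {ε : ℝ}
  {β c : ℝ} {x y : Vec d} {α α' : Vec m}

/-- The size of the doubling error. -/
def doublingError (c : ℝ) (x y : Vec d) (α α' : Vec m) : ℝ :=
  c * (‖x - y‖ + ‖α - α'‖) ^ 2 + (‖x - y‖ + ‖α - α'‖)

lemma doublingError_nonneg (hc : 0 ≤ c) : 0 ≤ doublingError c x y α α' := by
  unfold doublingError
  positivity

lemma diffTerm_le {L : ℝ} (hβ : 0 ≤ β) (hc : 0 ≤ c)
    (h1 : ∀ j, ‖colE (sigmaTilde ν σ η ε α x) j - colE (sigmaTilde ν σ η ε α' y) j‖ ≤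
      L * (‖x - y‖ + ‖α - α'‖))
    (h2 : ∀ j, ‖colE (sigmaTilde ν σ η ε α x) j‖ ≤ L * (1 + ‖x‖)) :
    diffTerm ν σ η ε β c 0 x y α α' ≤ 2 * d * L ^ 2 * (β + doublingError c x y α α') := by
  set s := ‖x - y‖ + ‖α - α'‖ with hs
  have hs0 : 0 ≤ s := by positivity
  have key : ∀ j, c * ‖colE (sigmaTilde ν σ η ε α x) j - colE (sigmaTilde ν σ η ε α' y) j‖ ^ 2
    + 0 * (‖colE (sigmaTilde ν σ η ε α x) j‖ ^ 2 + ‖colE (sigmaTilde ν σ η ε α' y) j‖ ^ 2)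
    + β * (2 / (1 + ‖x‖ ^ 2)) * ‖colE (sigmaTilde ν σ η ε α x) j‖ ^ 2 ≤
      4 * L ^ 2 * (β + doublingError c x y α α') := fun j => by
    have e1 : c * ‖colE (sigmaTilde ν σ η ε α x) j - colE (sigmaTilde ν σ η ε α' y) j‖ ^ 2 ≤
        c * (L * s) ^ 2 := by
      gcongr
      exact h1 j
    have e2 : β * (2 / (1 + ‖x‖ ^ 2)) * ‖colE (sigmaTilde ν σ η ε α x) j‖ ^ 2 ≤
        β * (2 / (1 + ‖x‖ ^ 2)) * (L * (1 + ‖x‖)) ^ 2 := by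
      gcongr
      exact h2 j
    have e3 : β * (2 / (1 + ‖x‖ ^ 2)) * (L * (1 + ‖x‖)) ^ 2 ≤ β * (4 * L ^ 2) := by
      rw [mul_assoc]
      refine mul_le_mul_of_nonneg_left ?_ hβ
      rw [div_mul_eq_mul_div, div_le_iff₀ (by positivity)]
      nlinarith [mul_nonneg (sq_nonneg L) (sq_nonneg (1 - ‖x‖))]
    have e4 : 0 ≤ L ^ 2 * (3 * (c * s ^ 2) + 4 * s) := by positivity
    simp only [doublingError, ← hs]
    nlinarith
  have h3 := Finset.sum_le_sum fun j (_ : j ∈ Finset.univ) => key j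
  rw [Finset.sum_const, Finset.card_univ, Fintype.card_fin, nsmul_eq_mul] at h3
  simp only [diffTerm]
  linarith

namespace AssumptionA

lemma norm_eta_sub_le (hA : AssumptionA ν A T b σ η γ f ζ g C) (hα : α ∈ A) (hα' : α' ∈ A)
    (e : Vec n) : ‖η α x e - η α' y e‖ ≤ C * (‖x - y‖ + ‖α - α'‖) :=
  (hA.hη_lip _ hα _ hα' _ _ e).trans
    (mul_le_of_le_one_right (by have := hA.hC; positivity) (min_le_left _ _))

lemma inner_drift_sub_le (hA : AssumptionA ν A T b σ η γ f ζ g C) (hα : α ∈ A) (hα' : α' ∈ A)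
    {L : ℝ} (hL : 0 ≤ L) (hb : ‖b α x‖ ≤ L * (1 + ‖x‖)) (hβ : 0 ≤ β) (hc : 0 ≤ c) :
    ⟪b α x, c • (x - y) + β • logGrad x⟫ - ⟪b α' y, c • (x - y)⟫ ≤
      (C + 3 * L) * (β + doublingError c x y α α') := by
  have hC := hA.hC
  set s := ‖x - y‖ + ‖α - α'‖ with hs
  have hws : ‖x - y‖ ≤ s := le_add_of_nonneg_right (norm_nonneg _)
  have hs0 : 0 ≤ s := by positivity
  have e1 : ⟪b α x - b α' y, c • (x - y)⟫ ≤ C * s * (c * s) := by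
    refine (real_inner_le_norm _ _).trans (mul_le_mul ?_ ?_ (norm_nonneg _) (by positivity))
    · linarith [hA.hb α hα α' hα' x y, norm_nonneg (σ α x - σ α' y)]
    · rw [norm_smul, Real.norm_of_nonneg hc]
      gcongr
  have e2 : ⟪b α x, logGrad x⟫ ≤ 3 * L := by
    refine (real_inner_le_norm _ _).trans ((mul_le_mul_of_nonneg_right hb (norm_nonneg _)).trans ?_)
    nlinarith [norm_logGrad_mul_le x]
  have e3 := mul_le_mul_of_nonneg_left e2 hβ
  rw [inner_sub_left] at e1
  rw [inner_add_right, real_inner_smul_right _ _ β]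
  have e4 : 0 ≤ 3 * L * (c * s ^ 2 + s) + C * (β + s) := by positivity
  simp only [doublingError, ← hs]
  nlinarith

/-- The increments of the two functions at a maximum point. -/
lemma _root_.IsDoubledMax.increment_le {u v : ℝ → Vec d → ℝ} {K s t : ℝ} (hβ : 0 ≤ β)
    (hmax : IsDoubledMax u v K s β c t x y) (h k : Vec d) :
    (u t (x + h) - u t x) - (v t (y + k) - v t y) ≤
      β * (⟪logGrad x, h⟫ + ‖h‖ ^ 2) + ⟪c • (x - y), h - k⟫ + c / 2 * ‖h - k‖ ^ 2 := by
  have h1 := hmax t (x + h) (y + k)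
  have h2 := logPen_le x (x + h)
  rw [add_sub_cancel_left] at h2
  have h3 : 1 / (1 + ‖x‖ ^ 2) * ‖h‖ ^ 2 ≤ ‖h‖ ^ 2 := by
    refine mul_le_of_le_one_left (sq_nonneg _) ?_
    rw [div_le_one (by positivity)]
    linarith [sq_nonneg ‖x‖]
  have h4 := mul_le_mul_of_nonneg_left (h2.trans (add_le_add_right h3 _)) hβ
  have h5 : ‖x + h - (y + k)‖ ^ 2 = ‖x - y‖ ^ 2 + 2 * ⟪x - y, h - k⟫ + ‖h - k‖ ^ 2 := by
    rw [← norm_add_sq_real]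
    congr 2
    abel
  rw [h5] at h1
  rw [real_inner_smul_left]
  linarith

lemma jumpK_sub_le (hA : AssumptionA ν A T b σ η γ f ζ g C) (hε : 0 < ε) (hα : α ∈ A)
    (hα' : α' ∈ A) {u v : ℝ → Vec d → ℝ} {t K s : ℝ} (hu : Continuous (u t))
    (hv : Continuous (v t)) {M : ℝ} (huM : ∀ x, |u t x| ≤ M) (hvM : ∀ x, |v t x| ≤ M)
    (hβ : 0 ≤ β) (hc : 0 ≤ c) (hmax : IsDoubledMax u v K s β c t x y) :
    jumpK ν η ε (u t) (c • (x - y) + β • logGrad x) α x - jumpK ν η ε (v t) (c • (x - y)) α' y ≤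
      C ^ 2 * (ν.restrict {e : Vec n | ε < ‖e‖}).real univ * (β + doublingError c x y α α') := by
  have _ := hA.isFiniteMeasure hε
  have hC := hA.hC
  set r := ‖x - y‖ + ‖α - α'‖ with hr
  have hr0 : 0 ≤ r := by positivity
  rw [jumpK, jumpK, ← integral_sub (hA.integrable_jumpK hε hα hu huM _ _)
    (hA.integrable_jumpK hε hα' hv hvM _ _)]
  refine (integral_mono ((hA.integrable_jumpK hε hα hu huM _ _).sub
    (hA.integrable_jumpK hε hα' hv hvM _ _))
    (integrable_const (C ^ 2 * (β + doublingError c x y α α'))) fun e => ?_).trans (le_of_eq ?_)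
  · have h1 := hmax.increment_le hβ (η α x e) (η α' y e)
    have h2 := hA.norm_eta_le hα x e
    have h3 := hA.norm_eta_sub_le (x := x) (y := y) hα hα' e
    have h4 : β * ‖η α x e‖ ^ 2 ≤ β * C ^ 2 := by gcongr
    have h5 : c / 2 * ‖η α x e - η α' y e‖ ^ 2 ≤ c / 2 * (C * r) ^ 2 := by gcongr
    have h6 : 0 ≤ C ^ 2 * (c / 2 * r ^ 2 + r) := by positivity
    simp only [Pi.sub_apply, doublingError, ← hr]
    rw [inner_sub_right] at h1
    rw [inner_add_right, real_inner_smul_right _ _ β, real_inner_comm (c • (x - y)) (η α x e),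
      real_inner_comm (c • (x - y)) (η α' y e), real_inner_comm (logGrad x) (η α x e)]
    nlinarith
  · rw [integral_const, smul_eq_mul]
    ring

lemma jumpB_sub_le (hA : AssumptionA ν A T b σ η γ f ζ g C) (hε : 0 < ε) (hα : α ∈ A)
    (hα' : α' ∈ A) {u v : ℝ → Vec d → ℝ} {t K s : ℝ} (hu : Continuous (u t))
    (hv : Continuous (v t)) {M : ℝ} (huM : ∀ x, |u t x| ≤ M) (hvM : ∀ x, |v t x| ≤ M)
    (hβ : 0 ≤ β) (hc : 0 ≤ c) (hmax : IsDoubledMax u v K s β c t x y) :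
    jumpB ν η γ ε (u t) α x - jumpB ν η γ ε (v t) α' y ≤
      (C * (3 * C + 2 * C ^ 2) + 2 * M * C) * (ν.restrict {e : Vec n | ε < ‖e‖}).real univ
        * (β + doublingError c x y α α') := by
  have _ := hA.isFiniteMeasure hε
  have hC := hA.hC
  have hM0 : 0 ≤ M := (abs_nonneg _).trans (huM 0)
  set r := ‖x - y‖ + ‖α - α'‖ with hr
  have hr0 : 0 ≤ r := by positivity
  have hwr : ‖x - y‖ ≤ r := le_add_of_nonneg_right (norm_nonneg _)
  rw [jumpB, jumpB, ← integral_sub (hA.integrable_jumpB hε α hu huM _)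
    (hA.integrable_jumpB hε α' hv hvM _)]
  refine (integral_mono ((hA.integrable_jumpB hε α hu huM _).sub
    (hA.integrable_jumpB hε α' hv hvM _)) (integrable_const
    ((C * (3 * C + 2 * C ^ 2) + 2 * M * C) * (β + doublingError c x y α α'))) fun e => ?_).trans
      (le_of_eq ?_)
  · have h1 := hmax.increment_le hβ (η α x e) (η α' y e)
    have h2 := hA.norm_eta_le hα x e
    have h3 := hA.norm_eta_sub_le (x := x) (y := y) hα hα' e
    have h4 : β * ‖η α x e‖ ^ 2 ≤ β * C ^ 2 := by gcongr
    have h5 : c / 2 * ‖η α x e - η α' y e‖ ^ 2 ≤ c / 2 * (C * r) ^ 2 := by gcongr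
    have h6 : ⟪logGrad x, η α x e⟫ ≤ 3 * C := (real_inner_le_norm _ _).trans
      (mul_le_mul (norm_logGrad_le x) h2 (norm_nonneg _) (by norm_num))
    have h7 : ⟪c • (x - y), η α x e - η α' y e⟫ ≤ c * r * (C * r) := by
      refine (real_inner_le_norm _ _).trans (mul_le_mul ?_ h3 (norm_nonneg _) (by positivity))
      rw [norm_smul, Real.norm_of_nonneg hc]
      gcongr
    have h8 := mul_le_mul_of_nonneg_left h6 hβ
    set D := (3 * C + C ^ 2) * β + (C + C ^ 2) * (c * r ^ 2) with hD
    have hD0 : 0 ≤ D := by positivity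
    have h9 : (u t (x + η α x e) - u t x) - (v t (y + η α' y e) - v t y) ≤ D := by
      have : 0 ≤ C ^ 2 * (c * r ^ 2) := by positivity
      rw [hD]
      nlinarith
    have h10 : ((u t (x + η α x e) - u t x) - (v t (y + η α' y e) - v t y)) * γ x e ≤ D * C :=
      mul_le_mul h9 ((le_abs_self _).trans (hA.abs_gamma_le x e)) (hA.hγ_nonneg x e) hD0
    have h11 : (v t (y + η α' y e) - v t y) * (γ x e - γ y e) ≤ 2 * M * (C * r) := by
      refine (le_abs_self _).trans ?_
      rw [abs_mul]
      refine mul_le_mul ?_ ?_ (abs_nonneg _) (by positivity)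
      · have e1 := abs_le.1 (hvM (y + η α' y e))
        have e2 := abs_le.1 (hvM y)
        rw [abs_le]
        constructor <;> linarith [e1.1, e1.2, e2.1, e2.2]
      · refine (hA.hγ_lip x y e).trans ((mul_le_of_le_one_right (by positivity)
          (min_le_left _ _)).trans ?_)
        gcongr
    have h12 : 0 ≤ C * (C ^ 2 * β + (2 * C + C ^ 2) * (c * r ^ 2) + (3 * C + 2 * C ^ 2) * r)
        + 2 * M * C * (β + c * r ^ 2) := by positivity
    simp only [Pi.sub_apply, doublingError, ← hr]
    rw [hD] at h10
    linarith
  · rw [integral_const, smul_eq_mul]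
    ring

end AssumptionA

end Estimates

section DoublingEstimate

variable {ν : Measure (Vec n)} {A : Set (Vec m)} {T : ℝ}
  {b : Vec m → Vec d → Vec d} {σ : Vec m → Vec d → Matrix (Fin d) (Fin d) ℝ}
  {η : Vec m → Vec d → Vec n → Vec d} {γ : Vec d → Vec n → ℝ}
  {f : Vec m → ℝ → Vec d → ℝ → Vec d → ℝ → ℝ}
  {ζ : ℝ → Vec d → ℝ} {g : Vec d → ℝ} {C : ℝ} {ε : ℝ}

/-- The estimate at a maximum point of the doubled function, with constants independent of the
functions and of the penalization parameters. -/
lemma AssumptionA.exists_doubling_estimate (hA : AssumptionA ν A T b σ η γ f ζ g C) (hε : 0 < ε)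
    {M : ℝ} (hM0 : 0 ≤ M) :
    ∃ Q₀ ≥ 0, ∃ L ≥ 0, ∀ (u v : ℝ → Vec d → ℝ) (K s β c t : ℝ) (x y : Vec d) (α α' : Vec m),
      Continuous (u t) → Continuous (v t) → (∀ x, |u t x| ≤ M) → (∀ x, |v t x| ≤ M) →
      0 ≤ β → 0 ≤ c → t ∈ Icc 0 T → α ∈ A → α' ∈ A → IsDoubledMax u v K s β c t x y →
      v t y ≤ u t x →
      0 ≤ diffTerm ν σ η ε β c 0 x y α α'
        + lowHam ν b σ η γ f ε u t x (c • (x - y) + β • logGrad x) α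
        - lowHam ν b σ η γ f ε v t y (c • (x - y)) α' →
      ∀ (R : ℝ) (mR : ℝ → ℝ), (∀ α ∈ A, ∀ t ∈ Icc (0:ℝ) T, ∀ (x x' : Vec d) (u : ℝ) (p : Vec d)
        (k : ℝ), ‖x‖ ≤ R → ‖x'‖ ≤ R → |u| ≤ R →
        |f α t x u p k - f α t x' u p k| ≤ mR (‖x - x'‖ * (1 + ‖p‖))) →
      ‖x‖ ≤ R → ‖y‖ ≤ R → M ≤ R →
      ∃ r, 0 ≤ r ∧ r ≤ L * (1 + R) * doublingError c x y α α' ∧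
        C * (u t x - v t y) ≤ Q₀ * (β + doublingError c x y α α') + mR r := by
  have hC := hA.hC
  obtain ⟨L, hL, hlip, hcol, hb⟩ := hA.exists_lipschitz ε
  set N := (ν.restrict {e : Vec n | ε < ‖e‖}).real univ with hN
  set E := (C * (3 * C + 2 * C ^ 2) + 2 * M * C) * N with hE
  refine ⟨2 * d * L ^ 2 + (C + 3 * L) + C ^ 2 * N + C * E + C * (1 + 3 * (d * L)), by positivity,
    1 + d * L, by positivity, ?_⟩
  intro u v K s β c t x y α α' hu hv huM hvM hβ hc ht hα hα' hmax huv hineq R mR hmR hxR hyR hMR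
  have hR0 : 0 ≤ R := hM0.trans hMR
  have e1 := diffTerm_le (ν := ν) (σ := σ) (η := η) (ε := ε) (α := α) (α' := α') hβ hc
    (hlip α hα α' hα' x y) (hcol α hα x)
  have e2 := hA.inner_drift_sub_le (x := x) (y := y) hα hα' hL.le (hb α hα x) hβ hc
  have e3 := hA.jumpK_sub_le hε hα hα' hu hv huM hvM hβ hc hmax
  have e4 := hA.jumpB_sub_le hε hα hα' hu hv huM hvM hβ hc hmax
  have hQ := doublingError_nonneg (x := x) (y := y) (α := α) (α' := α') hc
  rw [← hN] at e3 e4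
  rw [← hE] at e4
  set p := c • (x - y) with hp
  set P := mvE (sigmaTilde ν σ η ε α x)ᵀ (p + β • logGrad x) with hP
  set P' := mvE (sigmaTilde ν σ η ε α' y)ᵀ p with hP'
  set Bu := jumpB ν η γ ε (u t) α x with hBu
  set Bv := jumpB ν η γ ε (v t) α' y with hBv
  set Q := doublingError c x y α α' with hQdef
  set w := ‖x - y‖ with hw
  set δ := ‖α - α'‖ with hδ
  have hw0 : 0 ≤ w := norm_nonneg _
  have hδ0 : 0 ≤ δ := norm_nonneg _
  have hQe : Q = c * (w + δ) ^ 2 + (w + δ) := rfl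
  have hpn : ‖p‖ = c * w := by rw [hp, norm_smul, Real.norm_of_nonneg hc]
  have hcw : c * w ^ 2 ≤ c * (w + δ) ^ 2 := by
    gcongr
    linarith
  have hcw' : (w + δ) * (c * w) ≤ c * (w + δ) ^ 2 := by
    have : 0 ≤ (w + δ) * c * δ := by positivity
    nlinarith
  have hPP : ‖P' - P‖ ≤ 3 * (d * L) * (β + Q) := by
    refine (norm_mvE_sub_le _ _ _ _).trans ((Finset.sum_le_sum (g := fun _ => 3 * L * (β + Q))
      fun j _ => ?_).trans (le_of_eq ?_))
    · have h1 : ‖colE (sigmaTilde ν σ η ε α' y) j - colE (sigmaTilde ν σ η ε α x) j‖ * ‖p‖ ≤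
          L * (w + δ) * (c * w) := by
        rw [hpn, norm_sub_rev]
        gcongr
        exact hlip α hα α' hα' x y j
      have h2 : ‖colE (sigmaTilde ν σ η ε α x) j‖ * ‖p - (p + β • logGrad x)‖ ≤ L * (3 * β) := by
        rw [sub_add_cancel_left, norm_neg, norm_smul, Real.norm_of_nonneg hβ]
        calc _ ≤ L * (1 + ‖x‖) * (β * ‖logGrad x‖) := by
              gcongr
              exact hcol α hα x j
          _ = L * β * (‖logGrad x‖ * (1 + ‖x‖)) := by ring
          _ ≤ L * β * 3 := by
              gcongr
              exact norm_logGrad_mul_le x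
          _ = _ := by ring
      have h3 := mul_le_mul_of_nonneg_left hcw' hL.le
      have h4 : 0 ≤ L * (2 * (c * (w + δ) ^ 2) + 3 * (w + δ)) := by positivity
      rw [hQe]
      linarith
    · simp
      ring
  have hPn : ‖P'‖ ≤ d * (L * (1 + R) * (c * w)) := by
    refine (norm_le_sum_abs _).trans ((Finset.sum_le_sum (g := fun _ => L * (1 + R) * (c * w))
      fun j _ => ?_).trans (le_of_eq (by simp)))
    rw [hP', mvE_transpose_apply]
    refine (abs_real_inner_le_norm _ _).trans ?_
    rw [hpn]
    gcongr
    exact (hcol α' hα' y j).trans (by gcongr)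
  refine ⟨w * (1 + ‖P'‖), by positivity, ?_, ?_⟩
  · have h1 := mul_le_mul_of_nonneg_left hPn hw0
    have h2 : d * L * (1 + R) * (c * w ^ 2) ≤ d * L * (1 + R) * (c * (w + δ) ^ 2) := by gcongr
    have h3 : 0 ≤ d * L * (1 + R) * (w + δ) + R * (w + δ) + (1 + R) * (c * (w + δ) ^ 2) := by
      positivity
    rw [hQe]
    linarith
  · have hEQ : 0 ≤ E * (β + Q) := by positivity
    have f1 : f α t x (u t x) P Bu ≤ f α t x (u t x) P (Bv + E * (β + Q)) :=
      hA.hf_k_mono α hα t ht x (u t x) P (by linarith)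
    have f2 := hA.hf_lip α hα α' hα' t ht x (u t x) (u t x) P P' (Bv + E * (β + Q)) Bv
    rw [sub_self, abs_zero, add_sub_cancel_left, abs_of_nonneg hEQ, norm_sub_rev P] at f2
    have f3 := hmR α' hα' t ht x y (u t x) P' Bv hxR hyR ((huM x).trans hMR)
    have f4 := hA.hf_mono α' hα' t ht y P' Bv (u t x) (v t y) huv
    have f5 := mul_le_mul_of_nonneg_left hPP hC.le
    have f6 : C * δ ≤ C * (β + Q) := by
      have : 0 ≤ c * (w + δ) ^ 2 := by positivity
      rw [hQe]
      gcongr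
      linarith
    have f2' := (abs_le.1 f2).2
    have f3' := (abs_le.1 f3).2
    simp only [lowHam] at hineq
    rw [← hP, ← hP', ← hBu, ← hBv] at hineq
    linarith

end DoublingEstimate

section DoubledMaximum

lemma exists_le_mul_logPen (d : ℕ) {β : ℝ} (hβ : 0 < β) (M : ℝ) :
    ∃ R > 0, ∀ x : Vec d, R < ‖x‖ → 2 * M ≤ β * logPen x := by
  refine ⟨Real.exp (M / β), Real.exp_pos _, fun x hx => ?_⟩
  have h1 : Real.exp (2 * M / β) ≤ 1 + ‖x‖ ^ 2 := by
    have h2 : Real.exp (2 * M / β) = Real.exp (M / β) ^ 2 := by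
      rw [← Real.exp_nat_mul]
      congr 1
      push_cast
      ring
    have h3 := pow_le_pow_left₀ (Real.exp_pos (M / β)).le hx.le 2
    linarith
  have h2 := (Real.le_log_iff_exp_le (by positivity)).2 h1
  rw [div_le_iff₀' hβ] at h2
  exact h2

/-- The penalised difference of two bounded functions, constant in time outside `[0, T]`, attains
its maximum. -/
lemma exists_isDoubledMax {u v : ℝ → Vec d → ℝ} {T M : ℝ}
    (hu : Continuous fun z : ℝ × Vec d => u z.1 z.2)
    (hv : Continuous fun z : ℝ × Vec d => v z.1 z.2)
    (huM : ∀ t x, |u t x| ≤ M) (hvM : ∀ t x, |v t x| ≤ M)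
    (huT : ∀ t x, u (max 0 (min T t)) x = u t x) (hvT : ∀ t x, v (max 0 (min T t)) x = v t x)
    {K s β c : ℝ} (hK : 0 ≤ K) (hs : s ∈ Icc 0 T) (hβ : 0 < β) (hc : 0 < c) {x' : Vec d}
    (hpos : 0 < u s x' - v s x' - β * logPen x') :
    ∃ t ∈ Icc 0 T, ∃ x y, IsDoubledMax u v K s β c t x y := by
  have hM0 : 0 ≤ M := (abs_nonneg _).trans (huM 0 0)
  obtain ⟨R, hR, hRM⟩ := exists_le_mul_logPen d hβ M
  have hT : 0 ≤ T := hs.1.trans hs.2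
  set r := √(4 * M / c) with hr
  have hr2 : r ^ 2 = 4 * M / c := Real.sq_sqrt (by positivity)
  have hr0 : 0 ≤ r := Real.sqrt_nonneg _
  set F : ℝ × Vec d × Vec d → ℝ := fun z => u z.1 z.2.1 - v z.1 z.2.2 - rampSq K s z.1
    - β * logPen z.2.1 - c / 2 * ‖z.2.1 - z.2.2‖ ^ 2 with hF
  have hFc : Continuous F := by
    have h1 : Continuous fun z : ℝ × Vec d × Vec d => u z.1 z.2.1 :=
      hu.comp (continuous_fst.prodMk (continuous_fst.comp continuous_snd))
    have h2 : Continuous fun z : ℝ × Vec d × Vec d => v z.1 z.2.2 :=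
      hv.comp (continuous_fst.prodMk (continuous_snd.comp continuous_snd))
    have h3 := (continuous_rampSq K s).comp (continuous_fst (X := ℝ) (Y := Vec d × Vec d))
    have h4 : Continuous fun z : ℝ × Vec d × Vec d => logPen z.2.1 :=
      continuous_logPen.comp (continuous_fst.comp continuous_snd)
    exact (((h1.sub h2).sub h3).sub (h4.const_mul β)).sub (by fun_prop)
  have hramp0 : rampSq K s s = 0 := by simp [rampSq]
  have hsmall : ∀ t x y, 0 < F (t, x, y) → ‖x‖ ≤ R ∧ ‖y‖ ≤ R + r := by
    intro t x y h
    simp only [hF] at h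
    have h1 := abs_le.1 (huM t x)
    have h2 := abs_le.1 (hvM t y)
    have h3 := rampSq_nonneg hK s t
    have h4 := mul_nonneg hβ.le (logPen_nonneg x)
    have h5 : 0 ≤ c / 2 * ‖x - y‖ ^ 2 := by positivity
    have hx : ‖x‖ ≤ R := by
      by_contra! hx
      linarith [hRM x hx]
    refine ⟨hx, ?_⟩
    by_contra! hy
    have h6 : r ≤ ‖x - y‖ := by
      have := norm_sub_norm_le y x
      rw [norm_sub_rev] at this
      linarith
    have h7 := pow_le_pow_left₀ hr0 h6 2
    have h8 : c / 2 * (4 * M / c) ≤ c / 2 * ‖x - y‖ ^ 2 :=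
      mul_le_mul_of_nonneg_left (hr2 ▸ h7) (by positivity)
    have h9 : c / 2 * (4 * M / c) = 2 * M := by
      field_simp
      ring
    linarith
  have hF0 : 0 < F (s, x', x') := by
    simpa [hF, hramp0] using hpos
  have hmem0 := hsmall _ _ _ hF0
  have hcpt : IsCompact (Icc 0 T ×ˢ closedBall (0 : Vec d) R ×ˢ closedBall (0 : Vec d) (R + r)) :=
    isCompact_Icc.prod ((isCompact_closedBall _ _).prod (isCompact_closedBall _ _))
  obtain ⟨⟨t, x, y⟩, ⟨ht, -⟩, hmax⟩ := hcpt.exists_isMaxOn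
    ⟨(s, x', x'), hs, by simpa using hmem0.1, by simpa using hmem0.2⟩ hFc.continuousOn
  have hxx : F (s, x', x') ≤ F (t, x, y) :=
    hmax ⟨hs, by simpa using hmem0.1, by simpa using hmem0.2⟩
  have key : ∀ t' ∈ Icc 0 T, ∀ x' y', F (t', x', y') ≤ F (t, x, y) := by
    intro t' ht' x' y'
    rcases le_or_gt (F (t', x', y')) 0 with h | h
    · linarith
    · have := hsmall _ _ _ h
      exact hmax ⟨ht', by simpa using this.1, by simpa using this.2⟩
  refine ⟨t, ht, x, y, fun t' x' y' => ?_⟩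
  have hk := key (max 0 (min T t')) ⟨le_max_left _ _, max_le hT (min_le_left _ _)⟩ x' y'
  simp only [hF, huT, hvT] at hk
  have hramp : rampSq K s (max 0 (min T t')) ≤ rampSq K s t' := by
    simp only [rampSq]
    refine mul_le_mul_of_nonneg_left (pow_le_pow_left₀ (le_max_right _ _) ?_ 2) hK
    rcases le_total 0 (min T t') with h | h
    · rw [max_eq_right h]
      exact max_le_max_right _ (by linarith [min_le_right T t'])
    · rw [max_eq_left h]
      exact max_le (by linarith [hs.1, le_max_right (t' - s) 0]) (le_max_right _ _)
  linarith

/-- At a doubled maximum the distance between the two spatial points is controlled by the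
oscillation of `u`. -/
lemma IsDoubledMax.sq_dist_le {u v : ℝ → Vec d → ℝ} {K s β c t : ℝ} {x y : Vec d}
    (hmax : IsDoubledMax u v K s β c t x y) (hβ : 0 ≤ β) :
    c / 2 * ‖x - y‖ ^ 2 ≤ u t x - u t y + β * (3 * ‖x - y‖ + ‖x - y‖ ^ 2) := by
  have h := hmax t y y
  simp only [sub_self, norm_zero] at h
  have h1 := logPen_le x y
  have h2 : ⟪logGrad x, y - x⟫ ≤ 3 * ‖y - x‖ := (real_inner_le_norm _ _).trans
    (mul_le_mul_of_nonneg_right (norm_logGrad_le x) (norm_nonneg _))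
  have h3 : 1 / (1 + ‖x‖ ^ 2) * ‖y - x‖ ^ 2 ≤ ‖y - x‖ ^ 2 := by
    refine mul_le_of_le_one_left (by positivity) ?_
    rw [div_le_one (by positivity)]
    nlinarith [norm_nonneg x]
  rw [norm_sub_rev y x] at h2 h3
  rw [norm_sub_rev y x] at h1
  have h4 := mul_le_mul_of_nonneg_left
    (h1.trans (by linarith : _ ≤ logPen x + 3 * ‖x - y‖ + ‖x - y‖ ^ 2)) hβ
  nlinarith

end DoubledMaximum

section Comparison

variable {ν : Measure (Vec n)} {A : Set (Vec m)} {T : ℝ}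
  {b : Vec m → Vec d → Vec d} {σ : Vec m → Vec d → Matrix (Fin d) (Fin d) ℝ}
  {η : Vec m → Vec d → Vec n → Vec d} {γ : Vec d → Vec n → ℝ}
  {f : Vec m → ℝ → Vec d → ℝ → Vec d → ℝ → ℝ}
  {ζ : ℝ → Vec d → ℝ} {g : Vec d → ℝ} {C : ℝ} {ε : ℝ}

lemma eventually_mul_le (a : ℝ) {c : ℝ} (hc : 0 < c) : ∀ᶠ b in 𝓝[>] (0 : ℝ), a * b ≤ c := by
  have h : Tendsto (fun b : ℝ => a * b) (𝓝[>] 0) (𝓝 0) := by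
    have h : Continuous fun b : ℝ => a * b := by fun_prop
    simpa using (h.tendsto 0).mono_left nhdsWithin_le_nhds
  exact (h.eventually (gt_mem_nhds hc)).mono fun _ => le_of_lt

lemma exists_abs_sub_le_of_continuous {u : ℝ → Vec d → ℝ}
    (hu : Continuous fun z : ℝ × Vec d => u z.1 z.2) (T R : ℝ) {q : ℝ} (hq : 0 < q) :
    ∃ r > 0, ∀ t ∈ Icc 0 T, ∀ x y : Vec d, ‖x‖ ≤ R → ‖y‖ ≤ R → ‖x - y‖ < r →
      |u t x - u t y| ≤ q := by
  have huc : UniformContinuousOn (fun z : ℝ × Vec d => u z.1 z.2)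
      (Icc 0 T ×ˢ closedBall (0 : Vec d) R) :=
    (isCompact_Icc.prod (isCompact_closedBall _ _)).uniformContinuousOn_of_continuous
      hu.continuousOn
  obtain ⟨r, hr, h⟩ := Metric.uniformContinuousOn_iff.1 huc q hq
  refine ⟨r, hr, fun t ht x y hx hy hxy => ?_⟩
  have := h (t, x) ⟨ht, by simpa using hx⟩ (t, y) ⟨ht, by simpa using hy⟩
    (by simpa [Prod.dist_eq, dist_eq_norm] using hxy)
  exact (by simpa [Real.dist_eq] using this : |u t x - u t y| < q).le

namespace AssumptionA

set_option maxHeartbeats 1000000 in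
/-- A subsolution for the controls `S` lies, up to a small error on bounded sets, below every
bounded supersolution for a set of controls which is nearly as rich as `S`. -/
theorem exists_comparison (hA : AssumptionA ν A T b σ η γ f ζ g C) (hε : 0 < ε)
    {S : Set (Vec m)} (hS : S ⊆ A) {u : ℝ → Vec d → ℝ}
    (hu : Continuous fun z : ℝ × Vec d => u z.1 z.2) {M : ℝ} (huM : ∀ t x, |u t x| ≤ M)
    (huT : ∀ t x, u (max 0 (min T t)) x = u t x) (hsub : SubsolnJets ν S T b σ η γ f ζ ε u)
    (hu0 : ∀ x, u 0 x = g x) {κ : ℝ} (hκ : 0 < κ) (R₀ : ℝ) :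
    ∃ δ₀ > 0, ∀ S' ⊆ A, (∀ α ∈ S, ∃ α' ∈ S', ‖α - α'‖ ≤ δ₀) → ∀ v : ℝ → Vec d → ℝ,
      (Continuous fun z : ℝ × Vec d => v z.1 z.2) → (∀ t x, |v t x| ≤ M) →
      (∀ t x, v (max 0 (min T t)) x = v t x) → SupersolnJets ν S' T b σ η γ f ζ ε v →
      (∀ x, v 0 x = g x) → ∀ t ∈ Icc 0 T, ∀ x, ‖x‖ ≤ R₀ → u t x ≤ v t x + 3 * κ := by
  have hM0 : 0 ≤ M := (abs_nonneg _).trans (huM 0 0)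
  have hC := hA.hC
  have hCκ : 0 < C * κ := mul_pos hC hκ
  obtain ⟨Q₀, hQ₀, L, hL, hest⟩ := hA.exists_doubling_estimate hε hM0
  obtain ⟨β, ⟨⟨hβ1, hβQ⟩, hβl⟩, hβ⟩ := (((eventually_mul_le 1 one_pos).and
    (eventually_mul_le Q₀ (by linarith : 0 < C * κ / 4))).and
    (eventually_mul_le (Real.log (1 + R₀ ^ 2)) hκ)).and self_mem_nhdsWithin |>.exists
  rw [one_mul] at hβ1
  obtain ⟨R, hR, hRM⟩ := exists_le_mul_logPen d hβ M
  obtain ⟨mR, hmRc, hmR0, -, hmR⟩ := hA.hf_x (R + 1 + M) (by linarith)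
  obtain ⟨ρ, hρ, hmRρ⟩ : ∃ ρ > 0, ∀ r, 0 ≤ r → r ≤ ρ → mR r ≤ C * κ / 2 := by
    have h : ∀ᶠ r in 𝓝 (0 : ℝ), mR r < C * κ / 2 :=
      (hmRc.tendsto 0).eventually (gt_mem_nhds (by rw [hmR0]; linarith))
    obtain ⟨ρ, hρ, h⟩ := Metric.eventually_nhds_iff.1 h
    refine ⟨ρ / 2, by linarith, fun r hr0 hr => (h ?_).le⟩
    rw [Real.dist_eq, sub_zero, abs_of_nonneg hr0]
    linarith
  obtain ⟨q, ⟨⟨⟨hq1, hqQ⟩, hqL⟩, hqC⟩, hq⟩ := ((((eventually_mul_le 1 one_pos).and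
    (eventually_mul_le Q₀ (by linarith : 0 < C * κ / 4))).and
    (eventually_mul_le (L * (1 + (R + 1 + M))) hρ)).and
    (eventually_mul_le C hκ)).and self_mem_nhdsWithin |>.exists
  rw [one_mul] at hq1
  obtain ⟨r₀, hr₀, hur₀⟩ := exists_abs_sub_le_of_continuous hu T (R + 1)
    (by linarith : 0 < q / 16)
  set w₀ := min (r₀ / 2) (q / 68) with hw₀
  have hw₀pos : 0 < w₀ := lt_min (by linarith) (by linarith)
  have hw₀r : w₀ < r₀ := (min_le_left _ _).trans_lt (by linarith)
  have hw₀q : w₀ ≤ q / 68 := min_le_right _ _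
  set c := (4 * M + 1) / w₀ ^ 2 with hc
  have hcpos : 0 < c := by positivity
  obtain ⟨δ₀, hδ₀q, hδ₀⟩ : ∃ δ₀, 2 * c * δ₀ ^ 2 + δ₀ ≤ q / 8 ∧ 0 < δ₀ := by
    have h : Tendsto (fun δ : ℝ => 2 * c * δ ^ 2 + δ) (𝓝[>] 0) (𝓝 0) := by
      have h : Continuous fun δ : ℝ => 2 * c * δ ^ 2 + δ := by fun_prop
      simpa using (h.tendsto 0).mono_left nhdsWithin_le_nhds
    obtain ⟨δ, h1, h2⟩ := ((h.eventually (gt_mem_nhds (by linarith : 0 < q / 8))).and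
      self_mem_nhdsWithin).exists
    exact ⟨δ, h1.le, h2⟩
  refine ⟨δ₀, hδ₀, fun S' hS' hSS' v hv hvM hvT hsuper hv0 => ?_⟩
  have main : ∀ t ∈ Ico 0 T, ∀ x, ‖x‖ ≤ R₀ → u t x ≤ v t x + 3 * κ := by
    intro s hs x' hx'
    by_contra! hcon
    have hlog : β * logPen x' ≤ κ := by
      have h : logPen x' ≤ Real.log (1 + R₀ ^ 2) :=
        Real.log_le_log (by positivity)
          (by linarith [pow_le_pow_left₀ (norm_nonneg x') hx' 2])
      have := mul_le_mul_of_nonneg_left h hβ.le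
      linarith
    set K := (2 * M + 1) / (T - s) ^ 2 with hK
    have hTs : 0 < T - s := sub_pos.2 hs.2
    have hK0 : 0 ≤ K := by positivity
    obtain ⟨t, ht, x, y, hmax⟩ := exists_isDoubledMax hu hv huM hvM huT hvT hK0
      ⟨hs.1, hs.2.le⟩ hβ hcpos (x' := x') (by linarith)
    have hval := hmax s x' x'
    have hramp0 : rampSq K s s = 0 := by simp [rampSq]
    simp only [hramp0, sub_self, norm_zero, ne_eq, OfNat.ofNat_ne_zero, not_false_eq_true,
      zero_pow, mul_zero, sub_zero] at hval
    have hux := abs_le.1 (huM t x)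
    have hvy := abs_le.1 (hvM t y)
    have hr := rampSq_nonneg hK0 s t
    have hl := mul_nonneg hβ.le (logPen_nonneg x)
    have hw2 : 0 ≤ c / 2 * ‖x - y‖ ^ 2 := by positivity
    have hw0 : 0 ≤ ‖x - y‖ := norm_nonneg _
    have hgap : 2 * κ < u t x - v t y := by linarith
    have hxR : ‖x‖ ≤ R := by
      by_contra! h
      linarith [hRM x h]
    have hww₀ : ‖x - y‖ ≤ w₀ := by
      by_contra! h
      have h1 := pow_lt_pow_left₀ h hw₀pos.le two_ne_zero
      have h2 : c * w₀ ^ 2 = 4 * M + 1 := by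
        rw [hc]
        field_simp
      have h3 := mul_lt_mul_of_pos_left h1 hcpos
      linarith
    have hw1 : ‖x - y‖ ≤ 1 := by linarith
    have hyR : ‖y‖ ≤ R + 1 := by
      have := norm_sub_norm_le y x
      rw [norm_sub_rev] at this
      linarith
    have hosc := hmax.sq_dist_le hβ.le
    have huxy := (abs_le.1 (hur₀ t ht x y (by linarith) hyR (by linarith))).2
    have hcw : 2 * (c * ‖x - y‖ ^ 2) ≤ q / 4 + 16 * ‖x - y‖ := by
      have h1 : ‖x - y‖ ^ 2 ≤ ‖x - y‖ := by nlinarith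
      have h2 : β * (3 * ‖x - y‖ + ‖x - y‖ ^ 2) ≤ 1 * (4 * ‖x - y‖) :=
        mul_le_mul hβ1 (by linarith) (by positivity) zero_le_one
      linarith
    have hCw : C * ‖x - y‖ ≤ κ :=
      (mul_le_mul_of_nonneg_left (by linarith : ‖x - y‖ ≤ q) hC.le).trans hqC
    have ht0 : t ≠ 0 := by
      rintro rfl
      have h1 := hA.hζg_lip 0 x y
      have h2 := le_abs_self (g x - g y)
      have h3 := abs_nonneg (ζ 0 x - ζ 0 y)
      rw [hu0, hv0] at hgap
      linarith
    have htT : t ≠ T := by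
      rintro rfl
      have h1 : rampSq K s t = 2 * M + 1 := by
        rw [rampSq, max_eq_left hTs.le, hK]
        field_simp
      linarith
    have htIoo : t ∈ Ioo 0 T := ⟨ht.1.lt_of_ne' ht0, ht.2.lt_of_ne htT⟩
    obtain ⟨hζv, hlim⟩ := hmax.limit_inequality hA hε hS hS' hu hv huM hvM hsub hsuper hSS'
      hK0 hβ.le hcpos.le htIoo
    have hζu : ζ t x < u t x := by
      have h1 := hA.hζg_lip t x y
      have h2 := le_abs_self (ζ t x - ζ t y)
      have h3 := abs_nonneg (g x - g y)
      linarith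
    obtain ⟨α, hα, α', hα', hαα', hineq⟩ := hlim hζu
    obtain ⟨r, hr0, hrL, hfin⟩ := hest u v K s β c t x y α α'
      (hu.comp (Continuous.prodMk_right t)) (hv.comp (Continuous.prodMk_right t)) (huM t) (hvM t)
      hβ.le hcpos.le ht hα hα' hmax (by linarith) hineq (R + 1 + M) mR hmR (by linarith)
      (by linarith) (by linarith)
    have hα0 : 0 ≤ ‖α - α'‖ := norm_nonneg _
    have hQ : doublingError c x y α α' ≤ q := by
      have h1 : (‖x - y‖ + ‖α - α'‖) ^ 2 ≤ 2 * ‖x - y‖ ^ 2 + 2 * δ₀ ^ 2 := by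
        have := pow_le_pow_left₀ hα0 hαα' 2
        nlinarith [sq_nonneg (‖x - y‖ - ‖α - α'‖)]
      have h2 := mul_le_mul_of_nonneg_left h1 hcpos.le
      simp only [doublingError]
      linarith
    have hrρ : r ≤ ρ :=
      hrL.trans ((mul_le_mul_of_nonneg_left hQ (by positivity)).trans hqL)
    have h1 := hmRρ r hr0 hrρ
    have h2 := mul_le_mul_of_nonneg_left hQ hQ₀
    have h3 := mul_lt_mul_of_pos_left hgap hC
    linarith
  intro t ht x hx
  have hcl : t ∈ closure (Ico 0 T) := by
    rw [closure_Ico hA.hT.ne]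
    exact ht
  have hclosed : IsClosed {t | u t x ≤ v t x + 3 * κ} :=
    isClosed_le (hu.comp (Continuous.prodMk_left x))
      ((hv.comp (Continuous.prodMk_left x)).add continuous_const)
  exact closure_minimal (fun t ht => main t ht x hx) hclosed hcl

end AssumptionA

end Comparison

section Clamp

variable {ν : Measure (Vec n)} {A : Set (Vec m)} {T : ℝ}
  {b : Vec m → Vec d → Vec d} {σ : Vec m → Vec d → Matrix (Fin d) (Fin d) ℝ}
  {η : Vec m → Vec d → Vec n → Vec d} {γ : Vec d → Vec n → ℝ}
  {f : Vec m → ℝ → Vec d → ℝ → Vec d → ℝ → ℝ}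
  {ζ : ℝ → Vec d → ℝ} {g : Vec d → ℝ} {C : ℝ} {ε : ℝ}

/-- Extension of a function on `[0, T]`, constant in time outside that interval. -/
def clampTime (T : ℝ) (u : ℝ → Vec d → ℝ) (t : ℝ) (x : Vec d) : ℝ := u (max 0 (min T t)) x

lemma clampTime_of_mem {t : ℝ} (ht : t ∈ Icc 0 T) (u : ℝ → Vec d → ℝ) (x : Vec d) :
    clampTime T u t x = u t x := by
  rw [clampTime, min_eq_right ht.2, max_eq_right ht.1]

lemma clamp_mem (hT : 0 ≤ T) (t : ℝ) : max 0 (min T t) ∈ Icc 0 T :=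
  ⟨le_max_left _ _, max_le hT (min_le_left _ _)⟩

lemma clampTime_clamp (hT : 0 ≤ T) (u : ℝ → Vec d → ℝ) (t : ℝ) (x : Vec d) :
    clampTime T u (max 0 (min T t)) x = clampTime T u t x :=
  clampTime_of_mem (clamp_mem hT t) u x

lemma continuous_clampTime (hT : 0 ≤ T) {u : ℝ → Vec d → ℝ}
    (hu : ContinuousOn (fun p : ℝ × Vec d => u p.1 p.2) (Icc 0 T ×ˢ univ)) :
    Continuous fun z : ℝ × Vec d => clampTime T u z.1 z.2 :=
  hu.comp_continuous (f := fun z : ℝ × Vec d => (max 0 (min T z.1), z.2)) (by fun_prop)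
    fun z => ⟨clamp_mem hT z.1, mem_univ _⟩

lemma SubsolnHJBVIe.clampTime {S : Set (Vec m)} {u : ℝ → Vec d → ℝ}
    (h : SubsolnHJBVIe ν S T b σ η γ f ζ ε u) :
    SubsolnHJBVIe ν S T b σ η γ f ζ ε (clampTime T u) := by
  intro φ t₀ x₀ ht₀ hmax
  have ht₀' : t₀ ∈ Icc 0 T := ⟨ht₀.1.le, ht₀.2⟩
  rw [clampTime_of_mem ht₀']
  refine h φ t₀ x₀ ht₀ fun t ht x => ?_
  simpa only [clampTime_of_mem ht, clampTime_of_mem ht₀'] using hmax t ht x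

lemma SupersolnHJBVIe.clampTime {S : Set (Vec m)} {u : ℝ → Vec d → ℝ}
    (h : SupersolnHJBVIe ν S T b σ η γ f ζ ε u) :
    SupersolnHJBVIe ν S T b σ η γ f ζ ε (clampTime T u) := by
  intro φ t₀ x₀ ht₀ hmax
  have ht₀' : t₀ ∈ Icc 0 T := ⟨ht₀.1.le, ht₀.2⟩
  rw [clampTime_of_mem ht₀']
  refine h φ t₀ x₀ ht₀ fun t ht x => ?_
  simpa only [clampTime_of_mem ht, clampTime_of_mem ht₀'] using hmax t ht x

lemma SupersolnJets.mono {S S' : Set (Vec m)} {v : ℝ → Vec d → ℝ}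
    (h : SupersolnJets ν S T b σ η γ f ζ ε v) (hS : S' ⊆ S) :
    SupersolnJets ν S' T b σ η γ f ζ ε v := fun t₀ ht₀ x₀ a p X hJ =>
  ⟨(h t₀ ht₀ x₀ a p X hJ).1, fun α hα => (h t₀ ht₀ x₀ a p X hJ).2 α (hS hα)⟩

end Clamp

/-- Convergence of the finite-control approximation
(Theorem 3.1): `u^{ε,δ} → u^ε` locally uniformly as `δ → 0`. -/
theorem finite_control_approximation_converges
    {n d m : ℕ} (ν : Measure (Vec n)) (A : Set (Vec m)) (T : ℝ)
    (b : Vec m → Vec d → Vec d) (σ : Vec m → Vec d → Matrix (Fin d) (Fin d) ℝ)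
    (η : Vec m → Vec d → Vec n → Vec d) (γ : Vec d → Vec n → ℝ)
    (f : Vec m → ℝ → Vec d → ℝ → Vec d → ℝ → ℝ)
    (ζ : ℝ → Vec d → ℝ) (g : Vec d → ℝ) (C : ℝ)
    (hA : AssumptionA ν A T b σ η γ f ζ g C)
    (ε : ℝ) (hε : ε ∈ Ioo (0:ℝ) 1)
    (Aδ : ℝ → Set (Vec m))
    (hAδ_fin : ∀ δ ∈ Ioc (0:ℝ) 1, (Aδ δ).Finite)
    (hAδ_ne : ∀ δ ∈ Ioc (0:ℝ) 1, (Aδ δ).Nonempty)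
    (hAδ_sub : ∀ δ ∈ Ioc (0:ℝ) 1, Aδ δ ⊆ A)
    (hAδ_dense : ∀ δ ∈ Ioc (0:ℝ) 1, ∀ α ∈ A, ∃ α' ∈ Aδ δ, ‖α - α'‖ < δ)
    -- `uε` is a viscosity solution of the `A`-HJBVI
    (uε : ℝ → Vec d → ℝ)
    (huε_bdd : ∃ M, ∀ t x, |uε t x| ≤ M)
    (huε_cont : ContinuousOn (fun p : ℝ × Vec d => uε p.1 p.2) (Icc 0 T ×ˢ univ))
    (huε_init : ∀ x, uε 0 x = g x)
    (huε_sub : SubsolnHJBVIe ν A T b σ η γ f ζ ε uε)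
    (huε_super : SupersolnHJBVIe ν A T b σ η γ f ζ ε uε)
    -- for each `δ ∈ (0,1]`, `uδ δ` is a viscosity solution of the `A_δ`-HJBVI
    (uδ : ℝ → ℝ → Vec d → ℝ)
    (huδ_cont : ∀ δ ∈ Ioc (0:ℝ) 1,
      ContinuousOn (fun p : ℝ × Vec d => uδ δ p.1 p.2) (Icc 0 T ×ˢ univ))
    (huδ_init : ∀ δ ∈ Ioc (0:ℝ) 1, ∀ x, uδ δ 0 x = g x)
    (huδ_sub : ∀ δ ∈ Ioc (0:ℝ) 1, SubsolnHJBVIe ν (Aδ δ) T b σ η γ f ζ ε (uδ δ))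
    (huδ_super : ∀ δ ∈ Ioc (0:ℝ) 1, SupersolnHJBVIe ν (Aδ δ) T b σ η γ f ζ ε (uδ δ))
    -- uniform boundedness in `δ`
    (huδ_bdd : ∃ M, ∀ δ ∈ Ioc (0:ℝ) 1, ∀ t x, |uδ δ t x| ≤ M) :
    ∀ K : Set (ℝ × Vec d), IsCompact K → K ⊆ Icc 0 T ×ˢ univ →
      TendstoUniformlyOn (fun δ (p : ℝ × Vec d) => uδ δ p.1 p.2)
        (fun p : ℝ × Vec d => uε p.1 p.2) (nhdsWithin 0 (Ioc (0:ℝ) 1)) K := by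
  obtain ⟨M₁, hM₁⟩ := huε_bdd
  obtain ⟨M₂, hM₂⟩ := huδ_bdd
  have hT := hA.hT.le
  have hcε := continuous_clampTime hT huε_cont
  have hbε : ∀ t x, |clampTime T uε t x| ≤ max M₁ M₂ := fun t x =>
    (hM₁ _ x).trans (le_max_left _ _)
  have hiε : ∀ x, clampTime T uε 0 x = g x := fun x =>
    (clampTime_of_mem ⟨le_rfl, hT⟩ uε x).trans (huε_init x)
  have hsubε := hA.subsolnJets hε.1 subset_rfl hA.hAne hcε hbε huε_sub.clampTime
  have hsuperε := hA.supersolnJets hε.1 subset_rfl hcε hbε huε_super.clampTime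
  intro K hK hKT
  obtain ⟨R₀, hR₀⟩ := hK.isBounded.exists_norm_le
  rw [Metric.tendstoUniformlyOn_iff]
  intro κ hκ
  have hκ' : 0 < κ / 6 := by linarith
  obtain ⟨δ₀, hδ₀, hupper⟩ := hA.exists_comparison hε.1 subset_rfl hcε hbε
    (clampTime_clamp hT uε) hsubε hiε hκ' R₀
  filter_upwards [self_mem_nhdsWithin, nhdsWithin_le_nhds (gt_mem_nhds hδ₀)] with δ hδ hδδ₀
  have hcδ := continuous_clampTime hT (huδ_cont δ hδ)
  have hbδ : ∀ t x, |clampTime T (uδ δ) t x| ≤ max M₁ M₂ := fun t x =>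
    (hM₂ δ hδ _ x).trans (le_max_right _ _)
  have hiδ : ∀ x, clampTime T (uδ δ) 0 x = g x := fun x =>
    (clampTime_of_mem ⟨le_rfl, hT⟩ (uδ δ) x).trans (huδ_init δ hδ x)
  have hsubδ := hA.subsolnJets hε.1 (hAδ_sub δ hδ) (hAδ_ne δ hδ) hcδ hbδ (huδ_sub δ hδ).clampTime
  have hsuperδ := hA.supersolnJets hε.1 (hAδ_sub δ hδ) hcδ hbδ (huδ_super δ hδ).clampTime
  obtain ⟨δ₁, hδ₁, hlower⟩ := hA.exists_comparison hε.1 (hAδ_sub δ hδ) hcδ hbδ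
    (clampTime_clamp hT (uδ δ)) hsubδ hiδ hκ' R₀
  rintro ⟨t, x⟩ hz
  have ht : t ∈ Icc 0 T := (hKT hz).1
  have hx : ‖x‖ ≤ R₀ := (norm_snd_le (t, x)).trans (hR₀ _ hz)
  have h1 := hupper (Aδ δ) (hAδ_sub δ hδ)
    (fun α hα => (hAδ_dense δ hδ α hα).imp fun α' h => ⟨h.1, h.2.le.trans hδδ₀.le⟩)
    _ hcδ hbδ (clampTime_clamp hT (uδ δ)) hsuperδ hiδ t ht x hx
  have h2 := hlower (Aδ δ) (hAδ_sub δ hδ) (fun α hα => ⟨α, hα, by simpa using hδ₁.le⟩)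
    _ hcε hbε (clampTime_clamp hT uε) (hsuperε.mono (hAδ_sub δ hδ)) hiε t ht x hx
  rw [clampTime_of_mem ht, clampTime_of_mem ht] at h1 h2
  rw [Real.dist_eq, abs_lt]
  constructor <;> linarith
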